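/- arXiv:1002.2291 — 4 statements merged into one kernel-verified Lean document; each statement's English description precedes it below -/
import Mathlib

section
/- For all integers i, k, n with 1 ≤ i, i ≤ k and i ≤ n − 1, the fundamental group of F_{k+1}^{i,i+1} is isomorphic to the fundamental group of F_{k+1}^{i,n} (at corresponding basepoints, the configuration spaces being path-connected). -/
noncomputable section

open Module Submodule

/-- Topology on the projectivization (quotient topology). -/
instance (K V : Type*) [DivisionRing K] [AddCommGroup V] [Module K V] [TopologicalSpace V] :
    TopologicalSpace (Projectivization K V) :=
  inferInstanceAs (TopologicalSpace (Quotient (projectivizationSetoid K V)))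

/-- The complex projective space `ℂP^n`. -/
abbrev CP (n : ℕ) := Projectivization ℂ (Fin (n + 1) → ℂ)

/-- `Fconf k i n` is the ordered configuration space `F_k^{i,n}` of `k` pairwise distinct
points of `ℂP^n` whose projective span has dimension `i` (i.e. the span of representative
vectors has linear dimension `i + 1`). -/
def Fconf (k i n : ℕ) : Set (Fin k → CP n) :=
  {x | Function.Injective x ∧
    finrank ℂ (span ℂ (Set.range fun j => (x j).rep)) = i + 1}

open Matrix Set Topology unitInterval

/-! ### Injective matrices and their Moore–Penrose inverses -/

section Frames

variable {N m k : ℕ}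

/-- The set of `N × m` complex matrices with linearly independent columns. -/
def frameSet (N m : ℕ) : Set (Matrix (Fin N) (Fin m) ℂ) :=
  {A | Function.Injective A.mulVec}

lemma mem_frameSet_iff {A : Matrix (Fin N) (Fin m) ℂ} :
    A ∈ frameSet N m ↔ ∀ v, A *ᵥ v = 0 → v = 0 :=
  injective_iff_map_eq_zero A.mulVecLin

open scoped ComplexOrder in
lemma mem_frameSet_iff_det_ne_zero {A : Matrix (Fin N) (Fin m) ℂ} :
    A ∈ frameSet N m ↔ (Aᴴ * A).det ≠ 0 := by
  rw [← isUnit_iff_ne_zero, ← Matrix.isUnit_iff_isUnit_det, ← Matrix.mulVec_injective_iff_isUnit,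
    mem_frameSet_iff]
  refine Iff.trans ?_ (injective_iff_map_eq_zero (Aᴴ * A).mulVecLin).symm
  exact forall_congr' fun v => by
    rw [mulVecLin_apply, Matrix.conjTranspose_mul_self_mulVec_eq_zero]

lemma isOpen_frameSet : IsOpen (frameSet N m) := by
  have h : frameSet N m = {A | (Aᴴ * A).det ≠ 0} := by
    ext A
    exact mem_frameSet_iff_det_ne_zero
  rw [h]
  exact isOpen_ne_fun (by fun_prop) continuous_const

lemma mem_frameSet_of_mul {A : Matrix (Fin N) (Fin m) ℂ} {L : Matrix (Fin k) (Fin N) ℂ}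
    (h : L * A ∈ frameSet k m) : A ∈ frameSet N m := by
  rw [mem_frameSet_iff] at h ⊢
  intro v hv
  exact h v (by rw [← mulVec_mulVec, hv, mulVec_zero])

lemma mul_mem_frameSet {A : Matrix (Fin N) (Fin m) ℂ} {L : Matrix (Fin k) (Fin N) ℂ}
    (hL : L ∈ frameSet k N) (hA : A ∈ frameSet N m) : L * A ∈ frameSet k m := by
  rw [mem_frameSet_iff] at *
  intro v hv
  rw [← mulVec_mulVec] at hv
  exact hA v (hL _ hv)

/-- The Moore–Penrose inverse of a matrix with linearly independent columns. -/
def pinv (A : Matrix (Fin N) (Fin m) ℂ) : Matrix (Fin m) (Fin N) ℂ :=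
  (Aᴴ * A)⁻¹ * Aᴴ

lemma pinv_mul_self {A : Matrix (Fin N) (Fin m) ℂ} (hA : A ∈ frameSet N m) : pinv A * A = 1 := by
  rw [pinv, Matrix.mul_assoc]
  exact Matrix.nonsing_inv_mul _ (isUnit_iff_ne_zero.2 (mem_frameSet_iff_det_ne_zero.1 hA))

lemma continuousOn_pinv : ContinuousOn (pinv (N := N) (m := m)) (frameSet N m) := by
  have h : ∀ A : Matrix (Fin N) (Fin m) ℂ,
      pinv A = (Aᴴ * A).det⁻¹ • (Aᴴ * A).adjugate * Aᴴ := by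
    intro A
    rw [pinv, Matrix.inv_def, Ring.inverse_eq_inv']
  rw [show pinv (N := N) (m := m) = _ from funext h]
  intro A hA
  have hdet : ContinuousAt (fun A : Matrix (Fin N) (Fin m) ℂ => (Aᴴ * A).det⁻¹) A :=
    ContinuousAt.inv₀ (Continuous.continuousAt (by fun_prop)) (mem_frameSet_iff_det_ne_zero.1 hA)
  have hadj : Continuous (fun A : Matrix (Fin N) (Fin m) ℂ => (Aᴴ * A).adjugate) :=
    Continuous.matrix_adjugate (by fun_prop)
  have hmul : Continuous (fun p : Matrix (Fin m) (Fin m) ℂ × Matrix (Fin m) (Fin N) ℂ =>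
      p.1 * p.2) := by fun_prop
  exact (hmul.continuousAt.comp ((hdet.smul hadj.continuousAt).prodMk
    (Continuous.continuousAt (f := fun A : Matrix (Fin N) (Fin m) ℂ => Aᴴ)
      (by fun_prop)))).continuousWithinAt

lemma Continuous.pinv {Y : Type*} [TopologicalSpace Y] {A : Y → Matrix (Fin N) (Fin m) ℂ}
    (hA : Continuous A) (h : ∀ y, A y ∈ frameSet N m) : Continuous fun y => _root_.pinv (A y) :=
  continuousOn_pinv.comp_continuous hA h

/-- The orthogonal projection onto the column space of a matrix with independent columns. -/
def colProj (A : Matrix (Fin N) (Fin m) ℂ) : Matrix (Fin N) (Fin N) ℂ := A * pinv A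

lemma colProj_mul_self {A : Matrix (Fin N) (Fin m) ℂ} (hA : A ∈ frameSet N m) :
    colProj A * A = A := by
  rw [colProj, Matrix.mul_assoc, pinv_mul_self hA, Matrix.mul_one]

lemma colProj_mulVec_of_mem {A : Matrix (Fin N) (Fin m) ℂ} (hA : A ∈ frameSet N m)
    {w : Fin N → ℂ} (hw : w ∈ LinearMap.range A.mulVecLin) : colProj A *ᵥ w = w := by
  obtain ⟨v, rfl⟩ := hw
  rw [mulVecLin_apply, mulVec_mulVec, colProj_mul_self hA]

lemma colProj_mulVec_mem (A : Matrix (Fin N) (Fin m) ℂ) (w : Fin N → ℂ) :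
    colProj A *ᵥ w ∈ LinearMap.range A.mulVecLin :=
  ⟨pinv A *ᵥ w, by rw [mulVecLin_apply, mulVec_mulVec, colProj]⟩

lemma colProj_conjTranspose (A : Matrix (Fin N) (Fin m) ℂ) : (colProj A)ᴴ = colProj A := by
  simp [colProj, pinv, Matrix.conjTranspose_nonsing_inv, Matrix.mul_assoc]

lemma colProj_mul_colProj_of_range_le {A B : Matrix (Fin N) (Fin m) ℂ} (hA : A ∈ frameSet N m)
    (h : LinearMap.range B.mulVecLin ≤ LinearMap.range A.mulVecLin) :
    colProj A * colProj B = colProj B := by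
  refine Matrix.ext_of_mulVec_single fun i => ?_
  rw [← mulVec_mulVec]
  exact colProj_mulVec_of_mem hA (h (colProj_mulVec_mem B _))

lemma colProj_mul_colProj_self {A : Matrix (Fin N) (Fin m) ℂ} (hA : A ∈ frameSet N m) :
    colProj A * colProj A = colProj A :=
  colProj_mul_colProj_of_range_le hA le_rfl

lemma colProj_eq_of_range_eq {A B : Matrix (Fin N) (Fin m) ℂ} (hA : A ∈ frameSet N m)
    (hB : B ∈ frameSet N m) (h : LinearMap.range A.mulVecLin = LinearMap.range B.mulVecLin) :
    colProj A = colProj B := by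
  rw [← colProj_conjTranspose A, ← colProj_mul_colProj_of_range_le hB h.le,
    Matrix.conjTranspose_mul, colProj_conjTranspose, colProj_conjTranspose,
    colProj_mul_colProj_of_range_le hA h.ge]

end Frames

/-! ### The projective space and the action of matrices on it -/

section Action

variable {a b c : ℕ}

lemma continuous_projectivization_mk {Y : Type*} [TopologicalSpace Y] {f : Y → Fin (a + 1) → ℂ}
    (hf : Continuous f) (h : ∀ y, f y ≠ 0) :
    Continuous fun y => Projectivization.mk ℂ (f y) (h y) :=
  continuous_quotient_mk'.comp (hf.subtype_mk h)

/-- The orthogonal projection onto the line spanned by a nonzero vector. -/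
def vecProj (v : Fin (a + 1) → ℂ) : Matrix (Fin (a + 1)) (Fin (a + 1)) ℂ :=
  (star v ⬝ᵥ v)⁻¹ • vecMulVec v (star v)

open scoped ComplexOrder in
lemma star_dotProduct_self_ne_zero {v : Fin (a + 1) → ℂ} (hv : v ≠ 0) : star v ⬝ᵥ v ≠ 0 :=
  fun h => hv (dotProduct_star_self_eq_zero.1 (dotProduct_comm v (star v) ▸ h))

lemma vecProj_mulVec (v w : Fin (a + 1) → ℂ) :
    vecProj v *ᵥ w = ((star v ⬝ᵥ v)⁻¹ * (star v ⬝ᵥ w)) • v := by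
  rw [vecProj, smul_mulVec, vecMulVec_mulVec, op_smul_eq_smul, smul_smul]

lemma vecProj_smul {t : ℂ} (ht : t ≠ 0) (v : Fin (a + 1) → ℂ) : vecProj (t • v) = vecProj v := by
  have ht' : star t ≠ 0 := star_ne_zero.2 ht
  rw [vecProj, vecProj, star_smul, smul_vecMulVec, vecMulVec_smul, smul_dotProduct,
    dotProduct_smul, smul_smul, smul_smul]
  congr 1
  by_cases h : star v ⬝ᵥ v = 0
  · simp [h]
  · simp only [smul_eq_mul]
    field_simp

/-- The orthogonal projection onto the line of `ℂ^{a+1}` given by a point of `ℂP^a`. -/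
def lineProj (p : CP a) : Matrix (Fin (a + 1)) (Fin (a + 1)) ℂ := vecProj p.rep

lemma lineProj_mk {v : Fin (a + 1) → ℂ} (hv : v ≠ 0) :
    lineProj (Projectivization.mk ℂ v hv) = vecProj v := by
  obtain ⟨t, ht⟩ := Projectivization.exists_smul_eq_mk_rep ℂ v hv
  rw [lineProj, ← ht, Units.smul_def, vecProj_smul t.ne_zero]

lemma continuous_lineProj : Continuous (lineProj (a := a)) := by
  refine (isQuotientMap_quotient_mk'
    (s := projectivizationSetoid ℂ (Fin (a + 1) → ℂ))).continuous_iff.2 ?_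
  have h : lineProj ∘ (Quotient.mk' (s := projectivizationSetoid ℂ (Fin (a + 1) → ℂ))) =
      fun v => vecProj v.1 := funext fun v => lineProj_mk v.2
  refine (congrArg Continuous h).mpr ?_
  have hd : Continuous fun v : {v : Fin (a + 1) → ℂ // v ≠ 0} => (star v.1 ⬝ᵥ v.1)⁻¹ :=
    Continuous.inv₀ (by fun_prop) fun v => star_dotProduct_self_ne_zero v.2
  exact hd.smul (Continuous.matrix_vecMulVec (by fun_prop) (by fun_prop))

lemma lineProj_mulVec_rep (p : CP a) : lineProj p *ᵥ p.rep = p.rep := by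
  rw [lineProj, vecProj_mulVec,
    inv_mul_cancel₀ (star_dotProduct_self_ne_zero p.rep_nonzero), one_smul]

lemma exists_lineProj_mulVec_eq (p : CP a) (w : Fin (a + 1) → ℂ) :
    ∃ t : ℂ, lineProj p *ᵥ w = t • p.rep :=
  ⟨_, vecProj_mulVec _ _⟩

/-- The image of a point of `ℂP^a` under a matrix, with a junk value if the
corresponding line is in the kernel. -/
def act (L : Matrix (Fin (b + 1)) (Fin (a + 1)) ℂ) (p : CP a) : CP b :=
  if h : L *ᵥ p.rep ≠ 0 then Projectivization.mk ℂ (L *ᵥ p.rep) h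
  else Projectivization.mk ℂ 1 one_ne_zero

lemma act_mk {L : Matrix (Fin (b + 1)) (Fin (a + 1)) ℂ} {v : Fin (a + 1) → ℂ} (hv : v ≠ 0)
    (h : L *ᵥ v ≠ 0) :
    act L (Projectivization.mk ℂ v hv) = Projectivization.mk ℂ (L *ᵥ v) h := by
  obtain ⟨t, ht⟩ := Projectivization.exists_smul_eq_mk_rep ℂ v hv
  have h' : L *ᵥ (Projectivization.mk ℂ v hv).rep = t • (L *ᵥ v) := by
    rw [← ht, Units.smul_def, mulVec_smul, Units.smul_def]
  have hne : L *ᵥ (Projectivization.mk ℂ v hv).rep ≠ 0 := by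
    rw [h', Units.smul_def]
    exact smul_ne_zero t.ne_zero h
  rw [act, dif_pos hne, Projectivization.mk_eq_mk_iff]
  exact ⟨t, h'.symm⟩

lemma act_of_ne_zero {L : Matrix (Fin (b + 1)) (Fin (a + 1)) ℂ} {p : CP a}
    (h : L *ᵥ p.rep ≠ 0) : act L p = Projectivization.mk ℂ (L *ᵥ p.rep) h :=
  dif_pos h

lemma act_act {L : Matrix (Fin (b + 1)) (Fin (a + 1)) ℂ} {L' : Matrix (Fin (c + 1)) (Fin (b + 1)) ℂ}
    {p : CP a} (h : (L' * L) *ᵥ p.rep ≠ 0) : act L' (act L p) = act (L' * L) p := by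
  have h₁ : L *ᵥ p.rep ≠ 0 := by
    intro h0
    rw [← mulVec_mulVec, h0, mulVec_zero] at h
    exact h rfl
  have h₂ : L' *ᵥ (L *ᵥ p.rep) ≠ 0 := by rwa [mulVec_mulVec]
  rw [act_of_ne_zero h₁, act_mk h₁ h₂, act_of_ne_zero h]
  congr 1
  exact mulVec_mulVec _ _ _

lemma act_eq_self {L : Matrix (Fin (a + 1)) (Fin (a + 1)) ℂ} {p : CP a}
    (h : L *ᵥ p.rep = p.rep) : act L p = p := by
  rw [act_of_ne_zero (h.symm ▸ p.rep_nonzero)]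
  conv_rhs => rw [← p.mk_rep]
  congr 1

lemma Continuous.act {Y : Type*} [TopologicalSpace Y]
    {L : Y → Matrix (Fin (b + 1)) (Fin (a + 1)) ℂ} {p : Y → CP a} (hL : Continuous L)
    (hp : Continuous p) (h : ∀ y, L y *ᵥ (p y).rep ≠ 0) :
    Continuous fun y => _root_.act (L y) (p y) := by
  refine continuous_iff_continuousAt.2 fun y₀ => ?_
  set v := (p y₀).rep with hv
  have hw : Continuous fun y => lineProj (p y) *ᵥ v :=
    (continuous_lineProj.comp hp).matrix_mulVec continuous_const
  have hopen : IsOpen {y | lineProj (p y) *ᵥ v ≠ 0} := isOpen_ne_fun hw continuous_const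
  have hmem : y₀ ∈ {y | lineProj (p y) *ᵥ v ≠ 0} := by
    simpa [hv, lineProj_mulVec_rep] using (p y₀).rep_nonzero
  have key : ∀ y (hy : lineProj (p y) *ᵥ v ≠ 0), L y *ᵥ (lineProj (p y) *ᵥ v) ≠ 0 ∧
      Projectivization.mk ℂ _ hy = p y := by
    intro y hy
    obtain ⟨t, ht⟩ := exists_lineProj_mulVec_eq (p y) v
    have ht0 : t ≠ 0 := by
      rintro rfl
      exact hy (by rw [ht, zero_smul])
    refine ⟨?_, ?_⟩
    · rw [ht, mulVec_smul]
      exact smul_ne_zero ht0 (h y)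
    · conv_rhs => rw [← (p y).mk_rep]
      rw [Projectivization.mk_eq_mk_iff']
      exact ⟨t, ht.symm⟩
  refine (hopen.continuousOn_iff.1 ?_) hmem
  rw [continuousOn_iff_continuous_domRestrict]
  have heq : ({y | lineProj (p y) *ᵥ v ≠ 0}.domRestrict fun y => _root_.act (L y) (p y)) =
      fun y => Projectivization.mk ℂ (L y.1 *ᵥ (lineProj (p y.1) *ᵥ v)) (key y.1 y.2).1 := by
    funext y
    rw [Set.domRestrict_apply, ← act_mk y.2]
    rw [(key y.1 y.2).2]
  rw [heq]
  exact continuous_projectivization_mk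
    ((hL.comp continuous_subtype_val).matrix_mulVec (hw.comp continuous_subtype_val)) _

end Action

/-! ### Frames of configurations -/

section Configurations

variable {k i n r : ℕ}

/-- The linear span of a configuration. -/
def configSpan (x : Fin k → CP n) : Submodule ℂ (Fin (n + 1) → ℂ) :=
  span ℂ (Set.range fun j => (x j).rep)

lemma rep_mem_configSpan (x : Fin k → CP n) (j : Fin k) : (x j).rep ∈ configSpan x :=
  subset_span ⟨j, rfl⟩

lemma configSpan_eq_iSup (x : Fin k → CP n) : configSpan x = ⨆ j, (x j).submodule := by
  simp_rw [configSpan, span_range_eq_iSup, Projectivization.submodule_eq]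

/-- The columns of `A` form a basis of the linear span of `x`. -/
structure IsFrame (A : Matrix (Fin (n + 1)) (Fin (i + 1)) ℂ) (x : Fin k → CP n) : Prop where
  mem_frameSet : A ∈ frameSet (n + 1) (i + 1)
  range_eq : LinearMap.range A.mulVecLin = configSpan x

lemma finrank_range_of_mem_frameSet {N m : ℕ} {A : Matrix (Fin N) (Fin m) ℂ}
    (hA : A ∈ frameSet N m) : finrank ℂ (LinearMap.range A.mulVecLin) = m := by
  rw [LinearMap.finrank_range_of_inj (f := A.mulVecLin) hA, finrank_fin_fun]

lemma isFrame_of_range_le {A : Matrix (Fin (n + 1)) (Fin (i + 1)) ℂ} {x : Fin k → CP n}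
    (hx : x ∈ Fconf k i n) (hA : A ∈ frameSet (n + 1) (i + 1))
    (h : LinearMap.range A.mulVecLin ≤ configSpan x) : IsFrame A x :=
  ⟨hA, Submodule.eq_of_le_of_finrank_eq h ((finrank_range_of_mem_frameSet hA).trans hx.2.symm)⟩

lemma IsFrame.finrank_configSpan {A : Matrix (Fin (n + 1)) (Fin (i + 1)) ℂ} {x : Fin k → CP n}
    (h : IsFrame A x) : finrank ℂ (configSpan x) = i + 1 := by
  rw [← h.range_eq, finrank_range_of_mem_frameSet h.mem_frameSet]

lemma IsFrame.colProj_mulVec_rep {A : Matrix (Fin (n + 1)) (Fin (i + 1)) ℂ} {x : Fin k → CP n}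
    (h : IsFrame A x) (j : Fin k) : colProj A *ᵥ (x j).rep = (x j).rep :=
  colProj_mulVec_of_mem h.mem_frameSet (h.range_eq ▸ rep_mem_configSpan x j)

lemma IsFrame.eq_zero_of_mulVec {A : Matrix (Fin (n + 1)) (Fin (i + 1)) ℂ} {x : Fin k → CP n}
    {L : Matrix (Fin (r + 1)) (Fin (n + 1)) ℂ} (h : IsFrame A x)
    (hL : L * A ∈ frameSet (r + 1) (i + 1)) {w : Fin (n + 1) → ℂ} (hw : w ∈ configSpan x)
    (hLw : L *ᵥ w = 0) : w = 0 := by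
  rw [← h.range_eq] at hw
  obtain ⟨v, rfl⟩ := hw
  rw [mulVecLin_apply, mulVec_mulVec] at hLw
  rw [mem_frameSet_iff.1 hL v hLw, map_zero]

lemma IsFrame.mulVec_rep_ne_zero {A : Matrix (Fin (n + 1)) (Fin (i + 1)) ℂ} {x : Fin k → CP n}
    {L : Matrix (Fin (r + 1)) (Fin (n + 1)) ℂ} (h : IsFrame A x)
    (hL : L * A ∈ frameSet (r + 1) (i + 1)) (j : Fin k) : L *ᵥ (x j).rep ≠ 0 :=
  fun h0 => (x j).rep_nonzero (h.eq_zero_of_mulVec hL (rep_mem_configSpan x j) h0)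

lemma IsFrame.act {A : Matrix (Fin (n + 1)) (Fin (i + 1)) ℂ} {x : Fin k → CP n}
    {L : Matrix (Fin (r + 1)) (Fin (n + 1)) ℂ} (h : IsFrame A x)
    (hL : L * A ∈ frameSet (r + 1) (i + 1)) : IsFrame (L * A) fun j => _root_.act L (x j) := by
  refine ⟨hL, ?_⟩
  rw [Matrix.mulVecLin_mul, LinearMap.range_comp, h.range_eq, configSpan_eq_iSup,
    configSpan_eq_iSup, Submodule.map_iSup]
  refine iSup_congr fun j => ?_
  rw [act_of_ne_zero (h.mulVec_rep_ne_zero hL j), Projectivization.submodule_mk,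
    Projectivization.submodule_eq, Submodule.map_span, Set.image_singleton, mulVecLin_apply]

lemma IsFrame.act_mem_Fconf {A : Matrix (Fin (n + 1)) (Fin (i + 1)) ℂ} {x : Fin k → CP n}
    {L : Matrix (Fin (r + 1)) (Fin (n + 1)) ℂ} (h : IsFrame A x) (hx : Function.Injective x)
    (hL : L * A ∈ frameSet (r + 1) (i + 1)) : (fun j => _root_.act L (x j)) ∈ Fconf k i r := by
  refine ⟨fun j l hjl => hx ?_, (h.act hL).finrank_configSpan⟩
  simp only [act_of_ne_zero (h.mulVec_rep_ne_zero hL _)] at hjl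
  obtain ⟨t, ht⟩ := (Projectivization.mk_eq_mk_iff' ℂ _ _ _ _).1 hjl
  rw [← mulVec_smul, ← sub_eq_zero, ← mulVec_sub] at ht
  have := h.eq_zero_of_mulVec hL (sub_mem (smul_mem _ t (rep_mem_configSpan x l))
    (rep_mem_configSpan x j)) ht
  rw [← (x j).mk_rep, ← (x l).mk_rep, Projectivization.mk_eq_mk_iff']
  exact ⟨t, sub_eq_zero.1 this⟩

lemma exists_linearIndependent_reps {x : Fin k → CP n} (hx : x ∈ Fconf k i n) :
    ∃ j : Fin (i + 1) → Fin k, LinearIndependent ℂ fun l => (x (j l)).rep := by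
  obtain ⟨f, hf, -, hli⟩ := exists_fun_fin_finrank_span_eq ℂ (Set.range fun j => (x j).rep)
  choose j hj using hf
  obtain rfl : (fun l => (x (j l)).rep) = f := funext hj
  exact ⟨j ∘ Fin.cast hx.2.symm, hli.comp _ (Fin.cast_injective hx.2.symm)⟩

lemma transpose_of_mem_frameSet_iff {N m : ℕ} {v : Fin m → Fin N → ℂ} :
    (Matrix.of v)ᵀ ∈ frameSet N m ↔ LinearIndependent ℂ v :=
  Matrix.mulVec_injective_iff

lemma range_transpose_of_le {N m : ℕ} {v : Fin m → Fin N → ℂ} {W : Submodule ℂ (Fin N → ℂ)}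
    (h : ∀ l, v l ∈ W) : LinearMap.range (Matrix.of v)ᵀ.mulVecLin ≤ W := by
  rw [Matrix.range_mulVecLin, span_le]
  rintro _ ⟨l, rfl⟩
  exact h l

lemma exists_continuous_eventually_isFrame (x₀ : Fconf k i n) :
    ∃ A : Fconf k i n → Matrix (Fin (n + 1)) (Fin (i + 1)) ℂ, Continuous A ∧
      ∀ᶠ x in 𝓝 x₀, IsFrame (A x) x.1 := by
  obtain ⟨j, hj⟩ := exists_linearIndependent_reps x₀.2
  let v : Fconf k i n → Fin (i + 1) → Fin (n + 1) → ℂ := fun x l =>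
    lineProj (x.1 (j l)) *ᵥ (x₀.1 (j l)).rep
  have hv : Continuous v := by
    refine continuous_pi fun l => Continuous.matrix_mulVec ?_ continuous_const
    exact continuous_lineProj.comp ((continuous_apply _).comp continuous_subtype_val)
  have hA : Continuous fun x => (Matrix.of (v x))ᵀ := Continuous.matrix_transpose hv
  refine ⟨_, hA, ?_⟩
  have h₀ : (Matrix.of (v x₀))ᵀ ∈ frameSet (n + 1) (i + 1) := by
    rw [transpose_of_mem_frameSet_iff]
    simpa only [v, lineProj_mulVec_rep] using hj
  filter_upwards [hA.continuousAt.eventually (isOpen_frameSet.mem_nhds h₀)] with x hx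
  refine isFrame_of_range_le x.2 hx (range_transpose_of_le fun l => ?_)
  obtain ⟨t, ht⟩ := exists_lineProj_mulVec_eq (x.1 (j l)) (x₀.1 (j l)).rep
  exact (congrArg (· ∈ configSpan x.1) ht).mpr <| smul_mem _ t (rep_mem_configSpan x.1 (j l))

lemma exists_isFrame (x : Fconf k i n) :
    ∃ A : Matrix (Fin (n + 1)) (Fin (i + 1)) ℂ, IsFrame A x.1 :=
  let ⟨A, _, h⟩ := exists_continuous_eventually_isFrame x
  ⟨A x, h.self_of_nhds⟩

/-- The orthogonal projection onto the linear span of a configuration. -/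
def configProj (x : Fconf k i n) : Matrix (Fin (n + 1)) (Fin (n + 1)) ℂ :=
  colProj (exists_isFrame x).choose

lemma IsFrame.configProj_eq {x : Fconf k i n} {A : Matrix (Fin (n + 1)) (Fin (i + 1)) ℂ}
    (h : IsFrame A x.1) : configProj x = colProj A :=
  have h' := (exists_isFrame x).choose_spec
  colProj_eq_of_range_eq h'.mem_frameSet h.mem_frameSet (h'.range_eq.trans h.range_eq.symm)

lemma IsFrame.configProj_mul {x : Fconf k i n} {A : Matrix (Fin (n + 1)) (Fin (i + 1)) ℂ}
    (h : IsFrame A x.1) : configProj x * A = A := by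
  rw [h.configProj_eq, colProj_mul_self h.mem_frameSet]

lemma configProj_mul_self (x : Fconf k i n) : configProj x * configProj x = configProj x :=
  colProj_mul_colProj_self (exists_isFrame x).choose_spec.mem_frameSet

lemma configProj_mulVec_mem (x : Fconf k i n) (w : Fin (n + 1) → ℂ) :
    configProj x *ᵥ w ∈ configSpan x.1 :=
  (exists_isFrame x).choose_spec.range_eq ▸ colProj_mulVec_mem _ w

lemma continuous_configProj : Continuous (configProj (k := k) (i := i) (n := n)) := by
  refine continuous_iff_continuousAt.2 fun x₀ => ?_
  obtain ⟨A, hA, hframe⟩ := exists_continuous_eventually_isFrame x₀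
  have hmem := hframe.self_of_nhds.mem_frameSet
  have hpinv : ContinuousAt (fun x => pinv (A x)) x₀ :=
    ContinuousAt.comp (f := A) (continuousOn_pinv.continuousAt (isOpen_frameSet.mem_nhds hmem))
      hA.continuousAt
  have hmul : Continuous fun p : Matrix (Fin (n + 1)) (Fin (i + 1)) ℂ ×
      Matrix (Fin (i + 1)) (Fin (n + 1)) ℂ => p.1 * p.2 := by fun_prop
  refine (hmul.continuousAt.comp (hA.continuousAt.prodMk hpinv)).congr ?_
  filter_upwards [hframe] with x hx
  exact hx.configProj_eq.symm

/-- If the orthogonal projection `P` onto the span of `x` is close enough to the orthogonal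
projection `Q` onto the span of `x'`, then `P` maps frames of `x'` to frames of `x`. -/
lemma IsFrame.configProj_mul_isFrame {x x' : Fconf k i n}
    {A : Matrix (Fin (n + 1)) (Fin (i + 1)) ℂ} (h : IsFrame A x'.1)
    (hdet : (configProj x * configProj x' +
      (1 - configProj x) * (1 - configProj x')).det ≠ 0) :
    IsFrame (configProj x * A) x.1 := by
  refine isFrame_of_range_le x.2 (mem_frameSet_iff.2 fun v hv => ?_) ?_
  · have hA : configProj x' *ᵥ (A *ᵥ v) = A *ᵥ v := by
      rw [mulVec_mulVec, h.configProj_mul]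
    rw [← mulVec_mulVec] at hv
    refine mem_frameSet_iff.1 h.mem_frameSet v
      (Matrix.eq_zero_of_mulVec_eq_zero hdet ?_)
    rw [add_mulVec, ← mulVec_mulVec, ← mulVec_mulVec, sub_mulVec 1 (configProj x'), hA, hv]
    simp
  · rintro _ ⟨v, rfl⟩
    rw [mulVecLin_apply, ← mulVec_mulVec]
    exact configProj_mulVec_mem x _

end Configurations

/-! ### Lifting homotopies of configurations to frames -/

section Lifting

variable {k i n : ℕ} {Y : Type*}

/-- Successive orthogonal projections of a frame along a subdivision `t` of the interval. -/
def transport (H : I × Y → Fconf k i n) (A₀ : Y → Matrix (Fin (n + 1)) (Fin (i + 1)) ℂ)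
    (t : ℕ → I) : ℕ → I × Y → Matrix (Fin (n + 1)) (Fin (i + 1)) ℂ
  | 0, u => A₀ u.2
  | r + 1, u => configProj (H (min u.1 (t (r + 1)), u.2)) * transport H A₀ t r u

lemma continuous_transport [TopologicalSpace Y] {H : I × Y → Fconf k i n} (hH : Continuous H)
    {A₀ : Y → Matrix (Fin (n + 1)) (Fin (i + 1)) ℂ} (hA₀ : Continuous A₀) (t : ℕ → I) (r : ℕ) :
    Continuous (transport H A₀ t r) := by
  induction r with
  | zero => exact hA₀.comp continuous_snd
  | succ r ih =>
    exact (continuous_configProj.comp (hH.comp (by fun_prop))).matrix_mul ih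

lemma transport_eq_of_forall_eq {H : I × Y → Fconf k i n}
    {A₀ : Y → Matrix (Fin (n + 1)) (Fin (i + 1)) ℂ} {y : Y} (hA₀ : IsFrame (A₀ y) (H (0, y)).1)
    (h : ∀ s, H (s, y) = H (0, y)) (t : ℕ → I) (r : ℕ) (s : I) :
    transport H A₀ t r (s, y) = A₀ y := by
  induction r with
  | zero => rfl
  | succ r ih => rw [transport, ih, h, hA₀.configProj_mul]

/-- Homotopy lifting for the bundle of frames over the configuration space; the lift is
stationary wherever the homotopy is. -/
lemma exists_frame_lift [TopologicalSpace Y] [CompactSpace Y] {H : I × Y → Fconf k i n}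
    (hH : Continuous H) {A₀ : Y → Matrix (Fin (n + 1)) (Fin (i + 1)) ℂ} (hA₀ : Continuous A₀)
    (hframe : ∀ y, IsFrame (A₀ y) (H (0, y)).1) :
    ∃ A : I × Y → Matrix (Fin (n + 1)) (Fin (i + 1)) ℂ, Continuous A ∧
      (∀ u, IsFrame (A u) (H u).1) ∧ (∀ y, A (0, y) = A₀ y) ∧
      ∀ y, (∀ s, H (s, y) = H (0, y)) → ∀ s, A (s, y) = A₀ y := by
  let P : I → Y → Matrix (Fin (n + 1)) (Fin (n + 1)) ℂ := fun s y => configProj (H (s, y))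
  have hP : Continuous fun u : I × Y => P u.1 u.2 := continuous_configProj.comp hH
  let G : Set ((I × I) × Y) :=
    {u | (P u.1.1 u.2 * P u.1.2 u.2 + (1 - P u.1.1 u.2) * (1 - P u.1.2 u.2)).det ≠ 0}
  have hG : IsOpen G := by
    have h₁ : Continuous fun u : (I × I) × Y => P u.1.1 u.2 :=
      hP.comp (f := fun u : (I × I) × Y => (u.1.1, u.2)) (by fun_prop)
    have h₂ : Continuous fun u : (I × I) × Y => P u.1.2 u.2 :=
      hP.comp (f := fun u : (I × I) × Y => (u.1.2, u.2)) (by fun_prop)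
    exact isOpen_ne_fun (by fun_prop) continuous_const
  have hdiag : ∀ s y, ((s, s), y) ∈ G := by
    intro s y
    have h : P s y * P s y = P s y := configProj_mul_self _
    have : P s y * P s y + (1 - P s y) * (1 - P s y) = 1 := by
      rw [mul_sub, sub_mul, sub_mul, h]
      simp
    simp [G, this]
  have htube : ∀ s : I, ∃ U : Set I, IsOpen U ∧ s ∈ U ∧
      ∀ a ∈ U, ∀ b ∈ U, ∀ y, ((a, b), y) ∈ G := by
    intro s
    obtain ⟨U, W, hU, -, hsU, hW, hUW⟩ := generalized_tube_lemma (s := {((s, s) : I × I)})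
      isCompact_singleton (isCompact_univ (X := Y)) hG (by
        rintro ⟨_, y⟩ ⟨rfl, -⟩
        exact hdiag s y)
    obtain ⟨U₁, U₂, hU₁, hs₁, hU₂, hs₂, hsub⟩ :=
      mem_nhds_prod_iff'.1 (hU.mem_nhds (singleton_subset_iff.1 hsU))
    exact ⟨U₁ ∩ U₂, hU₁.inter hU₂, ⟨hs₁, hs₂⟩, fun a ha b hb y =>
      hUW ⟨hsub ⟨ha.1, hb.2⟩, hW (mem_univ y)⟩⟩
  choose U hUo hsU hUG using htube
  obtain ⟨t, ht0, hmono, ⟨r, hr⟩, ht⟩ := exists_monotone_Icc_subset_open_cover_unitInterval hUo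
    fun s _ => mem_iUnion.2 ⟨s, hsU s⟩
  have key : ∀ r (u : I × Y), IsFrame (transport H A₀ t r u) (H (min u.1 (t r), u.2)).1 := by
    intro r u
    induction r with
    | zero =>
      rw [ht0, min_eq_right unitInterval.nonneg']
      exact hframe u.2
    | succ r ih =>
      rcases le_total u.1 (t r) with hle | hle
      · rw [min_eq_left hle] at ih
        rw [transport, min_eq_left (hle.trans (hmono r.le_succ)), ih.configProj_mul]
        exact ih
      · obtain ⟨s, hs⟩ := ht r
        refine ih.configProj_mul_isFrame (hUG s _ (hs ⟨?_, min_le_right _ _⟩) _ (hs ⟨?_, ?_⟩) u.2)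
        · exact le_min hle (hmono r.le_succ)
        · rw [min_eq_right hle]
        · rw [min_eq_right hle]
          exact hmono r.le_succ
  refine ⟨transport H A₀ t r, continuous_transport hH hA₀ t r, fun u => ?_, fun y => ?_,
    fun y hy s => transport_eq_of_forall_eq (hframe y) hy t r s⟩
  · have := key r u
    rwa [hr r le_rfl, min_eq_left unitInterval.le_one'] at this
  · have : ∀ r, transport H A₀ t r (0, y) = A₀ y := by
      intro r
      induction r with
      | zero => rfl
      | succ r ih =>
        rw [transport, ih, min_eq_left unitInterval.nonneg', (hframe y).configProj_mul]
    exact this r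

lemma exists_frame_lift_path {γ : I → Fconf k i n} (hγ : Continuous γ) :
    ∃ A : I → Matrix (Fin (n + 1)) (Fin (i + 1)) ℂ, Continuous A ∧
      ∀ s, IsFrame (A s) (γ s).1 := by
  obtain ⟨A₀, hA₀⟩ := exists_isFrame (γ 0)
  obtain ⟨A, hA, hframe, -⟩ := exists_frame_lift (Y := Unit) (H := fun u => γ u.1)
    (hγ.comp continuous_fst) (A₀ := fun _ => A₀) continuous_const fun _ => hA₀
  exact ⟨fun s => A (s, ()), hA.comp (by fun_prop), fun s => hframe (s, ())⟩

end Lifting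

/-! ### Simple connectedness of the space of frames -/

section SimplyConnected

variable {N m : ℕ}

lemma countable_setOf_add_smul_notMem_frameSet {A : Matrix (Fin N) (Fin m) ℂ}
    (hA : A ∈ frameSet N m) (B : Matrix (Fin N) (Fin m) ℂ) :
    {z : ℂ | A + z • B ∉ frameSet N m}.Countable := by
  refine ((Matrix.finite_spectrum (pinv A * B)).countable.image fun μ => -μ⁻¹).mono fun z hz => ?_
  have hz0 : z ≠ 0 := by
    rintro rfl
    exact hz (by simpa using hA)
  refine ⟨-z⁻¹, fun hu => hz (mem_frameSet_of_mul (L := pinv A) ?_), by simp⟩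
  rw [Matrix.mul_add, pinv_mul_self hA, Matrix.mul_smul]
  refine (Matrix.mulVec_injective_iff_isUnit).2 ?_
  have : (1 : Matrix (Fin m) (Fin m) ℂ) + z • (pinv A * B) =
      (-z) • (algebraMap ℂ (Matrix (Fin m) (Fin m) ℂ) (-z⁻¹) - pinv A * B) := by
    rw [Algebra.algebraMap_eq_smul_one, smul_sub, smul_smul]
    simp [hz0]
  rw [this, Algebra.smul_def]
  exact ((IsUnit.mk0 (-z) (neg_ne_zero.2 hz0)).map (algebraMap ℂ _)).mul hu

lemma smul_mem_frameSet {A : Matrix (Fin N) (Fin m) ℂ} (hA : A ∈ frameSet N m) {t : ℝ}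
    (ht : t ≠ 0) : t • A ∈ frameSet N m := by
  rw [mem_frameSet_iff] at *
  intro v hv
  rw [smul_mulVec] at hv
  exact hA v ((smul_eq_zero.1 hv).resolve_left ht)

/-- Expresses the `j`-th column of a matrix as a combination of the other columns. -/
def dependentColumn (j : Fin (m + 1)) (v : Fin m → ℂ) (C : Fin N → Fin m → ℂ) :
    Fin N → Fin (m + 1) → ℂ :=
  fun a => Fin.insertNth (α := fun _ => ℂ) j (∑ l, v l * C a l) (C a)

lemma exists_eq_dependentColumn {A : Matrix (Fin N) (Fin (m + 1)) ℂ}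
    (hA : A ∉ frameSet N (m + 1)) : ∃ j v C, A = dependentColumn j v C := by
  rw [mem_frameSet_iff] at hA
  push Not at hA
  obtain ⟨w, hw, hw0⟩ := hA
  obtain ⟨j, hj⟩ := Function.ne_iff.1 hw0
  rw [Pi.zero_apply] at hj
  refine ⟨j, fun l => -(w (j.succAbove l) / w j), fun a l => A a (j.succAbove l), ?_⟩
  funext a b
  refine Fin.succAboveCases j ?_ (fun l => ?_) b
  · have h := congrFun hw a
    rw [mulVec, dotProduct, Fin.sum_univ_succAbove _ j, Pi.zero_apply] at h
    rw [dependentColumn, Fin.insertNth_apply_same, ← mul_right_inj' hj, Finset.mul_sum,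
      mul_comm, eq_neg_of_add_eq_zero_left h, ← Finset.sum_neg_distrib]
    refine Finset.sum_congr rfl fun l _ => ?_
    field_simp
  · rw [dependentColumn, Fin.insertNth_apply_succAbove]

lemma contDiff_dependentColumn (j : Fin (m + 1)) :
    ContDiff ℝ 1 fun d : (Fin m → ℂ) × (Fin N → Fin m → ℂ) => dependentColumn j d.1 d.2 := by
  refine contDiff_pi.2 fun a => contDiff_pi.2 fun l => ?_
  refine Fin.succAboveCases j ?_ (fun l => ?_) l
  · simp only [dependentColumn, Fin.insertNth_apply_same]
    fun_prop
  · simp only [dependentColumn, Fin.insertNth_apply_succAbove]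
    fun_prop

lemma exists_forall_add_smul_mem_frameSet {ι : Type*} [Countable ι] (hm : m + 1 < N)
    {γ : ι → ℝ → Fin N → Fin (m + 1) → ℂ} (hγ : ∀ b, ContDiff ℝ 1 (γ b)) :
    ∃ P : Fin N → Fin (m + 1) → ℂ, ∀ b (c t : ℝ),
      Matrix.of (P + c • γ b t) ∈ frameSet N (m + 1) := by
  let D := (Fin m → ℂ) × (Fin N → Fin m → ℂ) × ℝ × ℝ
  let ψ : Fin (m + 1) × ι → D → Fin N → Fin (m + 1) → ℂ := fun q d =>
    dependentColumn q.1 d.1 d.2.1 - d.2.2.1 • γ q.2 d.2.2.2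
  have hψ : ∀ q, ContDiff ℝ 1 (ψ q) := by
    rintro ⟨j, b⟩
    have h₁ := hγ b
    have h₂ := contDiff_dependentColumn (N := N) j
    exact ContDiff.sub (h₂.comp (f := fun d : D => (d.1, d.2.1))
      (contDiff_fst.prodMk contDiff_snd.fst)) (contDiff_snd.snd.fst.smul
        (h₁.comp contDiff_snd.snd.snd))
  have hdim : dimH (⋃ q, range (ψ q)) < finrank ℝ (Fin N → Fin (m + 1) → ℂ) := by
    have hlt : finrank ℝ D < finrank ℝ (Fin N → Fin (m + 1) → ℂ) := by
      have h₁ : finrank ℝ D = m * 2 + (N * (m * 2) + 2) := by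
        simp [D, Module.finrank_prod, Module.finrank_pi_fintype, Complex.finrank_real_complex]
      have h₂ : finrank ℝ (Fin N → Fin (m + 1) → ℂ) = N * ((m + 1) * 2) := by
        simp [Module.finrank_pi_fintype, Complex.finrank_real_complex]
      rw [h₁, h₂]
      nlinarith
    rw [dimH_iUnion]
    refine lt_of_le_of_lt (iSup_le fun q => (hψ q).dimH_range_le) (Nat.cast_lt.2 hlt)
  obtain ⟨P, hP⟩ := (dense_compl_of_dimH_lt_finrank hdim).nonempty
  refine ⟨P, fun b c t => ?_⟩
  by_contra hmem
  obtain ⟨j, v, C, h⟩ := exists_eq_dependentColumn hmem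
  refine hP (mem_iUnion.2 ⟨(j, b), (v, C, c, t), ?_⟩)
  exact sub_eq_of_eq_add (h.symm : dependentColumn j v C = P + c • γ b t)

lemma exists_contDiff_approx_path {E : Type*} [NormedAddCommGroup E] [NormedSpace ℝ E]
    {U : Set E} (hU : IsOpen U) {γ : I → E} (hγ : Continuous γ) (hγU : ∀ t, γ t ∈ U) :
    ∃ g : ℝ → E, ContDiff ℝ 1 g ∧ g 0 = γ 0 ∧ g 1 = γ 1 ∧
      ∀ s t : I, (1 - s : ℝ) • γ t + (s : ℝ) • g t ∈ U := by
  obtain ⟨δ, hδ, hsub⟩ := (isCompact_range hγ).exists_thickening_subset_open hU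
    (range_subset_iff.2 hγU)
  have hev := (bernsteinApproximation_uniform ⟨γ, hγ⟩).eventually (Metric.ball_mem_nhds _ hδ)
  obtain ⟨r, hr, hr0⟩ := (hev.and (Filter.eventually_ne_atTop 0)).exists
  let g : ℝ → E := fun t =>
    ∑ l : Fin (r + 1), ((r.choose l : ℝ) * t ^ (l : ℕ) * (1 - t) ^ (r - l)) • γ (bernstein.z l)
  have hg : ∀ t : I, g t = bernsteinApproximation r ⟨γ, hγ⟩ t := by
    intro t
    simp only [g, bernsteinApproximation.apply, bernstein_apply, ContinuousMap.coe_mk]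
  refine ⟨g, by fun_prop, ?_, ?_, fun s t => hsub ?_⟩
  · simpa using hg 0
  · simpa [hr0] using hg 1
  · refine Metric.mem_thickening_iff.2 ⟨γ t, mem_range_self t, ?_⟩
    have hball : g t ∈ Metric.ball (γ t) δ := by
      rw [hg]
      exact (ContinuousMap.dist_apply_le_dist t).trans_lt hr
    exact (convex_ball (γ t) δ) (Metric.mem_ball_self hδ) hball (sub_nonneg.2 s.2.2) s.2.1
      (by ring)

/-- Two squares with three edges in common have homotopic fourth edges. -/
lemma Path.Homotopic.of_squares {X : Type*} [TopologicalSpace X] {F G : I × I → X}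
    (hF : Continuous F) (hG : Continuous G) (h₀ : ∀ s, F (s, 0) = G (s, 0))
    (h₁ : ∀ s, F (s, 1) = G (s, 1)) (h : ∀ t, F (1, t) = G (1, t)) {x y : X} {p q : Path x y}
    (hp : ∀ t, p t = F (0, t)) (hq : ∀ t, q t = G (0, t)) : p.Homotopic q := by
  obtain rfl : F (0, 0) = x := by rw [← hp, p.source]
  obtain rfl : F (0, 1) = y := by rw [← hp, p.target]
  let e : Path ((0, 0) : I × I) (0, 1) := ⟨⟨fun t => (0, t), by fun_prop⟩, rfl, rfl⟩
  let a : Path ((0, 0) : I × I) (1, 0) := ⟨⟨fun s => (s, 0), by fun_prop⟩, rfl, rfl⟩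
  let b : Path ((1, 0) : I × I) (1, 1) := ⟨⟨fun t => (1, t), by fun_prop⟩, rfl, rfl⟩
  let c : Path ((0, 1) : I × I) (1, 1) := ⟨⟨fun s => (s, 1), by fun_prop⟩, rfl, rfl⟩
  let f := (a.trans b).trans c.symm
  have hFG : ∀ u, F (f u) = G (f u) := by
    intro u
    have hu : f u ∈ range f := mem_range_self u
    rw [Path.trans_range, Path.trans_range, Path.symm_range] at hu
    rcases hu with (⟨s, hs⟩ | ⟨s, hs⟩) | ⟨s, hs⟩ <;> rw [← hs]
    exacts [h₀ s, h s, h₁ s]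
  have : ContractibleSpace I := (convex_Icc (0 : ℝ) 1).contractibleSpace ⟨0, by simp⟩
  have hef : e.Homotopic f := SimplyConnectedSpace.paths_homotopic e f
  have hpF : p = e.map hF := Path.ext (funext hp)
  have hqG : q = (e.map hG).cast (h₀ 0) (h₁ 0) := Path.ext (funext hq)
  have hfFG : f.map hF = (f.map hG).cast (h₀ 0) (h₁ 0) := Path.ext (funext hFG)
  have hF' : (e.map hF).Homotopic (f.map hF) := hef.map ⟨F, hF⟩
  have hG' : (f.map hG).Homotopic (e.map hG) := (hef.map ⟨G, hG⟩).symm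
  rw [hpF, hqG]
  exact hF'.trans (hfFG ▸ hG'.pathCast (h₀ 0) (h₁ 0))

lemma add_smul_mem_frameSet {A P : Matrix (Fin N) (Fin m) ℂ} (hA : A ∈ frameSet N m)
    (hP : ∀ c : ℝ, P + c • A ∈ frameSet N m) (s : I) :
    (1 - s : ℝ) • A + (s : ℝ) • P ∈ frameSet N m := by
  rcases eq_or_ne (s : ℝ) 0 with hs | hs
  · simpa [hs] using hA
  · have h := smul_mem_frameSet (hP ((s : ℝ)⁻¹ * (1 - s))) hs
    rwa [smul_add, smul_smul, mul_inv_cancel_left₀ hs, add_comm] at h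

lemma exists_smooth_homotopic_path {x y : frameSet N m} (p : Path x y) :
    ∃ (g : ℝ → Fin N → Fin m → ℂ) (q : Path x y), ContDiff ℝ 1 g ∧
      (∀ t : I, (q t).1 = Matrix.of (g t)) ∧ p.Homotopic q := by
  have hp : Continuous fun t => (p t).1 := continuous_subtype_val.comp p.continuous
  obtain ⟨g, hg, hg0, hg1, hmem⟩ := exists_contDiff_approx_path
    (E := Fin N → Fin m → ℂ) (U := frameSet N m) isOpen_frameSet hp fun t => (p t).2
  replace hmem : ∀ s t : I,
      (1 - s : ℝ) • (p t).1 + (s : ℝ) • Matrix.of (g t) ∈ frameSet N m := hmem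
  have hgI : Continuous fun t : I => Matrix.of (g t) := hg.continuous.comp continuous_subtype_val
  have hgmem : ∀ t : I, Matrix.of (g t) ∈ frameSet N m := by
    intro t
    simpa using hmem 1 t
  have hg0' : Matrix.of (g 0) = x.1 := by
    rw [hg0, p.source]
    rfl
  have hg1' : Matrix.of (g 1) = y.1 := by
    rw [hg1, p.target]
    rfl
  let q : Path x y := ⟨⟨fun t => ⟨Matrix.of (g t), hgmem t⟩, hgI.subtype_mk _⟩,
    Subtype.ext hg0', Subtype.ext hg1'⟩
  refine ⟨g, q, hg, fun t => rfl, ⟨⟨⟨⟨fun u => ⟨(1 - u.1 : ℝ) • (p u.2).1 +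
    (u.1 : ℝ) • Matrix.of (g u.2), hmem u.1 u.2⟩, ?_⟩, ?_, ?_⟩, ?_⟩⟩⟩
  · refine Continuous.subtype_mk ?_ _
    have h₁ : Continuous fun u : I × I => (p u.2).1 := hp.comp continuous_snd
    have h₂ : Continuous fun u : I × I => Matrix.of (g u.2) := hgI.comp continuous_snd
    fun_prop
  · intro t
    ext1
    simp
  · intro t
    ext1
    simp [q]
  · rintro s t (rfl | rfl) <;> ext1
    · change (1 - s : ℝ) • (p 0).1 + (s : ℝ) • Matrix.of (g 0) = (p 0).1
      rw [p.source, hg0', ← add_smul, sub_add_cancel, one_smul]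
    · change (1 - s : ℝ) • (p 1).1 + (s : ℝ) • Matrix.of (g 1) = (p 1).1
      rw [p.target, hg1', ← add_smul, sub_add_cancel, one_smul]

lemma frameSet_paths_homotopic (hm : m + 1 < N) {x y : frameSet N (m + 1)} (p q : Path x y) :
    p.Homotopic q := by
  obtain ⟨g, p', hg, hgp, hp⟩ := exists_smooth_homotopic_path p
  obtain ⟨h, q', hh, hhq, hq⟩ := exists_smooth_homotopic_path q
  refine hp.trans (Path.Homotopic.trans ?_ hq.symm)
  obtain ⟨P, hP⟩ := exists_forall_add_smul_mem_frameSet hm (γ := fun b : Bool => cond b g h)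
    (by rintro (_ | _) <;> assumption)
  have cone_mem : ∀ (b : Bool) (r : Path x y), (∀ t : I, (r t).1 = Matrix.of (cond b g h t)) →
      ∀ s t : I, (1 - s : ℝ) • (r t).1 + (s : ℝ) • Matrix.of P ∈ frameSet N (m + 1) :=
    fun b r hr s t => add_smul_mem_frameSet (r t).2 (fun c => by rw [hr]; exact hP b c t) s
  have cone_cont : ∀ r : Path x y, Continuous fun u : I × I =>
      (1 - u.1 : ℝ) • (r u.2).1 + (u.1 : ℝ) • Matrix.of P := by
    intro r
    have h₁ : Continuous fun u : I × I => (r u.2).1 :=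
      continuous_subtype_val.comp (r.continuous.comp continuous_snd)
    fun_prop
  refine Path.Homotopic.of_squares
    (F := fun u => ⟨_, cone_mem true p' hgp u.1 u.2⟩)
    (G := fun u => ⟨_, cone_mem false q' hhq u.1 u.2⟩)
    ((cone_cont p').subtype_mk _) ((cone_cont q').subtype_mk _) ?_ ?_ ?_ ?_ ?_
  all_goals
    intro t
    ext1
    simp

lemma exists_path_avoiding_countable {S : Set ℂ} (hS : S.Countable) (h0 : (0 : ℂ) ∉ S)
    (h1 : (1 : ℂ) ∉ S) : ∃ c : Path (0 : ℂ) 1, ∀ t, c t ∉ S := by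
  have := hS.isPathConnected_compl_of_one_lt_rank (by rw [Complex.rank_real_complex]; simp)
  obtain ⟨c, hc⟩ := this.joinedIn 0 h0 1 h1
  exact ⟨c, hc⟩

lemma frameSet_joined (x y : frameSet N m) : Nonempty (Path x y) := by
  obtain ⟨c, hc⟩ := exists_path_avoiding_countable
    (countable_setOf_add_smul_notMem_frameSet x.2 (y.1 - x.1)) (by simp [x.2]) (by simp [y.2])
  have hmem : ∀ t, x.1 + c t • (y.1 - x.1) ∈ frameSet N m := fun t => not_not.1 (hc t)
  refine ⟨⟨⟨fun t => ⟨_, hmem t⟩, ?_⟩, ?_, ?_⟩⟩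
  · have := c.continuous
    exact Continuous.subtype_mk (by fun_prop) _
  · ext1
    simp
  · ext1
    simp

end SimplyConnected

section PathConnected

variable {k i n : ℕ}

lemma countable_setOf_not_linearIndependent_add_smul {N m : ℕ} {v : Fin m → Fin N → ℂ}
    (hv : LinearIndependent ℂ v) (w : Fin m → Fin N → ℂ) :
    {z : ℂ | ¬ LinearIndependent ℂ fun l => v l + z • w l}.Countable := by
  convert! countable_setOf_add_smul_notMem_frameSet (transpose_of_mem_frameSet_iff.2 hv)
    (Matrix.of w)ᵀ using 4 with z
  exact (transpose_of_mem_frameSet_iff (v := fun l => v l + z • w l)).symm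

/-- A family of vectors of `ℂ^{i+1}` that defines a configuration spanning `ℂP^i`. -/
structure IsSpanningFamily (c : Fin k → Fin (i + 1) → ℂ) : Prop where
  ne_zero : ∀ j, LinearIndependent ℂ ![c j]
  pair : ∀ j l, j ≠ l → LinearIndependent ℂ ![c j, c l]
  exists_basis : ∃ f : Fin (i + 1) → Fin k, LinearIndependent ℂ (c ∘ f)

lemma isSpanningFamily_rep (x : Fconf k i i) :
    IsSpanningFamily fun j => (x.1 j).rep where
  ne_zero j := by
    rw [linearIndependent_unique_iff]
    exact (x.1 j).rep_nonzero
  pair j l hjl := Projectivization.linearIndependent_pair_iff_ne.2 fun h => hjl (x.2.1 h)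
  exists_basis := exists_linearIndependent_reps x.2

lemma IsSpanningFamily.vec_ne_zero {c : Fin k → Fin (i + 1) → ℂ} (hc : IsSpanningFamily c)
    (j : Fin k) : c j ≠ 0 :=
  (hc.ne_zero j).ne_zero 0

lemma IsSpanningFamily.isFrame_one {c : Fin k → Fin (i + 1) → ℂ} (hc : IsSpanningFamily c) :
    IsFrame (1 : Matrix (Fin (i + 1)) (Fin (i + 1)) ℂ)
      fun j => Projectivization.mk ℂ (c j) (hc.vec_ne_zero j) := by
  refine ⟨mem_frameSet_iff.2 fun v hv => by simpa using hv, ?_⟩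
  obtain ⟨f, hf⟩ := hc.exists_basis
  have htop : span ℂ (Set.range (c ∘ f)) = ⊤ := hf.span_eq_top_of_card_eq_finrank' (by simp)
  rw [mulVecLin_one, LinearMap.range_id, eq_comm, eq_top_iff, ← htop, span_le]
  rintro _ ⟨l, rfl⟩
  rw [configSpan_eq_iSup]
  refine Submodule.mem_iSup_of_mem (f l) ?_
  rw [Projectivization.submodule_mk]
  exact mem_span_singleton_self _

lemma IsSpanningFamily.injective_mk {c : Fin k → Fin (i + 1) → ℂ} (hc : IsSpanningFamily c) :
    Function.Injective fun j => Projectivization.mk ℂ (c j) (hc.vec_ne_zero j) := by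
  intro j l hjl
  by_contra hne
  obtain ⟨t, ht⟩ := (Projectivization.mk_eq_mk_iff' ℂ _ _ _ _).1 hjl
  have := LinearIndependent.pair_iff.1 (hc.pair j l hne) 1 (-t) (by simp [ht])
  exact one_ne_zero this.1

lemma countable_setOf_not_isSpanningFamily {c : Fin k → Fin (i + 1) → ℂ}
    (hc : IsSpanningFamily c) (d : Fin k → Fin (i + 1) → ℂ) :
    {z : ℂ | ¬ IsSpanningFamily fun j => c j + z • d j}.Countable := by
  obtain ⟨f, hf⟩ := hc.exists_basis
  have h₁ := countable_iUnion fun j =>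
    countable_setOf_not_linearIndependent_add_smul (hc.ne_zero j) ![d j]
  have h₂ := countable_iUnion fun q : {q : Fin k × Fin k // q.1 ≠ q.2} =>
    countable_setOf_not_linearIndependent_add_smul (hc.pair q.1.1 q.1.2 q.2) ![d q.1.1, d q.1.2]
  have h₃ := countable_setOf_not_linearIndependent_add_smul hf (d ∘ f)
  refine ((h₁.union h₂).union h₃).mono fun z hz => ?_
  by_contra hmem
  simp only [mem_union, mem_iUnion, mem_ofPred_eq, not_or, not_exists, not_not, Subtype.forall,
    Prod.forall] at hmem
  obtain ⟨⟨h₁, h₂⟩, h₃⟩ := hmem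
  refine hz ⟨fun j => ?_, fun j l hjl => ?_, f, h₃⟩
  · convert! h₁ j using 1
    funext l
    fin_cases l
    rfl
  · convert! h₂ j l hjl using 1
    funext l
    fin_cases l <;> rfl

lemma exists_act_eq (x : Fconf k i n) {A : Matrix (Fin (n + 1)) (Fin (i + 1)) ℂ}
    (hA : IsFrame A x.1) : ∃ d : Fconf k i i, ∀ j, act A (d.1 j) = x.1 j := by
  have h : pinv A * A ∈ frameSet (i + 1) (i + 1) := by
    rw [pinv_mul_self hA.mem_frameSet]
    exact mem_frameSet_iff.2 fun v hv => by simpa using hv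
  refine ⟨⟨_, hA.act_mem_Fconf x.2.1 h⟩, fun j => ?_⟩
  have hfix : (A * pinv A) *ᵥ (x.1 j).rep = (x.1 j).rep := hA.colProj_mulVec_rep j
  rw [act_act (hfix.symm ▸ (x.1 j).rep_nonzero), act_eq_self hfix]

lemma Fconf_joined (x y : Fconf k i n) : Nonempty (Path x y) := by
  obtain ⟨A, hA⟩ := exists_isFrame x
  obtain ⟨B, hB⟩ := exists_isFrame y
  obtain ⟨d, hd⟩ := exists_act_eq x hA
  obtain ⟨e, he⟩ := exists_act_eq y hB
  obtain ⟨c, hc⟩ := exists_path_avoiding_countable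
    ((countable_setOf_add_smul_notMem_frameSet hA.mem_frameSet (B - A)).union
      (countable_setOf_not_isSpanningFamily (isSpanningFamily_rep d)
        fun j => (e.1 j).rep - (d.1 j).rep))
    (by simp [hA.mem_frameSet, isSpanningFamily_rep d])
    (by simp [hB.mem_frameSet, isSpanningFamily_rep e])
  simp only [mem_union, mem_ofPred_eq, not_or, not_not] at hc
  have hcc := c.continuous
  have hmem : ∀ t, (A + c t • (B - A)) * (1 : Matrix (Fin (i + 1)) (Fin (i + 1)) ℂ) ∈
      frameSet (n + 1) (i + 1) := fun t => by
    rw [Matrix.mul_one]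
    exact (hc t).1
  refine ⟨⟨⟨fun t => ⟨_, (hc t).2.isFrame_one.act_mem_Fconf (hc t).2.injective_mk (hmem t)⟩, ?_⟩,
    ?_, ?_⟩⟩
  · refine Continuous.subtype_mk (continuous_pi fun j => Continuous.act (by fun_prop)
      (continuous_projectivization_mk (by fun_prop) _) fun t => ?_) _
    exact (hc t).2.isFrame_one.mulVec_rep_ne_zero (hmem t) j
  · ext1
    funext j
    simp only [c.source, zero_smul, add_zero, Projectivization.mk_rep]
    exact hd j
  · ext1
    funext j
    simp only [c.target, one_smul, add_sub_cancel, Projectivization.mk_rep]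
    exact he j

end PathConnected

section Stabilization

variable {k i a n : ℕ}

lemma mul_pinv_mul_mem_frameSet {A : Matrix (Fin (n + 1)) (Fin (i + 1)) ℂ}
    {C : Matrix (Fin (a + 1)) (Fin (i + 1)) ℂ} (hA : A ∈ frameSet (n + 1) (i + 1))
    (hC : C ∈ frameSet (a + 1) (i + 1)) : C * pinv A * A ∈ frameSet (a + 1) (i + 1) := by
  rwa [Matrix.mul_assoc, pinv_mul_self hA, Matrix.mul_one]

/-- The image of a configuration with frame `A` under the linear map sending `A` to `C`. -/
def reframe (x : Fconf k i n) {A : Matrix (Fin (n + 1)) (Fin (i + 1)) ℂ} (hA : IsFrame A x.1)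
    {C : Matrix (Fin (a + 1)) (Fin (i + 1)) ℂ} (hC : C ∈ frameSet (a + 1) (i + 1)) :
    Fconf k i a :=
  ⟨fun j => act (C * pinv A) (x.1 j),
    hA.act_mem_Fconf x.2.1 (mul_pinv_mul_mem_frameSet hA.mem_frameSet hC)⟩

lemma reframe_eq_self (x : Fconf k i n) {A C : Matrix (Fin (n + 1)) (Fin (i + 1)) ℂ}
    (hA : IsFrame A x.1) (hC : C ∈ frameSet (n + 1) (i + 1)) (h : C = A) :
    reframe x hA hC = x := by
  subst h
  exact Subtype.ext (funext fun j => act_eq_self (hA.colProj_mulVec_rep j))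

lemma continuous_reframe {Y : Type*} [TopologicalSpace Y] {x : Y → Fconf k i n}
    {A : Y → Matrix (Fin (n + 1)) (Fin (i + 1)) ℂ} {C : Y → Matrix (Fin (a + 1)) (Fin (i + 1)) ℂ}
    (hx : Continuous x) (hA : Continuous A) (hC : Continuous C)
    (hframe : ∀ y, IsFrame (A y) (x y).1) (hmem : ∀ y, C y ∈ frameSet (a + 1) (i + 1)) :
    Continuous fun y => reframe (x y) (hframe y) (hmem y) := by
  refine Continuous.subtype_mk (continuous_pi fun j => Continuous.act
    (hC.matrix_mul (hA.pinv fun y => (hframe y).mem_frameSet))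
    ((continuous_apply j).comp (continuous_subtype_val.comp hx)) fun y => ?_) _
  exact (hframe y).mulVec_rep_ne_zero
    (mul_pinv_mul_mem_frameSet (hframe y).mem_frameSet (hmem y)) j

lemma mulVec_rep_ne_zero {J : Matrix (Fin (n + 1)) (Fin (a + 1)) ℂ}
    (hJ : J ∈ frameSet (n + 1) (a + 1)) (p : CP a) : J *ᵥ p.rep ≠ 0 :=
  fun h => p.rep_nonzero (mem_frameSet_iff.1 hJ _ h)

variable {J : Matrix (Fin (n + 1)) (Fin (a + 1)) ℂ}

lemma act_comp_mem_Fconf (hJ : J ∈ frameSet (n + 1) (a + 1)) (x : Fconf k i a) :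
    (fun j => act J (x.1 j)) ∈ Fconf k i n := by
  obtain ⟨A, hA⟩ := exists_isFrame x
  exact hA.act_mem_Fconf x.2.1 (mul_mem_frameSet hJ hA.mem_frameSet)

lemma continuous_act_apply (hJ : J ∈ frameSet (n + 1) (a + 1)) (j : Fin k) :
    Continuous fun x : Fconf k i a => act J (x.1 j) := by
  have h : Continuous fun x : Fconf k i a => x.1 j :=
    (continuous_apply j).comp continuous_subtype_val
  exact Continuous.act continuous_const h fun _ => mulVec_rep_ne_zero hJ _

variable (hJ : J ∈ frameSet (n + 1) (a + 1))

/-- The map of configuration spaces induced by an injective linear map. -/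
def configMap : C(Fconf k i a, Fconf k i n) where
  toFun x := ⟨fun j => act J (x.1 j), act_comp_mem_Fconf hJ x⟩
  continuous_toFun := (continuous_pi (continuous_act_apply hJ)).subtype_mk _

lemma configMap_injective : Function.Injective (configMap (k := k) (i := i) hJ) := by
  have h : ∀ p : CP a, act (pinv J) (act J p) = p := by
    intro p
    have hp : (pinv J * J) *ᵥ p.rep = p.rep := by rw [pinv_mul_self hJ, one_mulVec]
    rw [act_act (hp.symm ▸ p.rep_nonzero), act_eq_self hp]
  intro x y hxy
  refine Subtype.ext (funext fun j => ?_)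
  rw [← h (x.1 j), ← h (y.1 j)]
  exact congrArg (act (pinv J)) (congrFun (congrArg Subtype.val hxy) j)

lemma configMap_reframe (x : Fconf k i n) {A : Matrix (Fin (n + 1)) (Fin (i + 1)) ℂ}
    (hA : IsFrame A x.1) {C : Matrix (Fin (a + 1)) (Fin (i + 1)) ℂ}
    (hC : C ∈ frameSet (a + 1) (i + 1)) :
    configMap hJ (reframe x hA hC) = reframe x hA (mul_mem_frameSet hJ hC) := by
  refine Subtype.ext (funext fun j => ?_)
  have h := hA.mulVec_rep_ne_zero
    (mul_pinv_mul_mem_frameSet hA.mem_frameSet (mul_mem_frameSet hJ hC)) j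
  rw [Matrix.mul_assoc] at h
  exact (act_act h).trans (by rw [← Matrix.mul_assoc]; rfl)

lemma mul_pinv_mul_of_isFrame {x : Fconf k i a} {A : Matrix (Fin (n + 1)) (Fin (i + 1)) ℂ}
    (hA : IsFrame A (configMap hJ x).1) : J * (pinv J * A) = A := by
  obtain ⟨B, hB⟩ := exists_isFrame x
  have hJB : IsFrame (J * B) (configMap hJ x).1 := hB.act (mul_mem_frameSet hJ hB.mem_frameSet)
  have hrange : LinearMap.range A.mulVecLin ≤ LinearMap.range J.mulVecLin := by
    rw [hA.range_eq, ← hJB.range_eq, Matrix.mulVecLin_mul]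
    exact LinearMap.range_comp_le_range _ _
  rw [← Matrix.mul_assoc]
  refine Matrix.ext_of_mulVec_single fun l => ?_
  rw [← mulVec_mulVec]
  exact colProj_mulVec_of_mem hJ (hrange ⟨_, rfl⟩)

lemma pinv_mul_mem_frameSet {x : Fconf k i a} {A : Matrix (Fin (n + 1)) (Fin (i + 1)) ℂ}
    (hA : IsFrame A (configMap hJ x).1) : pinv J * A ∈ frameSet (a + 1) (i + 1) :=
  mem_frameSet_of_mul (L := J) (by rw [mul_pinv_mul_of_isFrame hJ hA]; exact hA.mem_frameSet)

lemma exists_homotopic_map (hin : i < n) {x : Fconf k i a}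
    (p : Path (configMap hJ x) (configMap hJ x)) :
    ∃ q : Path x x, p.Homotopic (q.map (configMap hJ).continuous) := by
  obtain ⟨A, hA, hframe⟩ := exists_frame_lift_path p.continuous
  have hf0 : IsFrame (A 0) (configMap hJ x).1 := by simpa using hframe 0
  have hf1 : IsFrame (A 1) (configMap hJ x).1 := by simpa using hframe 1
  obtain ⟨b⟩ := frameSet_joined ⟨_, pinv_mul_mem_frameSet hJ hf0⟩
    ⟨_, pinv_mul_mem_frameSet hJ hf1⟩
  have hb : Continuous fun t => (b t).1 := continuous_subtype_val.comp b.continuous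
  have hJb0 : J * (b 0).1 = A 0 := by rw [b.source, mul_pinv_mul_of_isFrame hJ hf0]
  have hJb1 : J * (b 1).1 = A 1 := by rw [b.target, mul_pinv_mul_of_isFrame hJ hf1]
  let α : Path (X := frameSet (n + 1) (i + 1)) ⟨A 0, hf0.mem_frameSet⟩ ⟨A 1, hf1.mem_frameSet⟩ :=
    ⟨⟨fun t => ⟨A t, (hframe t).mem_frameSet⟩, hA.subtype_mk _⟩, rfl, rfl⟩
  let β : Path (X := frameSet (n + 1) (i + 1)) ⟨A 0, hf0.mem_frameSet⟩ ⟨A 1, hf1.mem_frameSet⟩ :=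
    ⟨⟨fun t => ⟨J * (b t).1, mul_mem_frameSet hJ (b t).2⟩,
      (continuous_const.matrix_mul hb).subtype_mk _⟩, Subtype.ext hJb0, Subtype.ext hJb1⟩
  obtain ⟨C⟩ := frameSet_paths_homotopic (by omega) α β
  have hmap : ∀ t, configMap hJ (reframe (p t) (hframe t) (b t).2) =
      reframe (p t) (hframe t) (β t).2 := fun t => configMap_reframe hJ _ _ _
  have hside : ∀ t, J * (b t).1 = A t → reframe (p t) (hframe t) (β t).2 = p t :=
    fun t h => reframe_eq_self _ _ _ h
  let q : Path x x := ⟨⟨fun t => reframe (p t) (hframe t) (b t).2,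
      continuous_reframe p.continuous hA hb _ _⟩,
    configMap_injective hJ ((hmap 0).trans ((hside 0 hJb0).trans p.source)),
    configMap_injective hJ ((hmap 1).trans ((hside 1 hJb1).trans p.target))⟩
  refine ⟨q, ⟨⟨⟨⟨fun u => reframe (p u.2) (hframe u.2) (C u).2, ?_⟩, ?_, ?_⟩, ?_⟩⟩⟩
  · exact continuous_reframe (p.continuous.comp continuous_snd) (hA.comp continuous_snd)
      (continuous_subtype_val.comp C.continuous) _ _
  · exact fun t => reframe_eq_self (p t) (hframe t) (C (0, t)).2
      (congrArg Subtype.val (C.apply_zero t))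
  · intro t
    refine Eq.trans ?_ (hmap t).symm
    exact congrArg (fun c : frameSet (n + 1) (i + 1) => reframe (p t) (hframe t) c.2)
      (C.apply_one t)
  · rintro s t (rfl | rfl)
    · exact reframe_eq_self (p 0) (hframe 0) (C (s, 0)).2
        (congrArg Subtype.val (C.source s))
    · exact reframe_eq_self (p 1) (hframe 1) (C (s, 1)).2
        (congrArg Subtype.val (C.target s))

lemma homotopic_of_map_homotopic (hia : i < a) {x : Fconf k i a} {p q : Path x x}
    (h : (p.map (configMap hJ).continuous).Homotopic (q.map (configMap hJ).continuous)) :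
    p.Homotopic q := by
  obtain ⟨H⟩ := h
  obtain ⟨A₀, hA₀, hframe₀⟩ := exists_frame_lift_path
    (p.map (configMap (k := k) (i := i) hJ).continuous).continuous
  obtain ⟨A, hA, hframe, -, hstat⟩ := exists_frame_lift (Y := I) (H := H) H.continuous hA₀
    (fun t => by rw [H.apply_zero]; exact hframe₀ t)
  have hA0 : ∀ s, A (s, 0) = A (0, 0) := fun s => by
    rw [hstat 0 (fun s => by rw [H.source, H.source]) s,
      hstat 0 (fun s => by rw [H.source, H.source]) 0]
  have hA1 : ∀ s, A (s, 1) = A (0, 1) := fun s => by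
    rw [hstat 1 (fun s => by rw [H.target, H.target]) s,
      hstat 1 (fun s => by rw [H.target, H.target]) 0]
  have hfp : ∀ t, IsFrame (A (0, t)) (configMap hJ (p t)).1 := fun t => by
    have := hframe (0, t)
    rwa [H.apply_zero] at this
  have hfq : ∀ t, IsFrame (A (1, t)) (configMap hJ (q t)).1 := fun t => by
    have := hframe (1, t)
    rwa [H.apply_one] at this
  have hcont : ∀ s, Continuous fun t => pinv J * A (s, t) := fun s =>
    continuous_const.matrix_mul (hA.comp (by fun_prop))
  let α : Path (X := frameSet (a + 1) (i + 1)) ⟨_, pinv_mul_mem_frameSet hJ (hfp 0)⟩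
      ⟨_, pinv_mul_mem_frameSet hJ (hfp 1)⟩ :=
    ⟨⟨fun t => ⟨_, pinv_mul_mem_frameSet hJ (hfp t)⟩, (hcont 0).subtype_mk _⟩, rfl, rfl⟩
  let β : Path (X := frameSet (a + 1) (i + 1)) ⟨_, pinv_mul_mem_frameSet hJ (hfp 0)⟩
      ⟨_, pinv_mul_mem_frameSet hJ (hfp 1)⟩ :=
    ⟨⟨fun t => ⟨_, pinv_mul_mem_frameSet hJ (hfq t)⟩, (hcont 1).subtype_mk _⟩,
      Subtype.ext (congrArg (pinv J * ·) (hA0 1)), Subtype.ext (congrArg (pinv J * ·) (hA1 1))⟩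
  obtain ⟨C⟩ := frameSet_paths_homotopic (by omega) α β
  have hK : ∀ (u : I × I) (z : Fconf k i a), (C u).1 = pinv J * A u → H u = configMap hJ z →
      reframe (H u) (hframe u) (C u).2 = z := by
    intro u z hC hH
    apply configMap_injective hJ
    rw [configMap_reframe, ← hH]
    refine reframe_eq_self _ _ _ ?_
    rw [hC]
    exact mul_pinv_mul_of_isFrame hJ (hH ▸ hframe u)
  refine ⟨⟨⟨⟨fun u => reframe (H u) (hframe u) (C u).2, ?_⟩, fun t => ?_, fun t => ?_⟩, ?_⟩⟩
  · exact continuous_reframe H.continuous hA (continuous_subtype_val.comp C.continuous) _ _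
  · exact hK _ _ (congrArg Subtype.val (C.apply_zero t)) (H.apply_zero t)
  · exact hK _ _ (congrArg Subtype.val (C.apply_one t)) (H.apply_one t)
  · rintro s t (rfl | rfl)
    · refine hK _ _ ((congrArg Subtype.val (C.source s)).trans ?_) (H.source s |>.trans ?_)
      · exact congrArg (pinv J * ·) (hA0 s).symm
      · exact congrArg (configMap hJ) p.source.symm
    · refine hK _ _ ((congrArg Subtype.val (C.target s)).trans ?_) (H.target s |>.trans ?_)
      · exact congrArg (pinv J * ·) (hA1 s).symm
      · exact congrArg (configMap hJ) p.target.symm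

lemma bijective_fundamentalGroup_map_configMap (hia : i < a) (hin : i < n) (x : Fconf k i a) :
    Function.Bijective (FundamentalGroup.map (configMap hJ) x) := by
  constructor
  · intro p q
    induction p using Quotient.ind with | _ p
    induction q using Quotient.ind with | _ q
    intro h
    exact Quotient.sound (homotopic_of_map_homotopic hJ hia (Quotient.exact h))
  · intro p
    induction p using Quotient.ind with | _ p
    obtain ⟨q, hq⟩ := exists_homotopic_map hJ hin p
    exact ⟨Path.Homotopic.Quotient.mk q, Quotient.sound hq.symm⟩

end Stabilization

lemma submatrix_castLE_mem_frameSet {N m : ℕ} (h : m ≤ N) :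
    (1 : Matrix (Fin N) (Fin N) ℂ).submatrix id (Fin.castLE h) ∈ frameSet N m := by
  refine mem_frameSet_of_mul
    (L := (1 : Matrix (Fin N) (Fin N) ℂ).submatrix (Fin.castLE h) id) ?_
  rw [← submatrix_mul _ _ _ _ _ Function.bijective_id, Matrix.one_mul,
    submatrix_one _ (Fin.castLE_injective h)]
  exact mem_frameSet_iff.2 fun v hv => by simpa using hv

/-- For `1 ≤ i ≤ k` and `i ≤ n - 1`, the fundamental groups of `F_{k+1}^{i,i+1}` and of
`F_{k+1}^{i,n}` are isomorphic (at any basepoints; both spaces are path-connected). -/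
theorem pi1_Fconf_stable (i k n : ℕ) (hi : 1 ≤ i) (hik : i ≤ k) (hin : i + 1 ≤ n)
    (x : Fconf (k + 1) i (i + 1)) (y : Fconf (k + 1) i n) :
    Nonempty (FundamentalGroup (Fconf (k + 1) i (i + 1)) x ≃*
      FundamentalGroup (Fconf (k + 1) i n) y) := by
  have hJ := submatrix_castLE_mem_frameSet (show i + 1 + 1 ≤ n + 1 by omega)
  obtain ⟨γ⟩ := Fconf_joined (configMap hJ x) y
  exact ⟨(MulEquiv.ofBijective _
    (bijective_fundamentalGroup_map_configMap hJ (by omega) (by omega) x)).trans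
      (FundamentalGroup.fundamentalGroupMulEquivOfPath γ)⟩
end
end

section
/- For every integer k ≥ 1, the spaces F_k^{k-1,k} and F_{k+1}^{k,k} are simply connected. -/
noncomputable section

open Module Submodule

/-- A space is simply connected if it is covered by open sets with a common point, whose pairwise
intersections are path connected and in which any two paths with the same endpoints are homotopic
(possibly through the whole space). -/
theorem simplyConnectedSpace_of_isOpen_cover {X ι : Type*} [TopologicalSpace X] (U : ι → Set X)
    (hopen : ∀ i, IsOpen (U i)) (hcov : ∀ x, ∃ i, x ∈ U i) (x₀ : X) (hx₀ : ∀ i, x₀ ∈ U i)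
    (hconn : ∀ i j, IsPathConnected (U i ∩ U j))
    (hpath : ∀ i {x y : X} (p q : Path x y), (∀ t, p t ∈ U i) → (∀ t, q t ∈ U i) →
      p.Homotopic q) :
    SimplyConnectedSpace X := by
  have hjoin : ∀ i j x, x ∈ U i → x ∈ U j → ∃ q : Path x₀ x, ∀ t, q t ∈ U i ∩ U j := by
    intro i j x hi hj
    have h := (hconn i j).joinedIn x₀ ⟨hx₀ i, hx₀ j⟩ x ⟨hi, hj⟩
    exact ⟨h.somePath, h.somePath_mem⟩
  have key : ∀ {y : X} (γ : Path x₀ y), ∀ i, ∀ q : Path x₀ y, (∀ t, q t ∈ U i) →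
      γ.Homotopic q := by
    intro y γ i q hq
    obtain ⟨t, ht0, hmono, ⟨N, hN⟩, hsub⟩ :=
      exists_monotone_Icc_subset_open_cover_unitInterval
        (fun j => (hopen j).preimage γ.continuous)
        (fun s _ => Set.mem_iUnion.2 (hcov (γ s)))
    choose c hc using hsub
    have main : ∀ n, ∀ j, γ (t n) ∈ U j → ∀ r : Path x₀ (γ (t n)), (∀ s, r s ∈ U j) →
        ((γ.subpath 0 (t n)).cast γ.source.symm rfl).Homotopic r := by
      intro n
      induction n with
      | zero =>
        intro j hj r hr
        refine hpath j _ _ (fun s => ?_) hr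
        simpa [Path.subpath, ht0] using hx₀ j
      | succ n ih =>
        intro j hj r hr
        have hmem : ∀ s ∈ Set.Icc (t n) (t (n + 1)), γ s ∈ U (c n) := fun s hs => hc n hs
        have hle := hmono n.le_succ
        obtain ⟨p, hp⟩ := hjoin (c n) (c n) (γ (t n)) (hmem _ ⟨le_rfl, hle⟩)
          (hmem _ ⟨le_rfl, hle⟩)
        obtain ⟨p', hp'⟩ := hjoin (c n) j (γ (t (n + 1))) (hmem _ ⟨hle, le_rfl⟩) hj
        have h1 := ih (c n) (hmem _ ⟨le_rfl, hle⟩) p fun s => (hp s).1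
        have h2 : (p.trans (γ.subpath (t n) (t (n + 1)))).Homotopic p' := by
          refine hpath (c n) _ _ (fun s => ?_) fun s => (hp' s).1
          have hs : (p.trans (γ.subpath (t n) (t (n + 1)))) s ∈
              Set.range (p.trans (γ.subpath (t n) (t (n + 1)))) := ⟨s, rfl⟩
          rw [Path.trans_range, Path.range_subpath_of_le _ _ _ hle] at hs
          rcases hs with ⟨u, hu⟩ | ⟨u, hu, hu'⟩
          · exact hu ▸ (hp u).1
          · exact hu' ▸ hmem u hu
        have h3 : p'.Homotopic r := hpath j _ _ (fun s => (hp' s).2) hr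
        have h4 : (((γ.subpath 0 (t n)).cast γ.source.symm rfl).trans
            (γ.subpath (t n) (t (n + 1)))).Homotopic
            ((γ.subpath 0 (t (n + 1))).cast γ.source.symm rfl) := by
          have := (Path.Homotopic.pathCast
            ⟨Path.Homotopy.subpathTransSubpath γ 0 (t n) (t (n + 1))⟩ γ.source.symm rfl)
          convert this using 1
          ext s
          simp [Path.trans_apply]
        exact h4.symm.trans (((h1.hcomp (.refl _)).trans h2).trans h3)
    have hend : t N = 1 := hN N le_rfl
    have hy : γ (t N) = y := by rw [hend, γ.target]
    have h := main N i (by rw [hy]; simpa using hq 1) (q.cast rfl hy) hq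
    have h' := h.pathCast rfl hy.symm
    convert h' using 1
    · ext s
      simp [Path.subpath, hend]
    · ext s
      simp
  rw [simply_connected_iff_loops_nullhomotopic]
  refine ⟨⟨⟨x₀⟩, fun x y => ?_⟩, fun x γ => ?_⟩
  · have hx : ∀ x, Joined x₀ x := fun x => by
      obtain ⟨i, hi⟩ := hcov x
      obtain ⟨q, -⟩ := hjoin i i x hi hi
      exact ⟨q⟩
    exact (hx x).symm.trans (hx y)
  · obtain ⟨i, hi⟩ := hcov x
    obtain ⟨r, hr⟩ := hjoin i i x hi hi
    have h := key (r.trans γ) i r fun t => (hr t).1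
    rw [← Path.Homotopic.Quotient.eq] at h ⊢
    have h2 := congrArg (Path.Homotopic.Quotient.trans (Path.Homotopic.Quotient.mk r).symm) h
    simpa [← Path.Homotopic.Quotient.trans_assoc] using h2

/-- Two paths in a set `U` are homotopic if the inclusion of `U` factors through a simply connected
space. -/
theorem Path.homotopic_of_factors_through {X E : Type*} [TopologicalSpace X] [TopologicalSpace E]
    {S : Set E} [SimplyConnectedSpace S] {U : Set X} {s : X → E} (hs : ContinuousOn s U)
    (hmaps : ∀ u ∈ U, s u ∈ S) (r : C(S, X)) (hrs : ∀ u (hu : u ∈ U), r ⟨s u, hmaps u hu⟩ = u)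
    {x y : X} (p q : Path x y) (hp : ∀ t, p t ∈ U) (hq : ∀ t, q t ∈ U) : p.Homotopic q := by
  have hxU : x ∈ U := by simpa using hp 0
  have hyU : y ∈ U := by simpa using hp 1
  have lift : ∀ γ : Path x y, (∀ t, γ t ∈ U) →
      ∃ γ' : Path (⟨s x, hmaps x hxU⟩ : S) ⟨s y, hmaps y hyU⟩, ∀ t, r (γ' t) = γ t := by
    intro γ hγ
    refine ⟨⟨⟨fun t => ⟨s (γ t), hmaps _ (hγ t)⟩,
      (hs.comp_continuous γ.continuous hγ).subtype_mk _⟩, by simp, by simp⟩, fun t => ?_⟩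
    exact hrs _ (hγ t)
  obtain ⟨p', hp'⟩ := lift p hp
  obtain ⟨q', hq'⟩ := lift q hq
  have h := ((SimplyConnectedSpace.paths_homotopic p' q').map r).pathCast
    (hrs x hxU).symm (hrs y hyU).symm
  convert h
  · ext t; exact (hp' t).symm
  · ext t; exact (hq' t).symm

section LeadingMinors

variable {R : Type*} [CommRing R] {m : ℕ}

/-- The matrix whose columns of index `< j` are those of `M` and whose other columns are those of
the identity; its determinant is the leading principal `j × j` minor of `M`. -/
def leadingMatrix (M : Matrix (Fin m) (Fin m) R) (j : ℕ) : Matrix (Fin m) (Fin m) R :=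
  Matrix.of fun a b => if b.val < j then M a b else (1 : Matrix (Fin m) (Fin m) R) a b

/-- The leading principal `j × j` minor of `M` (equal to `M.det` if `m ≤ j`). -/
def leadingMinor (M : Matrix (Fin m) (Fin m) R) (j : ℕ) : R := (leadingMatrix M j).det

theorem leadingMinor_zero (M : Matrix (Fin m) (Fin m) R) : leadingMinor M 0 = 1 := by
  have : leadingMatrix M 0 = 1 := by ext; simp [leadingMatrix]
  rw [leadingMinor, this, Matrix.det_one]

theorem leadingMinor_of_le (M : Matrix (Fin m) (Fin m) R) {j : ℕ} (hj : m ≤ j) :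
    leadingMinor M j = M.det := by
  have : leadingMatrix M j = M := by
    ext a b; simp [leadingMatrix, b.2.trans_le hj]
  rw [leadingMinor, this]

theorem leadingMinor_castSucc (M : Matrix (Fin (m + 1)) (Fin (m + 1)) R) {j : ℕ} (hj : j ≤ m) :
    leadingMinor M j = leadingMinor (M.submatrix Fin.castSucc Fin.castSucc) j := by
  rw [leadingMinor, Matrix.det_succ_column _ (Fin.last m),
    Finset.sum_eq_single (Fin.last m)]
  · have : (leadingMatrix M j).submatrix Fin.castSucc Fin.castSucc =
        leadingMatrix (M.submatrix Fin.castSucc Fin.castSucc) j := by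
      ext a b; simp [leadingMatrix, Matrix.one_apply]
    simp only [Fin.succAbove_last, this, leadingMinor]
    simp [leadingMatrix, hj, ← two_mul]
  · intro a _ ha
    simp [leadingMatrix, hj, Matrix.one_apply, ha]
  · simp

theorem leadingMinor_mul_diagonal (M : Matrix (Fin m) (Fin m) R) (c : ℕ → R) {j : ℕ}
    (hj : j ≤ m) :
    leadingMinor (M * Matrix.diagonal fun b : Fin m => c b) j =
      leadingMinor M j * ∏ i ∈ Finset.range j, c i := by
  have : leadingMatrix (M * Matrix.diagonal fun b : Fin m => c b) j =
      leadingMatrix M j * Matrix.diagonal fun b : Fin m => if b.val < j then c b else 1 := by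
    ext a b
    by_cases h : b.val < j <;> simp [leadingMatrix, h]
  rw [leadingMinor, this, Matrix.det_mul, Matrix.det_diagonal, leadingMinor]
  congr 1
  rw [Fin.prod_univ_eq_prod_range (fun i => if i < j then c i else 1) m,
    ← Finset.prod_filter]
  congr 1
  ext i
  simp
  omega

theorem leadingMinor_vandermonde_ne_zero {R : Type*} [CommRing R] [IsDomain R] {m : ℕ}
    {v : Fin m → R} (hv : Function.Injective v) (j : ℕ) :
    leadingMinor (Matrix.vandermonde v) j ≠ 0 := by
  induction m with
  | zero => rw [leadingMinor_of_le _ (Nat.zero_le _)]; simp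
  | succ m ih =>
    rcases Nat.lt_or_ge m j with hj | hj
    · rw [leadingMinor_of_le _ hj, Matrix.det_vandermonde_ne_zero_iff]
      exact hv
    · rw [leadingMinor_castSucc _ hj]
      exact ih (hv.comp (Fin.castSucc_injective m)) 

theorem exists_rows_leadingMinor_ne_zero {K : Type*} [Field K] {ι : Type*} {m : ℕ}
    {A : Fin m → ι → K} (hA : LinearIndependent K A) :
    ∃ σ : Fin m → ι, ∀ j, leadingMinor (Matrix.of fun a b => A b (σ a)) j ≠ 0 := by
  induction m with
  | zero => exact ⟨Fin.elim0, fun j => by rw [leadingMinor_of_le _ (Nat.zero_le _)]; simp⟩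
  | succ m ih =>
    obtain ⟨σ, hσ⟩ := ih (hA.comp _ (Fin.castSucc_injective m))
    have hsub : ∀ r : ι, (Matrix.of fun a b => A b ((Fin.snoc σ r : Fin (m + 1) → ι) a)).submatrix
        Fin.castSucc Fin.castSucc = Matrix.of fun a b => A (Fin.castSucc b) (σ a) := by
      intro r; ext a b; simp
    obtain ⟨r, hr⟩ : ∃ r : ι, (Matrix.of fun a b =>
        A b ((Fin.snoc σ r : Fin (m + 1) → ι) a)).det ≠ 0 := by
      by_contra! h
      let c : Fin (m + 1) → K := fun b => (-1) ^ (m + b : ℕ) *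
        (Matrix.of fun (a : Fin m) (b' : Fin m) => A (b.succAbove b') (σ a)).det
      have hc : ∑ b, c b • A b = 0 := by
        ext r
        have := h r
        rw [Matrix.det_succ_row _ (Fin.last m)] at this
        rw [Pi.zero_apply, ← this, Finset.sum_apply]
        refine Finset.sum_congr rfl fun b _ => ?_
        have : (Matrix.of fun a b => A b ((Fin.snoc σ r : Fin (m + 1) → ι) a)).submatrix
            (Fin.last m).succAbove b.succAbove =
            Matrix.of fun (a : Fin m) (b' : Fin m) => A (b.succAbove b') (σ a) := by
          ext a b'; simp
        rw [this]
        simp [c]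
        ring
      have h0 := Fintype.linearIndependent_iff.1 hA c hc (Fin.last m)
      have h1 := hσ m
      rw [leadingMinor_of_le _ le_rfl] at h1
      simp only [c, Fin.succAbove_last, mul_eq_zero] at h0
      rcases h0 with h0 | h0
      · simp at h0
      · exact h1 h0
    refine ⟨Fin.snoc σ r, fun j => ?_⟩
    rcases Nat.lt_or_ge m j with hj | hj
    · rwa [leadingMinor_of_le _ hj]
    · rw [leadingMinor_castSucc _ hj, hsub]
      exact hσ j

theorem leadingMinor_map {S : Type*} [CommRing S] (f : R →+* S) (M : Matrix (Fin m) (Fin m) R)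
    (j : ℕ) : leadingMinor (M.map f) j = f (leadingMinor M j) := by
  rw [leadingMinor, leadingMinor, RingHom.map_det]
  congr 1
  ext a b
  by_cases h : b.val < j <;> by_cases hab : a = b <;>
    simp [leadingMatrix, h, Matrix.one_apply, hab]

theorem leadingMatrix_updateCol_self (M : Matrix (Fin m) (Fin m) R) (i : Fin m) :
    (leadingMatrix M i).updateCol i (Pi.single i 1) = leadingMatrix M i := by
  ext a b
  rcases eq_or_ne b i with rfl | h
  · simp [leadingMatrix, Matrix.one_apply, Pi.single_apply]
  · simp [h]

theorem leadingMatrix_updateCol (M : Matrix (Fin m) (Fin m) R) (i : Fin m) :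
    (leadingMatrix M i).updateCol i (fun a => M a i) = leadingMatrix M (i + 1) := by
  ext a b
  rcases eq_or_ne b i with rfl | h
  · simp [leadingMatrix]
  · simp [h, leadingMatrix, le_iff_lt_or_eq, ← Fin.ext_iff]

theorem finite_setOf_leadingMinor_add_smul_eq_zero {K : Type*} [Field K] {m : ℕ}
    (M N : Matrix (Fin m) (Fin m) K) (j : ℕ) (h : leadingMinor M j ≠ 0) :
    {z : K | leadingMinor (M + z • N) j = 0}.Finite := by
  let P : Matrix (Fin m) (Fin m) (Polynomial K) :=
    M.map Polynomial.C + (Polynomial.X : Polynomial K) • N.map Polynomial.C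
  have hP : ∀ z : K, (leadingMinor P j).eval z = leadingMinor (M + z • N) j := by
    intro z
    rw [← Polynomial.coe_evalRingHom, ← leadingMinor_map]
    congr 1
    ext a b
    simp [P]
    ring
  have hne : leadingMinor P j ≠ 0 := by
    intro h0
    apply h
    have := hP 0
    rwa [h0, zero_smul, add_zero, Polynomial.eval_zero, eq_comm] at this
  refine (Polynomial.finite_setOfPred_isRoot hne).subset fun z hz => ?_
  rw [Set.mem_ofPred_eq, Polynomial.IsRoot, hP]
  exact hz

theorem continuous_leadingMinor [TopologicalSpace R] [IsTopologicalRing R] (j : ℕ) :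
    Continuous fun M : Matrix (Fin m) (Fin m) R => leadingMinor M j := by
  refine Continuous.matrix_det (continuous_matrix fun a b => ?_)
  by_cases h : b.val < j
  · simpa [leadingMatrix, h] using continuous_id.matrix_elem a b
  · simpa [leadingMatrix, h] using continuous_const

end LeadingMinors

section Frames

variable {m : ℕ} {ι : Type*}

/-- The square matrix with columns `A b`, restricted to the rows `σ a`. -/
def rowMatrix (σ : Fin m → ι) (A : Fin m → ι → ℂ) : Matrix (Fin m) (Fin m) ℂ :=
  Matrix.of fun a b => A b (σ a)

theorem continuous_rowMatrix (σ : Fin m → ι) : Continuous (rowMatrix σ) :=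
  continuous_matrix fun a b => (continuous_apply (σ a)).comp (continuous_apply b)

theorem injective_of_leadingMinor_rowMatrix_ne_zero {σ : Fin m → ι} {A : Fin m → ι → ℂ}
    (h : leadingMinor (rowMatrix σ A) m ≠ 0) : Function.Injective σ := by
  intro a a' haa
  by_contra hne
  rw [leadingMinor_of_le _ le_rfl] at h
  exact h (Matrix.det_zero_of_row_eq hne (by ext b; simp [rowMatrix, haa]))

theorem linearIndependent_of_leadingMinor_rowMatrix_ne_zero {σ : Fin m → ι} {A : Fin m → ι → ℂ}
    (h : leadingMinor (rowMatrix σ A) m ≠ 0) : LinearIndependent ℂ A := by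
  rw [leadingMinor_of_le _ le_rfl] at h
  have hcol := Matrix.linearIndependent_cols_of_det_ne_zero h
  exact LinearIndependent.of_comp (LinearMap.funLeft ℂ ℂ σ) hcol

theorem leadingMinor_rowMatrix_smul (σ : Fin m → ι) (A : Fin m → ι → ℂ) (c : ℕ → ℂ) {j : ℕ}
    (hj : j ≤ m) :
    leadingMinor (rowMatrix σ fun b => c b • A b) j =
      leadingMinor (rowMatrix σ A) j * ∏ i ∈ Finset.range j, c i := by
  rw [← leadingMinor_mul_diagonal _ _ hj]
  congr 1
  ext a b
  simp [rowMatrix, mul_comm]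

/-- The `m`-tuples of vectors all of whose leading minors along the rows `σ` equal `1`. -/
def normalizedFrames (σ : Fin m → ι) : Set (Fin m → ι → ℂ) :=
  {A | ∀ j ≤ m, leadingMinor (rowMatrix σ A) j = 1}

/-- Rescale each vector of `A` so that all leading minors along the rows `σ` become `1`. -/
def normalizeFrame (σ : Fin m → ι) (A : Fin m → ι → ℂ) : Fin m → ι → ℂ := fun b =>
  (leadingMinor (rowMatrix σ A) b / leadingMinor (rowMatrix σ A) (b + 1)) • A b

theorem normalizeFrame_mem {σ : Fin m → ι} {A : Fin m → ι → ℂ}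
    (h : ∀ j ≤ m, leadingMinor (rowMatrix σ A) j ≠ 0) :
    normalizeFrame σ A ∈ normalizedFrames σ := by
  have hprod : ∀ j ≤ m, leadingMinor (rowMatrix σ A) j * ∏ i ∈ Finset.range j,
      leadingMinor (rowMatrix σ A) i / leadingMinor (rowMatrix σ A) (i + 1) = 1 := by
    intro j
    induction j with
    | zero => intro _; simp [leadingMinor_zero]
    | succ j ih =>
      intro hj
      rw [Finset.prod_range_succ, mul_comm, mul_assoc, div_mul_cancel₀ _ (h _ hj), mul_comm]
      exact ih (Nat.le_of_succ_le hj)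
  intro j hj
  exact (leadingMinor_rowMatrix_smul σ A
    (fun i => leadingMinor (rowMatrix σ A) i / leadingMinor (rowMatrix σ A) (i + 1)) hj).trans
    (hprod j hj)

theorem normalizeFrame_smul (σ : Fin m → ι) (A : Fin m → ι → ℂ) {c : ℕ → ℂ}
    (hc : ∀ i, c i ≠ 0) :
    normalizeFrame σ (fun b => c b • A b) = normalizeFrame σ A := by
  funext b
  have hprod : ∏ i ∈ Finset.range b, c i ≠ 0 := Finset.prod_ne_zero_iff.2 fun i _ => hc i
  simp only [normalizeFrame]
  rw [leadingMinor_rowMatrix_smul _ _ _ b.2.le, leadingMinor_rowMatrix_smul _ _ _ b.2,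
    Finset.prod_range_succ, smul_smul]
  congr 1
  have := hc b
  rw [div_mul_eq_mul_div, ← mul_assoc, mul_assoc _ (∏ i ∈ Finset.range b, c i),
    mul_assoc _ (∏ i ∈ Finset.range b, c i), mul_div_mul_right _ _ (mul_ne_zero hprod this)]

theorem continuousOn_normalizeFrame (σ : Fin m → ι) :
    ContinuousOn (normalizeFrame σ) {A | ∀ j ≤ m, leadingMinor (rowMatrix σ A) j ≠ 0} := by
  have hD : ∀ j, Continuous fun A : Fin m → ι → ℂ => leadingMinor (rowMatrix σ A) j := fun j =>
    (continuous_leadingMinor j).comp (continuous_rowMatrix σ)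
  refine continuousOn_pi.2 fun b => ?_
  exact ((hD b).continuousOn.div (hD (b + 1)).continuousOn fun A
    (hA : ∀ j ≤ m, leadingMinor (rowMatrix σ A) j ≠ 0) => hA _ b.2).smul
    (continuous_apply b).continuousOn

/-- Keep the vectors of index `< i`, move the `i`-th one along the segment to the basis vector of
index `σ i`, and replace the later ones by basis vectors. -/
def straighten [DecidableEq ι] (σ : Fin m → ι) (i : Fin m) (s : ℝ) (A : Fin m → ι → ℂ) :
    Fin m → ι → ℂ := fun b =>
  if b < i then A b
  else if b = i then (1 - s : ℂ) • A b + (s : ℂ) • Pi.single (σ b) 1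
  else Pi.single (σ b) 1

theorem straighten_mem [DecidableEq ι] {σ : Fin m → ι} (hσ : Function.Injective σ) (i : Fin m)
    (s : ℝ) {A : Fin m → ι → ℂ} (hA : A ∈ normalizedFrames σ) :
    straighten σ i s A ∈ normalizedFrames σ := by
  intro j hj
  rcases le_or_gt j i with hji | hij
  · rw [← hA j hj, leadingMinor, leadingMinor]
    congr 1
    ext a b
    by_cases hb : b.val < j
    · have : b < i := Fin.lt_def.2 (hb.trans_le hji)
      simp [leadingMatrix, hb, rowMatrix, straighten, this]
    · simp [leadingMatrix, hb]
  · have : leadingMatrix (rowMatrix σ (straighten σ i s A)) j =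
        (leadingMatrix (rowMatrix σ A) i).updateCol i
          ((1 - s : ℂ) • (fun a => rowMatrix σ A a i) + (s : ℂ) • Pi.single i 1) := by
      ext a b
      rcases lt_trichotomy b i with h | rfl | h
      · have hb : b.val < j := lt_trans h hij
        simp [leadingMatrix, hb, h, h.ne, rowMatrix, straighten]
      · simp [leadingMatrix, hij, rowMatrix, straighten, Pi.single_apply, hσ.eq_iff]
      · simp [leadingMatrix, h.not_gt, h.ne', rowMatrix, straighten, Pi.single_apply,
          hσ.eq_iff, Matrix.one_apply]
    rw [leadingMinor, this, Matrix.det_updateCol_add, Matrix.det_updateCol_smul,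
      Matrix.det_updateCol_smul, leadingMatrix_updateCol, leadingMatrix_updateCol_self]
    change _ * leadingMinor _ _ + _ * leadingMinor _ _ = 1
    rw [hA _ i.2, hA _ i.2.le]
    ring

theorem contractibleSpace_normalizedFrames {σ : Fin m → ι} (hσ : Function.Injective σ) :
    ContractibleSpace (normalizedFrames σ) := by
  classical
  have key : ∀ k i, i + k = m → ∃ F : C(normalizedFrames σ, normalizedFrames σ),
      (∀ A b, (F A).1 b = if b.val < i then A.1 b else Pi.single (σ b) 1) ∧
      (ContinuousMap.id _).Homotopic F := by
    intro k
    induction k with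
    | zero =>
      rintro i rfl
      exact ⟨ContinuousMap.id _, fun A b => by simp, .refl _⟩
    | succ k ih =>
      intro i hi
      obtain ⟨F, hF, hhom⟩ := ih (i + 1) (by omega)
      let i' : Fin m := ⟨i, by omega⟩
      have hcont : Continuous fun p : ℝ × normalizedFrames σ =>
          (⟨straighten σ i' p.1 p.2.1, straighten_mem hσ i' p.1 p.2.2⟩ : normalizedFrames σ) := by
        refine Continuous.subtype_mk (continuous_pi fun b => ?_) _
        have hA : Continuous fun p : ℝ × normalizedFrames σ => p.2.1 b :=
          (continuous_apply b).comp (continuous_subtype_val.comp continuous_snd)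
        have hs : Continuous fun p : ℝ × normalizedFrames σ => (p.1 : ℂ) :=
          Complex.continuous_ofReal.comp continuous_fst
        unfold straighten
        split_ifs
        · exact hA
        · exact ((continuous_const.sub hs).smul hA).add (hs.smul continuous_const)
        · exact continuous_const
      refine ⟨⟨fun A => ⟨straighten σ i' 1 A.1, straighten_mem hσ i' 1 A.2⟩,
        hcont.comp (Continuous.prodMk_right (1 : ℝ))⟩, fun A b => ?_, hhom.trans ⟨⟨⟨fun p =>
        ⟨straighten σ i' p.1 p.2.1, straighten_mem hσ i' p.1 p.2.2⟩, ?_⟩, fun A => ?_,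
        fun A => ?_⟩⟩⟩
      · simp only [ContinuousMap.coe_mk, straighten, Fin.lt_def, i']
        split_ifs <;> simp
      · exact hcont.comp ((continuous_subtype_val.comp continuous_fst).prodMk continuous_snd)
      · ext b : 2
        rw [hF]
        simp only [straighten, Fin.lt_def, Fin.ext_iff, i']
        rcases lt_trichotomy b.val i with h | h | h
        · simp [h, h.trans (Nat.lt_succ_self i)]
        · simp [h]
        · simp [h.not_gt, h.ne', (Nat.succ_le_of_lt h).not_gt]
      · simp
  obtain ⟨F, hF, hhom⟩ := key m 0 (by omega)
  rw [contractible_iff_id_nullhomotopic]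
  let A₀ : normalizedFrames σ := ⟨fun b => Pi.single (σ b) 1, fun j _ => by
    have : leadingMatrix (rowMatrix σ fun b => Pi.single (σ b) 1) j = 1 := by
      ext a b
      simp [leadingMatrix, rowMatrix, Pi.single_apply, hσ.eq_iff, Matrix.one_apply]
    rw [leadingMinor, this, Matrix.det_one]⟩
  refine ⟨A₀, ?_⟩
  have : F = ContinuousMap.const _ A₀ := by
    ext A b : 3
    simp [hF, A₀]
  rwa [← this]

end Frames

section Configurations

theorem isOpenQuotientMap_projectivization_mk' (V : Type*) [AddCommGroup V] [Module ℂ V]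
    [TopologicalSpace V] [ContinuousConstSMul ℂ V] :
    IsOpenQuotientMap (Projectivization.mk' ℂ : {v : V // v ≠ 0} → Projectivization ℂ V) := by
  refine ⟨Quotient.mk_surjective, continuous_quot_mk, fun O hO => ?_⟩
  have hq : Topology.IsQuotientMap
      (Projectivization.mk' ℂ : {v : V // v ≠ 0} → Projectivization ℂ V) := isQuotientMap_quot_mk
  rw [← hq.isOpen_preimage]
  obtain ⟨W, hW, rfl⟩ := isOpen_induced_iff.1 hO
  have : (Projectivization.mk' ℂ : {v : V // v ≠ 0} → Projectivization ℂ V) ⁻¹'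
      (Projectivization.mk' ℂ '' (Subtype.val ⁻¹' W)) =
      ⋃ c : ℂˣ, (fun v : {v : V // v ≠ 0} => (c : ℂ) • v.1) ⁻¹' W := by
    ext v
    simp only [Set.mem_preimage, Set.mem_image, Set.mem_iUnion]
    constructor
    · rintro ⟨w, hw, hwv⟩
      rw [Projectivization.mk'_eq_mk, Projectivization.mk'_eq_mk,
        Projectivization.mk_eq_mk_iff] at hwv
      obtain ⟨c, hc⟩ := hwv
      exact ⟨c, by rw [← Units.smul_def, hc]; exact hw⟩
    · rintro ⟨c, hc⟩
      refine ⟨⟨(c : ℂ) • v.1, smul_ne_zero c.ne_zero v.2⟩, hc, ?_⟩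
      rw [Projectivization.mk'_eq_mk, Projectivization.mk'_eq_mk,
        Projectivization.mk_eq_mk_iff]
      exact ⟨c, rfl⟩
  rw [this]
  exact isOpen_iUnion fun c => hW.preimage (continuous_subtype_val.const_smul _)

variable {m n : ℕ}

/-- The representative vectors of a tuple of points. -/
def repFrame (x : Fin m → CP n) : Fin m → Fin (n + 1) → ℂ := fun b => (x b).rep

/-- The tuple of points represented by a tuple of nonzero vectors. -/
def projFrame (A : Fin m → {v : Fin (n + 1) → ℂ // v ≠ 0}) : Fin m → CP n :=
  Pi.map (fun _ => Projectivization.mk' ℂ) A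

theorem isOpenQuotientMap_projFrame :
    IsOpenQuotientMap (projFrame : (Fin m → {v : Fin (n + 1) → ℂ // v ≠ 0}) → _) :=
  IsOpenQuotientMap.piMap fun _ => isOpenQuotientMap_projectivization_mk' _

theorem exists_repFrame_projFrame (A : Fin m → {v : Fin (n + 1) → ℂ // v ≠ 0}) :
    ∃ c : ℕ → ℂ, (∀ i, c i ≠ 0) ∧ repFrame (projFrame A) = fun b : Fin m => c b • (A b).1 := by
  choose c hc using fun b => Projectivization.exists_smul_eq_mk_rep ℂ (A b).1 (A b).2
  refine ⟨fun i => if h : i < m then c ⟨i, h⟩ else 1, fun i => ?_, ?_⟩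
  · dsimp only
    split_ifs
    · exact Units.ne_zero _
    · exact one_ne_zero
  · funext b
    simp only [b.2, dite_true]
    exact (hc b).symm

theorem projFrame_repFrame (x : Fin m → CP n) :
    projFrame (fun b => ⟨repFrame x b, (x b).rep_nonzero⟩) = x :=
  funext fun b => (x b).mk_rep

theorem projFrame_eq_of_smul {A : Fin m → {v : Fin (n + 1) → ℂ // v ≠ 0}} {x : Fin m → CP n}
    {c : Fin m → ℂ} (h : ∀ b, (A b).1 = c b • repFrame x b) : projFrame A = x := by
  rw [← projFrame_repFrame x]
  funext b
  exact (Projectivization.mk_eq_mk_iff' ℂ _ _ _ _).2 ⟨c b, (h b).symm⟩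

theorem mem_Fconf_iff {i : ℕ} (x : Fin (i + 1) → CP n) :
    x ∈ Fconf (i + 1) i n ↔ LinearIndependent ℂ (repFrame x) := by
  rw [linearIndependent_iff_card_eq_finrank_span, Fintype.card_fin]
  constructor
  · exact fun h => h.2.symm
  · intro h
    refine ⟨?_, h.symm⟩
    have hli : LinearIndependent ℂ (repFrame x) := by
      rwa [linearIndependent_iff_card_eq_finrank_span, Fintype.card_fin]
    exact fun a b hab => hli.injective (congrArg Projectivization.rep hab)

/-- The tuples of points all of whose leading minors along the rows `σ` are nonzero. -/
def chart (n : ℕ) (σ : Fin m → Fin (n + 1)) : Set (Fin m → CP n) :=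
  {x | ∀ j ≤ m, leadingMinor (rowMatrix σ (repFrame x)) j ≠ 0}

theorem mem_chart {σ : Fin m → Fin (n + 1)} {x : Fin m → CP n} :
    x ∈ chart n σ ↔ ∀ j ≤ m, leadingMinor (rowMatrix σ (repFrame x)) j ≠ 0 := Iff.rfl

theorem projFrame_mem_chart {σ : Fin m → Fin (n + 1)}
    {A : Fin m → {v : Fin (n + 1) → ℂ // v ≠ 0}} :
    projFrame A ∈ chart n σ ↔
      ∀ j ≤ m, leadingMinor (rowMatrix σ fun b => (A b).1) j ≠ 0 := by
  obtain ⟨c, hc, h⟩ := exists_repFrame_projFrame A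
  rw [mem_chart, h]
  refine forall₂_congr fun j hj => ?_
  rw [leadingMinor_rowMatrix_smul σ (fun b => (A b).1) c hj]
  simp [hc, Finset.prod_eq_zero_iff]

theorem isOpen_chart (σ : Fin m → Fin (n + 1)) : IsOpen (chart n σ) := by
  rw [← isOpenQuotientMap_projFrame.isQuotientMap.isOpen_preimage]
  have : projFrame ⁻¹' chart n σ =
      ⋂ j ∈ Set.Iic m, {A | leadingMinor (rowMatrix σ fun b => (A b).1) j ≠ 0} := by
    ext A
    simp [projFrame_mem_chart]
  rw [this]
  refine (Set.finite_Iic m).isOpen_biInter fun j _ => isOpen_ne_fun ?_ continuous_const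
  exact (continuous_leadingMinor j).comp ((continuous_rowMatrix σ).comp
    (continuous_pi fun b => continuous_subtype_val.comp (continuous_apply b)))

theorem continuousOn_normalizeFrame_repFrame (σ : Fin m → Fin (n + 1)) :
    ContinuousOn (fun x => normalizeFrame σ (repFrame x)) (chart n σ) := by
  rw [isOpenQuotientMap_projFrame.isQuotientMap.continuousOn_isOpen_iff (isOpen_chart σ)]
  have : (fun x => normalizeFrame σ (repFrame x)) ∘ projFrame =
      fun A : Fin m → {v : Fin (n + 1) → ℂ // v ≠ 0} => normalizeFrame σ fun b => (A b).1 := by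
    funext A
    obtain ⟨c, hc, h⟩ := exists_repFrame_projFrame A
    simp only [Function.comp, h]
    exact normalizeFrame_smul σ (fun b => (A b).1) hc
  rw [this]
  refine (continuousOn_normalizeFrame σ).comp (Continuous.continuousOn
    (continuous_pi fun b => continuous_subtype_val.comp (continuous_apply b))) fun A hA => ?_
  exact projFrame_mem_chart.1 hA

variable {i : ℕ}

theorem chart_subset_Fconf (σ : Fin (i + 1) → Fin (n + 1)) : chart n σ ⊆ Fconf (i + 1) i n :=
  fun x hx => (mem_Fconf_iff x).2
    (linearIndependent_of_leadingMinor_rowMatrix_ne_zero (hx _ le_rfl))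

theorem exists_mem_chart {x : Fin (i + 1) → CP n} (hx : x ∈ Fconf (i + 1) i n) :
    ∃ σ : Fin (i + 1) → Fin (n + 1), Function.Injective σ ∧ x ∈ chart n σ := by
  obtain ⟨σ, hσ⟩ := exists_rows_leadingMinor_ne_zero ((mem_Fconf_iff x).1 hx)
  exact ⟨σ, injective_of_leadingMinor_rowMatrix_ne_zero (hσ (i + 1)), fun j _ => hσ j⟩

theorem exists_mem_all_charts (hmn : m ≤ n + 1) :
    ∃ x : Fin m → CP n, ∀ σ : Fin m → Fin (n + 1), Function.Injective σ → x ∈ chart n σ := by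
  let A : Fin m → Fin (n + 1) → ℂ := fun b r => (r.val : ℂ) ^ b.val
  have hA : ∀ σ : Fin m → Fin (n + 1), Function.Injective σ →
      ∀ j, leadingMinor (rowMatrix σ A) j ≠ 0 := fun σ hσ j =>
    leadingMinor_vandermonde_ne_zero (v := fun a => ((σ a).val : ℂ))
      (fun a b hab => hσ (Fin.ext (Nat.cast_injective hab))) j
  have hli : LinearIndependent ℂ A := linearIndependent_of_leadingMinor_rowMatrix_ne_zero
    (hA (Fin.castLE hmn) (Fin.castLE_injective hmn) m)
  exact ⟨projFrame fun b => ⟨A b, hli.ne_zero b⟩, fun σ hσ =>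
    projFrame_mem_chart.2 fun j _ => hA σ hσ j⟩

theorem joinedIn_chart_inter_chart {σ τ : Fin m → Fin (n + 1)} {x y : Fin m → CP n}
    (hx : x ∈ chart n σ ∩ chart n τ) (hy : y ∈ chart n σ ∩ chart n τ) :
    JoinedIn (chart n σ ∩ chart n τ) x y := by
  let A : ℂ → Fin m → Fin (n + 1) → ℂ := fun z => repFrame x + z • (repFrame y - repFrame x)
  let bad : (Fin m → Fin (n + 1)) → Set ℂ := fun ρ =>
    ⋃ j ∈ Set.Iic m, {z | leadingMinor (rowMatrix ρ (A z)) j = 0}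
  have hbad : ∀ ρ, x ∈ chart n ρ → (bad ρ).Finite := fun ρ hρ =>
    (Set.finite_Iic m).biUnion fun j hj =>
      finite_setOf_leadingMinor_add_smul_eq_zero (rowMatrix ρ (repFrame x))
        (rowMatrix ρ (repFrame y - repFrame x)) j (hρ j hj)
  have hgood : ∀ ρ z, z ∉ bad ρ ↔ ∀ j ≤ m, leadingMinor (rowMatrix ρ (A z)) j ≠ 0 := by
    intro ρ z
    simp [bad]
  have hA0 : A 0 = repFrame x := by simp [A]
  have hA1 : A 1 = repFrame y := by simp [A]
  have hpc : IsPathConnected (bad σ ∪ bad τ)ᶜ :=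
    ((hbad σ hx.1).union (hbad τ hx.2)).countable.isPathConnected_compl_of_one_lt_rank
      (by rw [Complex.rank_real_complex]; exact Nat.one_lt_ofNat)
  have h0 : (0 : ℂ) ∈ (bad σ ∪ bad τ)ᶜ := by
    rw [Set.compl_union]
    exact ⟨(hgood σ 0).2 (hA0 ▸ hx.1), (hgood τ 0).2 (hA0 ▸ hx.2)⟩
  have h1 : (1 : ℂ) ∈ (bad σ ∪ bad τ)ᶜ := by
    rw [Set.compl_union]
    exact ⟨(hgood σ 1).2 (hA1 ▸ hy.1), (hgood τ 1).2 (hA1 ▸ hy.2)⟩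
  obtain ⟨γ, hγ⟩ := hpc.joinedIn 0 h0 1 h1
  simp only [Set.compl_union] at hγ
  have hγσ := fun t => (hgood σ _).1 (hγ t).1
  have hγτ := fun t => (hgood τ _).1 (hγ t).2
  have hne : ∀ t b, A (γ t) b ≠ 0 := fun t b =>
    (linearIndependent_of_leadingMinor_rowMatrix_ne_zero (hγσ t m le_rfl)).ne_zero b
  have hcont : Continuous fun t => projFrame fun b => ⟨A (γ t) b, hne t b⟩ := by
    refine isOpenQuotientMap_projFrame.continuous.comp
      (continuous_pi fun b => Continuous.subtype_mk ?_ _)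
    exact continuous_const.add (γ.continuous.smul continuous_const)
  refine ⟨⟨⟨_, hcont⟩, ?_, ?_⟩, fun t =>
    ⟨projFrame_mem_chart.2 (hγσ t), projFrame_mem_chart.2 (hγτ t)⟩⟩
  · refine projFrame_eq_of_smul (c := 1) fun b => ?_
    simp [hA0]
  · refine projFrame_eq_of_smul (c := 1) fun b => ?_
    simp [hA1]

/-- The space of `i + 1` projectively independent points of `ℂP^n` is simply connected. -/
theorem simplyConnectedSpace_Fconf (hin : i ≤ n) : SimplyConnectedSpace (Fconf (i + 1) i n) := by
  obtain ⟨x₀, hx₀⟩ := exists_mem_all_charts (Nat.succ_le_succ hin)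
  have hx₀F : x₀ ∈ Fconf (i + 1) i n := chart_subset_Fconf _
    (hx₀ (Fin.castLE (Nat.succ_le_succ hin)) (Fin.castLE_injective _))
  refine simplyConnectedSpace_of_isOpen_cover
    (fun σ : {σ : Fin (i + 1) → Fin (n + 1) // Function.Injective σ} =>
      (Subtype.val ⁻¹' chart n σ.1 : Set (Fconf (i + 1) i n)))
    (fun σ => (isOpen_chart σ.1).preimage continuous_subtype_val) (fun x => ?_)
    ⟨x₀, hx₀F⟩ (fun σ => hx₀ σ.1 σ.2) (fun σ τ => ?_) fun σ x y p q hp hq => ?_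
  · obtain ⟨σ, hσ, hx⟩ := exists_mem_chart x.2
    exact ⟨⟨σ, hσ⟩, hx⟩
  · refine ⟨⟨x₀, hx₀F⟩, ⟨hx₀ σ.1 σ.2, hx₀ τ.1 τ.2⟩, fun {y} hy => ?_⟩
    obtain ⟨γ, hγ⟩ := joinedIn_chart_inter_chart ⟨hx₀ σ.1 σ.2, hx₀ τ.1 τ.2⟩ hy
    exact ⟨⟨⟨fun t => ⟨γ t, chart_subset_Fconf σ.1 (hγ t).1⟩, γ.continuous.subtype_mk _⟩,
      Subtype.ext γ.source, Subtype.ext γ.target⟩, hγ⟩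
  · have := contractibleSpace_normalizedFrames σ.2
    have hD : ∀ A : normalizedFrames σ.1, ∀ j ≤ i + 1,
        leadingMinor (rowMatrix σ.1 A.1) j ≠ 0 := fun A j hj => by
      rw [A.2 j hj]
      exact one_ne_zero
    have hne : ∀ (A : normalizedFrames σ.1) b, A.1 b ≠ 0 := fun A b =>
      (linearIndependent_of_leadingMinor_rowMatrix_ne_zero (hD A _ le_rfl)).ne_zero b
    let r : C(normalizedFrames σ.1, Fconf (i + 1) i n) :=
      ⟨fun A => ⟨projFrame fun b => ⟨A.1 b, hne A b⟩,
        chart_subset_Fconf σ.1 (projFrame_mem_chart.2 (hD A))⟩,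
        Continuous.subtype_mk (isOpenQuotientMap_projFrame.continuous.comp
          (continuous_pi fun b => Continuous.subtype_mk
            ((continuous_apply b).comp continuous_subtype_val) _)) _⟩
    refine Path.homotopic_of_factors_through
      (s := fun x : Fconf (i + 1) i n => normalizeFrame σ.1 (repFrame x.1))
      ((continuousOn_normalizeFrame_repFrame σ.1).comp continuous_subtype_val.continuousOn
        fun x hx => hx)
      (fun x hx => normalizeFrame_mem hx) r (fun x hx => Subtype.ext ?_) p q hp hq
    exact projFrame_eq_of_smul fun b => rfl

end Configurations

/-- For every `k ≥ 1`, the spaces `F_k^{k-1,k}` and `F_{k+1}^{k,k}` are simply connected. -/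
theorem Fconf_top_strata_simplyConnected (k : ℕ) (hk : 1 ≤ k) :
    SimplyConnectedSpace (Fconf k (k - 1) k) ∧
      SimplyConnectedSpace (Fconf (k + 1) k k) := by
  refine ⟨?_, simplyConnectedSpace_Fconf le_rfl⟩
  obtain ⟨i, rfl⟩ : ∃ i, k = i + 1 := ⟨k - 1, by omega⟩
  exact simplyConnectedSpace_Fconf (Nat.le_succ i)
end
end

section
/- The fundamental group of F_4^{1,2} (the space of 4 distinct collinear points in ℂP², at any basepoint) is isomorphic to the free group on two generators. -/
noncomputable section

open Module Submodule

section OpenCover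

open Set unitInterval

variable {X ι : Type*} [TopologicalSpace X] {U : ι → Set X}

/-- A property of homotopy classes of paths which is stable under concatenation and holds for
the paths contained in a member of an open cover holds for all paths. -/
theorem Path.Homotopic.Quotient.induction_of_openCover
    (hU : ∀ i, IsOpen (U i)) (hcov : ∀ x, ∃ i, x ∈ U i)
    {P : ∀ {a b : X}, Path.Homotopic.Quotient a b → Prop}
    (small : ∀ i {a b : X} (γ : Path a b), (∀ t, γ t ∈ U i) → P (.mk γ))
    (trans : ∀ {a b c : X} (p : Path.Homotopic.Quotient a b) (q : Path.Homotopic.Quotient b c),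
      P p → P q → P (p.trans q))
    {a b : X} (p : Path.Homotopic.Quotient a b) : P p := by
  induction p using Path.Homotopic.Quotient.ind with | mk γ => ?_
  obtain ⟨t, t0, tmono, ⟨n, hn⟩, ht⟩ := exists_monotone_Icc_subset_open_cover_unitInterval
    (c := fun i => γ ⁻¹' U i) (fun i => (hU i).preimage γ.continuous)
    (fun s _ => mem_iUnion.2 (hcov (γ s)))
  have hstep (m : ℕ) : P (.mk (γ.subpath (t m) (t (m + 1)))) := by
    obtain ⟨i, hi⟩ := ht m
    refine small i _ fun s => ?_
    have : γ.subpath (t m) (t (m + 1)) s ∈ γ '' Icc (t m) (t (m + 1)) := by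
      rw [← γ.range_subpath_of_le _ _ (tmono m.le_succ)]
      exact mem_range_self s
    obtain ⟨r, hr, h⟩ := this
    exact h ▸ hi hr
  have hind (m : ℕ) : P (.mk (γ.subpath (t 0) (t (m + 1)))) := by
    induction m with
    | zero => exact hstep 0
    | succ m ih =>
      have := trans _ _ ih (hstep (m + 1))
      rwa [← Path.Homotopic.Quotient.mk_trans,
        Path.Homotopic.Quotient.eq.2 ⟨Path.Homotopy.subpathTransSubpath γ _ _ _⟩] at this
  have key := hind n
  rw [t0, hn (n + 1) n.le_succ, γ.subpath_zero_one] at key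
  obtain ⟨γ, rfl, rfl⟩ := γ
  exact key

theorem Path.Homotopic.Quotient.trans_symm_trans {a b c : X} (p : Path.Homotopic.Quotient a b)
    (q : Path.Homotopic.Quotient c b) : (p.trans q.symm).trans q = p := by
  rw [Path.Homotopic.Quotient.trans_assoc, q.symm_trans, p.trans_refl]

/-- If a space is covered by path connected open sets containing the base point, then a subgroup of
its fundamental group is everything as soon as it contains all the loops which are the
concatenation of a path in a member of the cover and of a path in a member of the cover. -/
theorem FundamentalGroup.subgroup_eq_top_of_openCover
    (hU : ∀ i, IsOpen (U i)) (hcov : ∀ x, ∃ i, x ∈ U i) (hpc : ∀ i, IsPathConnected (U i))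
    {x₀ : X} (hx₀ : ∀ i, x₀ ∈ U i) (N : Subgroup (FundamentalGroup X x₀))
    (hN : ∀ (i j : ι) (y : X) (α β : Path x₀ y), (∀ t, α t ∈ U i) → (∀ t, β t ∈ U j) →
      FundamentalGroup.fromPath ((Path.Homotopic.Quotient.mk α).trans (.symm (.mk β))) ∈ N) :
    N = ⊤ := by
  have hmul (p q : Path.Homotopic.Quotient x₀ x₀) (hp : FundamentalGroup.fromPath p ∈ N)
      (hq : FundamentalGroup.fromPath q ∈ N) : FundamentalGroup.fromPath (p.trans q) ∈ N :=
    N.mul_mem hq hp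
  have hjoin (i : ι) (y : X) (hy : y ∈ U i) : ∃ α : Path x₀ y, ∀ t, α t ∈ U i :=
    (hpc i).joinedIn x₀ (hx₀ i) y hy
  refine (Subgroup.eq_top_iff' N).2 fun p => ?_
  have key : ∀ {a b : X} (p : Path.Homotopic.Quotient a b) (i j : ι) (α : Path x₀ a)
      (β : Path x₀ b), (∀ t, α t ∈ U i) → (∀ t, β t ∈ U j) →
      FundamentalGroup.fromPath (((Path.Homotopic.Quotient.mk α).trans p).trans (.symm (.mk β)))
        ∈ N := by
    refine fun p => Path.Homotopic.Quotient.induction_of_openCover hU hcov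
      (P := fun {a b} p => ∀ (i j : ι) (α : Path x₀ a) (β : Path x₀ b), (∀ t, α t ∈ U i) →
        (∀ t, β t ∈ U j) → FundamentalGroup.fromPath
          (((Path.Homotopic.Quotient.mk α).trans p).trans (.symm (.mk β))) ∈ N) ?_ ?_ p
    · intro k a b γ hγ i j α β hα hβ
      obtain ⟨α', hα'⟩ := hjoin k a (by simpa using hγ 0)
      have h1 := hN i k a α α' hα hα'
      have h2 := hN k j b (α'.trans γ) β (fun t => by
        have : (α'.trans γ) t ∈ range (α'.trans γ) := mem_range_self t
        rw [Path.trans_range] at this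
        rcases this with ⟨s, hs⟩ | ⟨s, hs⟩
        exacts [hs ▸ hα' s, hs ▸ hγ s]) hβ
      convert hmul _ _ h1 h2 using 1
      simp [← Path.Homotopic.Quotient.trans_assoc, Path.Homotopic.Quotient.trans_symm_trans]
    · intro a b c p q hp hq i j α β hα hβ
      obtain ⟨k, hk⟩ := hcov b
      obtain ⟨δ, hδ⟩ := hjoin k b hk
      convert hmul _ _ (hp i k α δ hα hδ) (hq k j δ β hδ hβ) using 1
      simp [← Path.Homotopic.Quotient.trans_assoc, Path.Homotopic.Quotient.trans_symm_trans]
  obtain ⟨i, -⟩ := hcov x₀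
  have := key p i i (.refl x₀) (.refl x₀) (fun _ => hx₀ i) (fun _ => hx₀ i)
  rw [Path.Homotopic.Quotient.mk_refl, Path.Homotopic.Quotient.refl_trans,
    ← Path.Homotopic.Quotient.mk_refl, ← Path.Homotopic.Quotient.mk_symm, Path.refl_symm] at this
  convert this
  exact (Path.Homotopic.Quotient.trans_refl p).symm

theorem IsSimplyConnected.mk_eq_mk {s : Set X} (hs : IsSimplyConnected s) {a b : X}
    (γ γ' : Path a b) (hγ : ∀ t, γ t ∈ s) (hγ' : ∀ t, γ' t ∈ s) :
    Path.Homotopic.Quotient.mk γ = .mk γ' := by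
  have := hs.simplyConnectedSpace
  have ha : a ∈ s := by simpa using hγ 0
  have hb : b ∈ s := by simpa using hγ 1
  let lift (δ : Path a b) (hδ : ∀ t, δ t ∈ s) : Path (⟨a, ha⟩ : s) ⟨b, hb⟩ :=
    { toFun t := ⟨δ t, hδ t⟩
      source' := by simp
      target' := by simp }
  exact Path.Homotopic.Quotient.eq.2
    ((SimplyConnectedSpace.paths_homotopic (lift γ hγ) (lift γ' hγ')).map
      ⟨Subtype.val, continuous_subtype_val⟩)

/-- A space covered by simply connected open sets with pairwise path connected intersections, all
containing a common point, is simply connected. -/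
theorem SimplyConnectedSpace.of_openCover
    (hU : ∀ i, IsOpen (U i)) (hcov : ∀ x, ∃ i, x ∈ U i) (hsc : ∀ i, IsSimplyConnected (U i))
    (hinter : ∀ i j, IsPathConnected (U i ∩ U j)) {x₀ : X} (hx₀ : ∀ i, x₀ ∈ U i) :
    SimplyConnectedSpace X := by
  have hjoin (y : X) : Joined x₀ y := by
    obtain ⟨i, hi⟩ := hcov y
    exact ((hsc i).isPathConnected.joinedIn x₀ (hx₀ i) y hi).joined
  have hpc : PathConnectedSpace X :=
    ⟨⟨x₀⟩, fun x y => (hjoin x).symm.trans (hjoin y)⟩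
  have htop : (⊥ : Subgroup (FundamentalGroup X x₀)) = ⊤ := by
    refine FundamentalGroup.subgroup_eq_top_of_openCover hU hcov
      (fun i => (hsc i).isPathConnected) hx₀ _ fun i j y α β hα hβ => ?_
    have hyi : y ∈ U i := by simpa using hα 1
    have hyj : y ∈ U j := by simpa using hβ 1
    obtain ⟨ε, hε⟩ := (hinter i j).joinedIn x₀ ⟨hx₀ i, hx₀ j⟩ y ⟨hyi, hyj⟩
    rw [(hsc i).mk_eq_mk α ε hα fun t => (hε t).1, (hsc j).mk_eq_mk β ε hβ fun t => (hε t).2]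
    rw [Path.Homotopic.Quotient.trans_symm]
    exact Subgroup.one_mem _
  have hsub (x : X) : Subsingleton (FundamentalGroup X x) := by
    have : Subsingleton (FundamentalGroup X x₀) := Subgroup.subsingleton_iff.1
      (subsingleton_of_bot_eq_top htop)
    exact (FundamentalGroup.fundamentalGroupMulEquivOfPathConnected x x₀).toEquiv.subsingleton
  exact simply_connected_iff_loops_nullhomotopic.2 ⟨hpc, fun x γ =>
    Path.Homotopic.Quotient.exact
      (@Subsingleton.elim _ (hsub x) (FundamentalGroup.fromPath (.mk γ)) 1)⟩

theorem SimplyConnectedSpace.of_retract {Y : Type*} [TopologicalSpace Y] [SimplyConnectedSpace Y]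
    (f : C(Y, X)) (g : C(X, Y)) (h : ∀ x, f (g x) = x) : SimplyConnectedSpace X := by
  refine simply_connected_iff_loops_nullhomotopic.2
    ⟨(Function.LeftInverse.surjective h).pathConnectedSpace f.continuous, fun x γ => ?_⟩
  have := ((SimplyConnectedSpace.paths_homotopic (γ.map g.continuous) (.refl _)).map f).pathCast
    (h x).symm (h x).symm
  convert this using 1
  · ext t
    simp [h]
  · ext t
    simp [h]

end OpenCover

section TwoComponentCover

open Set unitInterval

variable {X ι G : Type*} [TopologicalSpace X]

theorem Path.Homotopic.Quotient.trans_symm_trans_symm_symm {a b c d : X}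
    (p : Path.Homotopic.Quotient a b) (q : Path.Homotopic.Quotient c b)
    (r : Path.Homotopic.Quotient d b) :
    (p.trans r.symm).trans (q.trans r.symm).symm = p.trans q.symm := by
  have : (q.trans r.symm).symm = r.trans q.symm := by
    induction q using Path.Homotopic.Quotient.ind with | mk q => ?_
    induction r using Path.Homotopic.Quotient.ind with | mk r => ?_
    simp only [← Path.Homotopic.Quotient.mk_symm, ← Path.Homotopic.Quotient.mk_trans,
      Path.trans_symm, Path.symm_symm]
  rw [this, ← Path.Homotopic.Quotient.trans_assoc, p.trans_symm_trans r]

/-- An open cover `U` such that the intersection of any two distinct members is the disjoint union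
of the open sets `A` and `B`, which are contained in all the members. -/
structure IsTwoComponentCover (U : ι → Set X) (A B : Set X) : Prop where
  isOpen : ∀ i, IsOpen (U i)
  covers : ∀ x, ∃ i, x ∈ U i
  isOpen_left : IsOpen A
  isOpen_right : IsOpen B
  disjoint : Disjoint A B
  left_subset : ∀ i, A ⊆ U i
  right_subset : ∀ i, B ⊆ U i
  inter_subset : ∀ i j, i ≠ j → U i ∩ U j ⊆ A ∪ B

namespace IsTwoComponentCover

variable {U : ι → Set X} {A B : Set X} [Group G] [TopologicalSpace G] [DiscreteTopology G]

open Classical in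
/-- The principal bundle with discrete structure group `G`, trivial over the members of the cover,
whose transition function from `U i` to `U j` is `1` on `A` and `(g j)⁻¹ * g i` on `B`. -/
def bundleCore (h : IsTwoComponentCover U A B) (g : ι → G) : FiberBundleCore ι X G where
  baseSet := U
  isOpen_baseSet := h.isOpen
  indexAt x := (h.covers x).choose
  mem_baseSet_at x := (h.covers x).choose_spec
  coordChange i j x v := if x ∈ B then (g j)⁻¹ * g i * v else v
  coordChange_self i x _ v := by simp
  continuousOn_coordChange i j := by
    rintro ⟨x, v⟩ ⟨hx, -⟩
    refine ContinuousAt.continuousWithinAt ?_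
    by_cases hij : i = j
    · subst hij
      simpa using continuousAt_snd
    by_cases hxB : x ∈ B
    · refine (continuousAt_const.mul continuousAt_snd :
        ContinuousAt (fun p : X × G => (g j)⁻¹ * g i * p.2) (x, v)).congr ?_
      filter_upwards [(h.isOpen_right.preimage continuous_fst).mem_nhds (x := (x, v)) hxB]
        with p hp
      exact (if_pos hp).symm
    · have hxA : x ∈ A := (h.inter_subset i j hij hx).resolve_right hxB
      refine (continuousAt_snd : ContinuousAt (fun p : X × G => p.2) (x, v)).congr ?_
      filter_upwards [(h.isOpen_left.preimage continuous_fst).mem_nhds (x := (x, v)) hxA]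
        with p hp
      exact (if_neg (h.disjoint.notMem_of_mem_left hp)).symm
  coordChange_comp i j k x _ v := by
    by_cases hx : x ∈ B <;> simp [hx, mul_assoc]

variable (h : IsTwoComponentCover U A B) (g : ι → G)

theorem isCoveringMap_proj : IsCoveringMap (h.bundleCore g).proj :=
  IsFiberBundle.isCoveringMap fun x =>
    ⟨(h.bundleCore g).localTriv ((h.bundleCore g).indexAt x), (h.bundleCore g).mem_baseSet_at x⟩

/-- The point of the fiber over `x` whose coordinate in the chart `i` is `v`. -/
def fiberPoint (i : ι) (x : X) (v : G) : (h.bundleCore g).proj ⁻¹' {x} :=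
  ⟨((h.bundleCore g).localTriv i).toOpenPartialHomeomorph.symm (x, v), rfl⟩

theorem fiberPoint_coordChange (i j : ι) (x : X) (hi : x ∈ U i) (hj : x ∈ U j) (v : G) :
    h.fiberPoint g j x ((h.bundleCore g).coordChange i j x v) = h.fiberPoint g i x v := by
  refine Subtype.ext ?_
  simp only [fiberPoint, FiberBundleCore.localTriv_symm_apply]
  rw [(h.bundleCore g).coordChange_comp i j _ x ⟨⟨hi, hj⟩, (h.bundleCore g).mem_baseSet_at x⟩]

theorem fiberPoint_eq_of_mem_left (i j : ι) (x : X) (hx : x ∈ A) (v : G) :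
    h.fiberPoint g i x v = h.fiberPoint g j x v := by
  rw [← h.fiberPoint_coordChange g i j x (h.left_subset i hx) (h.left_subset j hx)]
  exact congrArg _ (if_neg (h.disjoint.notMem_of_mem_left hx))

theorem fiberPoint_eq_of_mem_right (i j : ι) (x : X) (hx : x ∈ B) (v : G) :
    h.fiberPoint g i x v = h.fiberPoint g j x ((g j)⁻¹ * g i * v) := by
  rw [← h.fiberPoint_coordChange g i j x (h.right_subset i hx) (h.right_subset j hx)]
  exact congrArg _ (if_pos hx)

theorem fiberPoint_injective_of_mem_left (i : ι) (x : X) (hx : x ∈ A) :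
    Function.Injective (h.fiberPoint g i x) := by
  intro v w hvw
  have hmem (u : G) := ((h.bundleCore g).mem_localTriv_target i (x, u)).2 (h.left_subset i hx)
  have := ((h.bundleCore g).localTriv i).toOpenPartialHomeomorph.symm.injOn (hmem v) (hmem w)
    (congrArg Subtype.val hvw)
  exact congrArg Prod.snd this

theorem monodromy_fiberPoint (i : ι) {a b : X} (γ : Path a b) (hγ : ∀ t, γ t ∈ U i) (v : G) :
    (h.isCoveringMap_proj g).monodromy (.mk γ) (h.fiberPoint g i a v) = h.fiberPoint g i b v := by
  let e := ((h.bundleCore g).localTriv i).toOpenPartialHomeomorph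
  have hcont : Continuous fun t => e.symm (γ t, v) := by
    refine e.continuousOn_symm.comp_continuous (by fun_prop) fun t => ?_
    exact ((h.bundleCore g).mem_localTriv_target i (γ t, v)).2 (hγ t)
  refine (h.isCoveringMap_proj g).monodromy_eq_of_map_eq
    (.mk ⟨⟨_, hcont⟩, ?_, ?_⟩) ?_
  · simp [fiberPoint, e]
  · simp [fiberPoint, e]
  · rfl

end IsTwoComponentCover

/-- A space with an open cover by simply connected sets indexed by `Option κ`, such that the
intersection of any two distinct members is the disjoint union of two fixed path connected sets,
has a free fundamental group. -/
theorem IsTwoComponentCover.nonempty_fundamentalGroup_mulEquiv_freeGroup {κ : Type*}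
    {U : Option κ → Set X} {A B : Set X} (h : IsTwoComponentCover U A B)
    (hU : ∀ i, IsSimplyConnected (U i)) (hA : IsPathConnected A) (hB : IsPathConnected B)
    {x₀ : X} (hx₀ : x₀ ∈ A) : Nonempty (FundamentalGroup X x₀ ≃* FreeGroup κ) := by
  obtain ⟨y₀, hy₀⟩ := hB.nonempty
  choose c hc using fun i => (hU i).isPathConnected.joinedIn x₀ (h.left_subset i hx₀) y₀
    (h.right_subset i hy₀)
  let a (i : Option κ) : FundamentalGroup X x₀ :=
    FundamentalGroup.fromPath ((Path.Homotopic.Quotient.mk (c i)).trans (.symm (.mk (c none))))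
  let φ : FreeGroup κ →* FundamentalGroup X x₀ := FreeGroup.lift fun s => a (some s)
  have ha (i : Option κ) : a i ∈ φ.range := by
    cases i with
    | none =>
      have : a none = 1 := Path.Homotopic.Quotient.trans_symm _
      exact this ▸ one_mem _
    | some s => exact ⟨.of s, FreeGroup.lift_apply_of⟩
  have hsurj : φ.range = ⊤ := by
    refine FundamentalGroup.subgroup_eq_top_of_openCover h.isOpen h.covers
      (fun i => (hU i).isPathConnected) (fun i => h.left_subset i hx₀) _ fun i j y α β hα hβ => ?_
    have hyi : y ∈ U i := by simpa using hα 1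
    have hyj : y ∈ U j := by simpa using hβ 1
    have hone (δ : Path x₀ y) : FundamentalGroup.fromPath
        ((Path.Homotopic.Quotient.mk δ).trans (.symm (.mk δ))) ∈ φ.range := by
      rw [Path.Homotopic.Quotient.trans_symm]
      exact one_mem _
    by_cases hij : i = j
    · subst hij
      rw [(hU i).mk_eq_mk α β hα hβ]
      exact hone β
    rcases h.inter_subset i j hij ⟨hyi, hyj⟩ with hy | hy
    · obtain ⟨ε, hε⟩ := hA.joinedIn x₀ hx₀ y hy
      rw [(hU i).mk_eq_mk α ε hα fun t => h.left_subset i (hε t),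
        (hU j).mk_eq_mk β ε hβ fun t => h.left_subset j (hε t)]
      exact hone ε
    · obtain ⟨ε, hε⟩ := hB.joinedIn y hy y₀ hy₀
      have hmk (k : Option κ) (δ : Path x₀ y) (hδ : ∀ t, δ t ∈ U k) :
          Path.Homotopic.Quotient.mk δ =
            (Path.Homotopic.Quotient.mk (c k)).trans (.symm (.mk ε)) := by
        rw [← Path.Homotopic.Quotient.mk_symm, ← Path.Homotopic.Quotient.mk_trans]
        refine (hU k).mk_eq_mk _ _ hδ fun t => ?_
        have : ((c k).trans ε.symm) t ∈ range ((c k).trans ε.symm) := mem_range_self t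
        rw [Path.trans_range] at this
        rcases this with ⟨s, hs⟩ | ⟨s, hs⟩
        exacts [hs ▸ hc k s, hs ▸ h.right_subset k (hε _)]
      convert mul_mem (inv_mem (ha j)) (ha i) using 1
      rw [FundamentalGroup.mul_def, FundamentalGroup.inv_def, hmk i α hα, hmk j β hβ]
      exact (Path.Homotopic.Quotient.trans_symm_trans_symm_symm _ _ _).trans
        (Path.Homotopic.Quotient.trans_symm_trans_symm_symm _ _ _).symm
  let _ : TopologicalSpace (FreeGroup κ) := ⊥
  have : DiscreteTopology (FreeGroup κ) := ⟨rfl⟩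
  let g (i : Option κ) : FreeGroup κ := i.elim 1 .of
  have hmon_gen (s : κ) (v : FreeGroup κ) :
      (h.isCoveringMap_proj g).monodromyPerm x₀ (a (some s)) (h.fiberPoint g none x₀ v) =
        h.fiberPoint g none x₀ (.of s * v) := by
    rw [IsCoveringMap.coe_monodromyPerm]
    refine ((h.isCoveringMap_proj g).monodromy_trans_apply _ _ _).trans ?_
    rw [h.fiberPoint_eq_of_mem_left g none (some s) x₀ hx₀,
      h.monodromy_fiberPoint g (some s) (c (some s)) (hc _),
      h.fiberPoint_eq_of_mem_right g (some s) none y₀ hy₀, ← Path.Homotopic.Quotient.mk_symm,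
      h.monodromy_fiberPoint g none (c none).symm fun t => hc none _]
    simp [g]
  have hmon (w v : FreeGroup κ) :
      (h.isCoveringMap_proj g).monodromyPerm x₀ (φ w) (h.fiberPoint g none x₀ v) =
        h.fiberPoint g none x₀ (w * v) := by
    induction w using FreeGroup.induction_on generalizing v with
    | C1 => rw [map_one, map_one, Equiv.Perm.one_apply, one_mul]
    | of s => simpa [φ] using hmon_gen s v
    | inv_of s ih => 
      rw [map_inv, map_inv, Equiv.Perm.inv_eq_iff_eq, ih]
      simp
    | mul w₁ w₂ ih₁ ih₂ => rw [map_mul, map_mul, Equiv.Perm.mul_apply, ih₂, ih₁, mul_assoc]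
  have hinj : Function.Injective φ := (injective_iff_map_eq_one φ).2 fun w hw => by
    have := hmon w 1
    rw [hw, map_one, Equiv.Perm.one_apply, mul_one] at this
    exact (h.fiberPoint_injective_of_mem_left g none x₀ hx₀ this).symm
  exact ⟨(MulEquiv.ofBijective φ ⟨hinj, MonoidHom.range_eq_top.1 hsurj⟩).symm⟩

end TwoComponentCover

section PuncturedPlane

open Set

/-- The union of the open upper and lower half planes and a subset of the real line. -/
def slitUnion (s : Set ℝ) : Set ℂ := {z | z.im ≠ 0 ∨ z.re ∈ s}

theorem isOpen_slitUnion {s : Set ℝ} (hI : IsOpen s) : IsOpen (slitUnion s) :=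
  (isOpen_ne.preimage Complex.continuous_im).union (hI.preimage Complex.continuous_re)

theorem isSimplyConnected_slitUnion {s : Set ℝ} (hI : Convex ℝ s) (hne : s.Nonempty) :
    IsSimplyConnected (slitUnion s) := by
  obtain ⟨c, hc⟩ := hne
  have hcI : (c : ℂ) ∈ slitUnion s := Or.inr (by simpa using hc)
  have : StarConvex ℝ (c : ℂ) (slitUnion s) := by
    intro y hy a b ha hb hab
    rcases hb.eq_or_lt with rfl | hb'
    · obtain rfl : a = 1 := by simpa using hab
      simpa using hcI
    · rcases hy with hy | hy
      · left
        simpa using ⟨hb'.ne', hy⟩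
      · right
        simpa using hI hc hy ha hb hab
  have := this.contractibleSpace ⟨_, hcI⟩
  exact SimplyConnectedSpace.ofContractible _

theorem IsSimplyConnected.preimage_coe {X : Type*} [TopologicalSpace X] {s t : Set X}
    (ht : IsSimplyConnected t) (hts : t ⊆ s) :
    IsSimplyConnected ((↑) ⁻¹' t : Set s) := by
  rw [← Topology.IsEmbedding.subtypeVal.isSimplyConnected_image, Subtype.image_preimage_coe,
    inter_eq_right.2 hts]
  exact ht

/-- The complex plane with the points `0` and `1` removed. -/
def puncturedPlane : Set ℂ := {z | z ≠ 0 ∧ z ≠ 1}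

/-- The intervals of the real line cut out by `0` and `1`. -/
def puncturedPlaneInterval : Option (Fin 2) → Set ℝ
  | none => Ioo 0 1
  | some 0 => Iio 0
  | some 1 => Ioi 1

theorem slitUnion_puncturedPlaneInterval_subset (i : Option (Fin 2)) :
    slitUnion (puncturedPlaneInterval i) ⊆ puncturedPlane := by
  rintro z hz
  have key : ∀ i, (0 : ℝ) ∉ puncturedPlaneInterval i ∧ (1 : ℝ) ∉ puncturedPlaneInterval i := by
    intro i
    match i with
    | none => simp [puncturedPlaneInterval]
    | some 0 => simp [puncturedPlaneInterval]
    | some 1 => simp [puncturedPlaneInterval]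
  constructor
  · rintro rfl
    simp [slitUnion, key i] at hz
  · rintro rfl
    simp [slitUnion, key i] at hz

theorem isTwoComponentCover_puncturedPlane :
    IsTwoComponentCover (X := puncturedPlane)
      (fun i => (↑) ⁻¹' slitUnion (puncturedPlaneInterval i))
      ((↑) ⁻¹' {z : ℂ | 0 < z.im}) ((↑) ⁻¹' {z : ℂ | z.im < 0}) where
  isOpen i := by
    refine (isOpen_slitUnion ?_).preimage continuous_subtype_val
    match i with
    | none => exact isOpen_Ioo
    | some 0 => exact isOpen_Iio
    | some 1 => exact isOpen_Ioi
  covers := by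
    rintro ⟨z, h0, h1⟩
    simp only [slitUnion, mem_preimage, mem_ofPred_eq]
    by_cases hz : z.im = 0
    · have h0' : z.re ≠ 0 := fun h => h0 (Complex.ext h hz)
      have h1' : z.re ≠ 1 := fun h => h1 (Complex.ext h hz)
      rcases lt_or_gt_of_ne h0' with h | h
      · exact ⟨some 0, Or.inr h⟩
      rcases lt_or_gt_of_ne h1' with h' | h'
      · exact ⟨none, Or.inr ⟨h, h'⟩⟩
      · exact ⟨some 1, Or.inr h'⟩
    · exact ⟨none, Or.inl hz⟩
  isOpen_left := (isOpen_lt continuous_const Complex.continuous_im).preimage continuous_subtype_val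
  isOpen_right := (isOpen_lt Complex.continuous_im continuous_const).preimage continuous_subtype_val
  disjoint := disjoint_left.2 fun z (h : 0 < z.1.im) (h' : z.1.im < 0) => h.not_gt h'
  left_subset i z h := Or.inl (ne_of_gt h)
  right_subset i z h := Or.inl (ne_of_lt h)
  inter_subset i j hij z hz := by
    rcases lt_trichotomy z.1.im 0 with h | h | h
    · exact Or.inr h
    · exfalso
      have hi := hz.1.resolve_left (not_not_intro h)
      have hj := hz.2.resolve_left (not_not_intro h)
      match i, j, hij, hi, hj with
      | none, none, hij, _, _ => exact hij rfl
      | none, some 0, _, hi, hj => exact lt_asymm hi.1 hj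
      | none, some 1, _, hi, hj => exact lt_asymm hi.2 hj
      | some 0, none, _, hi, hj => exact lt_asymm hi hj.1
      | some 0, some 0, hij, _, _ => exact hij rfl
      | some 0, some 1, _, hi, hj => exact lt_asymm ((mem_Iio.1 hi).trans zero_lt_one) (mem_Ioi.1 hj)
      | some 1, none, _, hi, hj => exact lt_asymm hi hj.2
      | some 1, some 0, _, hi, hj => exact lt_asymm ((mem_Iio.1 hj).trans zero_lt_one) (mem_Ioi.1 hi)
      | some 1, some 1, hij, _, _ => exact hij rfl
    · exact Or.inl h

instance pathConnectedSpace_puncturedPlane : PathConnectedSpace puncturedPlane := by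
  rw [← isPathConnected_iff_pathConnectedSpace]
  have : puncturedPlane = ({0, 1} : Set ℂ)ᶜ := by
    ext z
    simp [puncturedPlane]
  rw [this]
  refine (Set.toFinite _).countable.isPathConnected_compl_of_one_lt_rank ?_
  simp [Complex.rank_real_complex]

/-- The fundamental group of the twice punctured plane is free on two generators. -/
theorem nonempty_fundamentalGroup_puncturedPlane_mulEquiv (z : puncturedPlane) :
    Nonempty (FundamentalGroup puncturedPlane z ≃* FreeGroup (Fin 2)) := by
  have hI : ∀ w : ℂ, w.im ≠ 0 → w ∈ puncturedPlane := fun w hw =>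
    slitUnion_puncturedPlaneInterval_subset none (Or.inl hw)
  have hconv : ∀ i, Convex ℝ (puncturedPlaneInterval i)
    | none => convex_Ioo _ _
    | some 0 => convex_Iio _
    | some 1 => convex_Ioi _
  have hne : ∀ i, (puncturedPlaneInterval i).Nonempty
    | none => nonempty_Ioo.2 zero_lt_one
    | some 0 => nonempty_Iio
    | some 1 => nonempty_Ioi
  obtain ⟨e⟩ := isTwoComponentCover_puncturedPlane.nonempty_fundamentalGroup_mulEquiv_freeGroup
    (x₀ := ⟨Complex.I, hI _ (by simp)⟩)
    (fun i => (isSimplyConnected_slitUnion (hconv i) (hne i)).preimage_coe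
      (slitUnion_puncturedPlaneInterval_subset i))
    (IsPathConnected.preimage_coe
      ((convex_halfSpace_im_gt 0).isPathConnected ⟨Complex.I, by simp⟩)
      fun w hw => hI w (ne_of_gt hw))
    (IsPathConnected.preimage_coe
      ((convex_halfSpace_im_lt 0).isPathConnected ⟨-Complex.I, by simp⟩)
      fun w hw => hI w (ne_of_lt hw)) (by simp)
  exact ⟨(FundamentalGroup.fundamentalGroupMulEquivOfPathConnected _ _).trans e⟩

end PuncturedPlane

section Complement

open Set

variable {E : Type*} [NormedAddCommGroup E] [NormedSpace ℝ E]

/-- The complement of the closed ray from the origin through `p`. -/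
def rayCompl (p : E) : Set E := ((fun t : ℝ => t • p) '' Ici 0)ᶜ

theorem isOpen_rayCompl {p : E} (hp : p ≠ 0) : IsOpen (rayCompl p) :=
  ((isClosedEmbedding_smul_left hp).isClosedMap _ isClosed_Ici).isOpen_compl

theorem neg_mem_rayCompl {p : E} (hp : p ≠ 0) : -p ∈ rayCompl p := by
  rintro ⟨t, ht, h⟩
  have h' : (t + 1) • p = 0 := by
    rw [add_smul, one_smul]
    exact eq_neg_iff_add_eq_zero.1 h
  rcases smul_eq_zero.1 h' with h' | h'
  · linarith [mem_Ici.1 ht]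
  · exact hp h'

theorem isSimplyConnected_rayCompl {p : E} (hp : p ≠ 0) : IsSimplyConnected (rayCompl p) := by
  have : StarConvex ℝ (-p) (rayCompl p) := by
    intro y hy a b ha hb hab
    rcases hb.eq_or_lt with rfl | hb'
    · obtain rfl : a = 1 := by simpa using hab
      simpa using neg_mem_rayCompl hp
    · rintro ⟨t, ht, h⟩
      refine hy ⟨b⁻¹ * (t + a), mul_nonneg (inv_nonneg.2 hb) (add_nonneg ht ha), ?_⟩
      have h' : (t + a) • p = b • y := by
        rw [add_smul]
        simp only at h
        rw [h]
        module
      simp only [mul_smul, h', inv_smul_smul₀ hb'.ne']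
  have := this.contractibleSpace ⟨_, neg_mem_rayCompl hp⟩
  exact SimplyConnectedSpace.ofContractible _

theorem rayCompl_inter_rayCompl_neg (p : E) :
    rayCompl p ∩ rayCompl (-p) = (Submodule.span ℝ {p} : Set E)ᶜ := by
  rw [rayCompl, rayCompl, ← compl_union]
  congr 1
  ext x
  simp only [mem_union, mem_image, mem_Ici, SetLike.mem_coe, Submodule.mem_span_singleton]
  constructor
  · rintro (⟨t, -, rfl⟩ | ⟨t, -, rfl⟩)
    · exact ⟨t, rfl⟩
    · exact ⟨-t, by simp⟩
  · rintro ⟨t, rfl⟩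
    rcases le_total 0 t with ht | ht
    · exact Or.inl ⟨t, ht, rfl⟩
    · exact Or.inr ⟨-t, neg_nonneg.2 ht, by simp⟩

/-- The complement of the origin in a real vector space of dimension at least three is simply
connected. -/
theorem simplyConnectedSpace_ne_zero [FiniteDimensional ℝ E] (hE : 2 < Module.finrank ℝ E) :
    SimplyConnectedSpace {b : E // b ≠ 0} := by
  have := Module.nontrivial_of_finrank_pos (R := ℝ) (M := E) (by omega)
  obtain ⟨p, hp⟩ := exists_ne (0 : E)
  have hline : IsPathConnected ((Submodule.span ℝ {p} : Set E)ᶜ) := by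
    refine isPathConnected_compl_of_one_lt_codim ?_
    have h1 := (Submodule.span ℝ {p}).finrank_quotient_add_finrank
    rw [finrank_span_singleton hp] at h1
    rw [← Module.finrank_eq_rank]
    exact_mod_cast (by omega : 1 < Module.finrank ℝ (E ⧸ Submodule.span ℝ {p}))
  obtain ⟨x₀, hx₀⟩ := hline.nonempty
  have hinter := rayCompl_inter_rayCompl_neg p
  have hx₀' := hx₀
  rw [← hinter] at hx₀'
  have hzero : ∀ q : E, rayCompl q ⊆ {b : E | b ≠ 0} := by
    rintro q _ h rfl
    exact h ⟨0, mem_Ici.2 le_rfl, zero_smul ℝ q⟩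
  have hsc : ∀ q : E, q ≠ 0 → IsSimplyConnected ((↑) ⁻¹' rayCompl q : Set {b : E // b ≠ 0}) :=
    fun q hq => (isSimplyConnected_rayCompl hq).preimage_coe (hzero q)
  have hpc : IsPathConnected ((↑) ⁻¹' (rayCompl p ∩ rayCompl (-p)) : Set {b : E // b ≠ 0}) :=
    IsPathConnected.preimage_coe (hinter ▸ hline) (inter_subset_left.trans (hzero p))
  refine SimplyConnectedSpace.of_openCover (x₀ := ⟨x₀, hzero p hx₀'.1⟩)
    (U := fun i : Bool => (↑) ⁻¹' rayCompl (cond i p (-p))) ?_ ?_ ?_ ?_ ?_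
  · rintro (_ | _)
    exacts [(isOpen_rayCompl (neg_ne_zero.2 hp)).preimage continuous_subtype_val,
      (isOpen_rayCompl hp).preimage continuous_subtype_val]
  · rintro ⟨x, hx⟩
    by_cases h : x ∈ rayCompl p
    · exact ⟨true, h⟩
    · refine ⟨false, ?_⟩
      obtain ⟨t, ht, rfl⟩ := not_not.1 h
      rintro ⟨s, hs, h'⟩
      have h'' : (t + s) • p = 0 := by
        simp only [cond_false, smul_neg] at h'
        rw [add_smul, ← h', neg_add_cancel]
      have hts : t + s = 0 := (smul_eq_zero.1 h'').resolve_right hp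
      have : t = 0 := by linarith [mem_Ici.1 ht, mem_Ici.1 hs]
      exact hx (by simp [this])
  · rintro (_ | _)
    exacts [hsc _ (neg_ne_zero.2 hp), hsc _ hp]
  · rintro (_ | _) (_ | _)
    · simpa using (hsc _ (neg_ne_zero.2 hp)).isPathConnected
    · rw [inter_comm]
      exact hpc
    · exact hpc
    · simpa using (hsc _ hp).isPathConnected
  · rintro (_ | _)
    exacts [hx₀'.2, hx₀'.1]

end Complement

section Product

variable {X Y Z : Type*} [TopologicalSpace X] [TopologicalSpace Y] [TopologicalSpace Z]

theorem Path.Homotopic.prodMk {a₁ a₂ : X} {b₁ b₂ : Y} {p p' : Path a₁ a₂} {q q' : Path b₁ b₂}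
    (hp : p.Homotopic p') (hq : q.Homotopic q') : (p.prod q).Homotopic (p'.prod q') :=
  Nonempty.map2 Path.Homotopic.prodHomotopy hp hq

theorem SimplyConnectedSpace.prod [SimplyConnectedSpace X] [SimplyConnectedSpace Y] :
    SimplyConnectedSpace (X × Y) := by
  refine simply_connected_iff_loops_nullhomotopic.2 ⟨inferInstance, fun x γ => ?_⟩
  exact Path.Homotopic.prodMk
    (SimplyConnectedSpace.paths_homotopic (γ.map continuous_fst) (.refl _))
    (SimplyConnectedSpace.paths_homotopic (γ.map continuous_snd) (.refl _))

/-- If `X` is a retract over `Y` of a product `Z × Y` with `Z` simply connected, then the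
fundamental groups of `X` and `Y` are isomorphic. -/
theorem FundamentalGroup.nonempty_mulEquiv_of_prod_retract [SimplyConnectedSpace Z]
    (f : C(X, Y)) (g : C(X, Z)) (r : C(Z × Y, X)) (hr : ∀ x, r (g x, f x) = x)
    (hf : ∀ z y, f (r (z, y)) = y) (x : X) :
    Nonempty (FundamentalGroup X x ≃* FundamentalGroup Y (f x)) := by
  refine ⟨MulEquiv.ofBijective (FundamentalGroup.map f x) ⟨?_, ?_⟩⟩
  · intro a b
    induction a using Path.Homotopic.Quotient.ind with | mk p => ?_
    induction b using Path.Homotopic.Quotient.ind with | mk q => ?_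
    intro h
    have h' : (p.map f.continuous).Homotopic (q.map f.continuous) :=
      Path.Homotopic.Quotient.exact h
    have key := ((Path.Homotopic.prodMk (SimplyConnectedSpace.paths_homotopic
      (p.map g.continuous) (q.map g.continuous)) h').map r).pathCast (hr x).symm (hr x).symm
    refine Path.Homotopic.Quotient.eq.2 ?_
    convert key using 1
    · ext t
      simp [hr]
    · ext t
      simp [hr]
  · intro b
    induction b using Path.Homotopic.Quotient.ind with | mk q => ?_
    refine ⟨.mk ((((Path.refl (g x)).prod q).map r.continuous).cast (hr x).symm (hr x).symm), ?_⟩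
    refine congrArg Path.Homotopic.Quotient.mk ?_
    ext t
    simp [hf]

end Product

section Projectivization

variable {V : Type*} [AddCommGroup V] [Module ℂ V]

section ToProj

variable [Nontrivial V]

open Classical in
/-- The point of the projective space represented by `v`, with a junk value for `v = 0`. -/
def toProj (v : V) : Projectivization ℂ V :=
  if h : v ≠ 0 then Projectivization.mk ℂ v h else Classical.arbitrary _

theorem toProj_of_ne_zero {v : V} (h : v ≠ 0) : toProj v = Projectivization.mk ℂ v h :=
  dif_pos h

theorem toProj_rep (x : Projectivization ℂ V) : toProj x.rep = x := by
  rw [toProj_of_ne_zero x.rep_nonzero, x.mk_rep]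

theorem toProj_smul {a : ℂ} (ha : a ≠ 0) (v : V) : toProj (a • v) = toProj v := by
  by_cases hv : v = 0
  · rw [hv, smul_zero]
  · rw [toProj_of_ne_zero hv, toProj_of_ne_zero (smul_ne_zero ha hv),
      Projectivization.mk_eq_mk_iff']
    exact ⟨a, rfl⟩

theorem exists_rep_toProj_eq_smul {v : V} (h : v ≠ 0) :
    ∃ a : ℂ, a ≠ 0 ∧ (toProj v).rep = a • v := by
  obtain ⟨a, ha⟩ := Projectivization.exists_smul_eq_mk_rep ℂ v h
  exact ⟨a, a.ne_zero, by rw [toProj_of_ne_zero h, ← ha, Units.smul_def]⟩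

theorem toProj_ne_toProj_iff {v w : V} (hv : v ≠ 0) (hw : w ≠ 0) :
    toProj v ≠ toProj w ↔ LinearIndependent ℂ ![v, w] := by
  rw [LinearIndependent.pair_symm_iff, LinearIndependent.pair_iff' hw, toProj_of_ne_zero hv,
    toProj_of_ne_zero hw, ne_eq, Projectivization.mk_eq_mk_iff', not_exists]

end ToProj

variable {Y Z : Type*} [TopologicalSpace Y] [TopologicalSpace Z] [TopologicalSpace V]
  [ContinuousConstSMul ℂ V]

theorem isOpenQuotientMap_projectivization_mk :
    IsOpenQuotientMap fun v : {v : V // v ≠ 0} => Projectivization.mk ℂ v.1 v.2 := by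
  refine ⟨Projectivization.ind fun v hv => ⟨⟨v, hv⟩, rfl⟩, continuous_quotient_mk', ?_⟩
  intro U hU
  refine isOpen_coinduced.2 ?_
  have : (fun v : {v : V // v ≠ 0} => Projectivization.mk ℂ v.1 v.2) ⁻¹'
      ((fun v : {v : V // v ≠ 0} => Projectivization.mk ℂ v.1 v.2) '' U) =
      ⋃ a : ℂˣ, (fun v : {v : V // v ≠ 0} =>
        (⟨a • v.1, (smul_ne_zero_iff_ne a).2 v.2⟩ : {v : V // v ≠ 0})) ⁻¹' U := by
    ext v
    simp only [Set.mem_preimage, Set.mem_image, Set.mem_iUnion]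
    constructor
    · rintro ⟨w, hw, h⟩
      obtain ⟨a, ha⟩ := (Projectivization.mk_eq_mk_iff ℂ _ _ _ _).1 h
      refine ⟨a, ?_⟩
      convert hw
    · rintro ⟨a, ha⟩
      exact ⟨_, ha, (Projectivization.mk_eq_mk_iff ℂ _ _ _ _).2 ⟨a, rfl⟩⟩
  exact this ▸ isOpen_iUnion fun a =>
    hU.preimage ((continuous_subtype_val.const_smul a).subtype_mk _)

theorem continuousAt_toProj [Nontrivial V] [T1Space V] {v : V} (hv : v ≠ 0) :
    ContinuousAt toProj v := by
  have hopen : IsOpen {v : V | v ≠ 0} := isOpen_ne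
  refine (continuousOn_iff_continuous_domRestrict.2 ?_ :
    ContinuousOn toProj {v : V | v ≠ 0}).continuousAt (hopen.mem_nhds hv)
  exact (isOpenQuotientMap_projectivization_mk (V := V)).continuous.congr fun v =>
    (toProj_of_ne_zero v.2).symm

theorem continuousAt_comp_rep {F : V × Z → Y} (hF : ∀ (a : ℂ) v z, a ≠ 0 → F (a • v, z) = F (v, z))
    {x : Projectivization ℂ V} {z : Z} (h : ContinuousAt F (x.rep, z)) :
    ContinuousAt (fun p : Projectivization ℂ V × Z => F (p.1.rep, p.2)) (x, z) := by
  have hq := (isOpenQuotientMap_projectivization_mk (V := V)).prodMap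
    (IsOpenQuotientMap.id (X := Z))
  have hx : (x, z) = Prod.map (fun v : {v : V // v ≠ 0} => Projectivization.mk ℂ v.1 v.2) id
      (⟨x.rep, x.rep_nonzero⟩, z) := by
    simp
  rw [hx, ← hq.continuousAt_comp_iff]
  have : ContinuousAt (F ∘ fun p : {v : V // v ≠ 0} × Z => (p.1.1, p.2))
      (⟨x.rep, x.rep_nonzero⟩, z) :=
    ContinuousAt.comp h (by fun_prop)
  convert this using 1
  ext ⟨v, y⟩
  obtain ⟨a, ha⟩ := Projectivization.exists_smul_eq_mk_rep ℂ v.1 v.2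
  simp [← ha, Units.smul_def, hF a.1 v.1 y a.ne_zero]

theorem continuousAt_comp_rep_left {F : V → Y} (hF : ∀ (a : ℂ) v, a ≠ 0 → F (a • v) = F v)
    {x : Projectivization ℂ V} (h : ContinuousAt F x.rep) :
    ContinuousAt (fun y : Projectivization ℂ V => F y.rep) x :=
  ContinuousAt.comp (f := fun y => (y, ()))
    (continuousAt_comp_rep (F := fun p : V × Unit => F p.1) (fun a v _ => hF a v)
      (ContinuousAt.comp (f := Prod.fst) (x := (x.rep, ())) h continuousAt_fst)) (by fun_prop)

theorem continuousAt_comp_rep_pi {ι : Type*} [Finite ι] {F : (ι → V) → Y}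
    (hF : ∀ (a : ι → ℂ) v, (∀ i, a i ≠ 0) → F (fun i => a i • v i) = F v)
    {x : ι → Projectivization ℂ V} (h : ContinuousAt F fun i => (x i).rep) :
    ContinuousAt (fun x : ι → Projectivization ℂ V => F fun i => (x i).rep) x := by
  have hq := IsOpenQuotientMap.piMap fun _ : ι => isOpenQuotientMap_projectivization_mk (V := V)
  have hx : x = Pi.map (fun _ (v : {v : V // v ≠ 0}) => Projectivization.mk ℂ v.1 v.2)
      (fun i => ⟨(x i).rep, (x i).rep_nonzero⟩) := by
    ext i
    simp
  rw [hx, ← hq.continuousAt_comp_iff]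
  have : ContinuousAt (F ∘ fun (p : ι → {v : V // v ≠ 0}) i => (p i).1)
      (fun i => ⟨(x i).rep, (x i).rep_nonzero⟩) :=
    ContinuousAt.comp h (continuous_pi fun i =>
      continuous_subtype_val.comp (continuous_apply i)).continuousAt
  convert this using 1
  ext v
  choose a ha using fun i => Projectivization.exists_smul_eq_mk_rep ℂ (v i).1 (v i).2
  simp [← ha, Units.smul_def, hF (fun i => a i) (fun i => v i) fun i => (a i).ne_zero]

end Projectivization

section PairSpace

theorem LinearIndependent.pair_smul_smul {V : Type*} [AddCommGroup V] [Module ℂ V] {v w : V}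
    (h : LinearIndependent ℂ ![v, w]) {a b : ℂ} (ha : a ≠ 0) (hb : b ≠ 0) :
    LinearIndependent ℂ ![a • v, b • w] := by
  rw [LinearIndependent.pair_iff] at h ⊢
  intro s t hst
  rw [smul_smul, smul_smul] at hst
  obtain ⟨h₁, h₂⟩ := h _ _ hst
  exact ⟨(mul_eq_zero.1 h₁).resolve_right ha, (mul_eq_zero.1 h₂).resolve_right hb⟩

theorem linearIndependent_pair_smul_add {ι : Type*} {v b : ι → ℂ} {k : ι} (hv : v k ≠ 0)
    (hbk : b k = 0) (hb : b ≠ 0) (t : ℂ) : LinearIndependent ℂ ![v, t • v + b] := by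
  rw [LinearIndependent.pair_iff]
  intro x y h
  have hk := congrFun h k
  simp only [Pi.add_apply, Pi.smul_apply, smul_eq_mul, hbk, add_zero, Pi.zero_apply] at hk
  have hxy : x + y * t = 0 := by
    refine (mul_eq_zero.1 (?_ : (x + y * t) * v k = 0)).resolve_right hv
    rw [← hk]
    ring
  have hyb : y • b = 0 := by
    calc y • b = (x • v + y • (t • v + b)) - (x + y * t) • v := by module
      _ = 0 := by rw [h, hxy, zero_smul, sub_zero]
  have hy : y = 0 := (smul_eq_zero.1 hyb).resolve_right hb
  exact ⟨by simpa [hy] using hxy, hy⟩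

/-- The space of linearly independent pairs of vectors in `ℂ³` up to a common scalar. -/
def pairSpace : Set (Projectivization ℂ ((Fin 3 → ℂ) × (Fin 3 → ℂ))) :=
  {z | LinearIndependent ℂ ![z.rep.1, z.rep.2]}

theorem toProj_mem_pairSpace {v w : Fin 3 → ℂ} (h : LinearIndependent ℂ ![v, w]) :
    toProj (v, w) ∈ pairSpace := by
  have hne : (v, w) ≠ 0 := fun h0 => h.ne_zero 0 (congrArg Prod.fst h0)
  obtain ⟨a, ha, hrep⟩ := exists_rep_toProj_eq_smul hne
  simp only [pairSpace, Set.mem_ofPred_eq, hrep]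
  exact h.pair_smul_smul ha ha

/-- The vectors of `ℂ³` whose `k`-th coordinate vanishes. -/
abbrev coordHyperplane (k : Fin 3) : Submodule ℂ (Fin 3 → ℂ) :=
  LinearMap.ker (LinearMap.proj k : (Fin 3 → ℂ) →ₗ[ℂ] ℂ)

instance simplyConnectedSpace_coordHyperplane (k : Fin 3) :
    SimplyConnectedSpace {b : coordHyperplane k // b ≠ 0} := by
  refine simplyConnectedSpace_ne_zero ?_
  have h := LinearMap.finrank_range_add_finrank_ker (LinearMap.proj k : (Fin 3 → ℂ) →ₗ[ℂ] ℂ)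
  rw [LinearMap.range_eq_top.2 (LinearMap.proj_surjective k), finrank_top, finrank_self,
    finrank_fin_fun] at h
  rw [finrank_real_of_complex]
  change 1 + finrank ℂ (coordHyperplane k) = 3 at h
  omega

/-- The point of `pairSpace` represented by `(v, t • v + b)`. -/
def pairPoint {k : Fin 3} (v : Fin 3 → ℂ) (hv : v k ≠ 0) (t : ℂ)
    (b : {b : coordHyperplane k // b ≠ 0}) : pairSpace :=
  ⟨toProj (v, t • v + (b : Fin 3 → ℂ)), toProj_mem_pairSpace
    (linearIndependent_pair_smul_add hv b.1.2 (by simpa using b.2) t)⟩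

/-- The subset of `pairSpace` where the `k`-th coordinate of the first vector does not vanish. -/
def pairChart (k : Fin 3) : Set pairSpace := {z | z.1.rep.1 k ≠ 0}

theorem pairPoint_mem_pairChart {j k : Fin 3} {v : Fin 3 → ℂ} (hv : v k ≠ 0) (hj : v j ≠ 0) (t : ℂ)
    (b : {b : coordHyperplane k // b ≠ 0}) : pairPoint v hv t b ∈ pairChart j := by
  have hne : (v, t • v + (b : Fin 3 → ℂ)) ≠ 0 := fun h0 =>
    hv (congrFun (congrArg Prod.fst h0) k)
  obtain ⟨a, ha, hrep⟩ := exists_rep_toProj_eq_smul hne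
  simp [pairChart, pairPoint, hrep, ha, hj]

theorem continuous_pairPoint {Y : Type*} [TopologicalSpace Y] {k : Fin 3} {v : Y → Fin 3 → ℂ}
    (hv : ∀ y, v y k ≠ 0) {t : Y → ℂ} {b : Y → {b : coordHyperplane k // b ≠ 0}}
    (hvc : Continuous v) (ht : Continuous t) (hb : Continuous b) :
    Continuous fun y => pairPoint (v y) (hv y) (t y) (b y) := by
  refine Continuous.subtype_mk (continuous_iff_continuousAt.2 fun y => ?_) _
  have hne : (v y, t y • v y + (b y : Fin 3 → ℂ)) ≠ 0 := fun h0 =>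
    hv y (congrFun (congrArg Prod.fst h0) k)
  exact (continuousAt_toProj hne).comp (f := fun y => (v y, t y • v y + (b y : Fin 3 → ℂ)))
    (by fun_prop)

/-- The coefficients of the second vector with respect to the first one and the hyperplane where
the `k`-th coordinate vanishes, when both vectors are multiplied by `c`. -/
def pairCoeff (k : Fin 3) (c : ℂ) (w : (Fin 3 → ℂ) × (Fin 3 → ℂ))
    (hw : LinearIndependent ℂ ![w.1, w.2]) (hc : c ≠ 0) (hk : w.1 k ≠ 0) :
    {b : coordHyperplane k // b ≠ 0} :=
  ⟨⟨c • (w.2 - (w.2 k / w.1 k) • w.1), by simp [hk]⟩, fun h => by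
    have h' : w.2 - (w.2 k / w.1 k) • w.1 = 0 :=
      (smul_eq_zero.1 (congrArg Subtype.val h)).resolve_left hc
    rw [LinearIndependent.pair_iff] at hw
    exact one_ne_zero (hw (-(w.2 k / w.1 k)) 1 (by rw [← h']; module)).2⟩

theorem pairPoint_pairCoeff {k : Fin 3} {c : ℂ} (hc : c ≠ 0) {z : pairSpace}
    (hz : z ∈ pairChart k) :
    pairPoint (k := k) (c • z.1.rep.1) (smul_ne_zero hc hz) (z.1.rep.2 k / z.1.rep.1 k)
      (pairCoeff k c z.1.rep z.2 hc hz) = z := by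
  refine Subtype.ext ?_
  conv_rhs => rw [← toProj_rep z.1, ← toProj_smul hc]
  refine congrArg toProj (Prod.ext rfl ?_)
  simp only [pairCoeff, Prod.smul_snd]
  module

theorem isOpen_pairChart (k : Fin 3) : IsOpen (pairChart k) := by
  refine isOpen_iff_continuous_mem.2 (continuous_iff_continuousAt.2 fun z => ?_)
  refine ContinuousAt.comp (f := Subtype.val) (continuousAt_comp_rep_left
    (F := fun w : (Fin 3 → ℂ) × (Fin 3 → ℂ) => w.1 k ≠ 0) ?_ ?_) continuousAt_subtype_val
  · intro a v ha
    simp [ha]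
  · have : IsOpen {w : (Fin 3 → ℂ) × (Fin 3 → ℂ) | w.1 k ≠ 0} :=
      isOpen_ne_fun (by fun_prop) (by fun_prop)
    exact (isOpen_iff_continuous_mem.1 this).continuousAt

theorem continuous_comp_rep_pairChart {Y : Type*} [TopologicalSpace Y] {k : Fin 3}
    {F : (Fin 3 → ℂ) × (Fin 3 → ℂ) → Y} (hF : ∀ (a : ℂ) w, a ≠ 0 → F (a • w) = F w)
    (h : ∀ w : (Fin 3 → ℂ) × (Fin 3 → ℂ), w.1 k ≠ 0 → ContinuousAt F w) :
    Continuous fun z : pairChart k => F z.1.1.rep :=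
  continuous_iff_continuousAt.2 fun z =>
    ContinuousAt.comp (f := fun z : pairChart k => z.1.1)
      (continuousAt_comp_rep_left hF (h _ z.2))
      (continuous_subtype_val.comp continuous_subtype_val).continuousAt

theorem isSimplyConnected_pairChart (k : Fin 3) : IsSimplyConnected (pairChart k) := by
  have := SimplyConnectedSpace.prod (X := ℂ) (Y := {b : coordHyperplane k // b ≠ 0})
  have := SimplyConnectedSpace.prod (X := Fin 3 → ℂ)
    (Y := ℂ × {b : coordHyperplane k // b ≠ 0})
  have hupd (a : Fin 3 → ℂ) : Function.update a k 1 k ≠ 0 := by simp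
  let f : C((Fin 3 → ℂ) × ℂ × {b : coordHyperplane k // b ≠ 0}, pairChart k) :=
    ⟨fun y => ⟨pairPoint (Function.update y.1 k 1) (hupd y.1) y.2.1 y.2.2,
        pairPoint_mem_pairChart (hupd y.1) (hupd y.1) _ _⟩,
      (continuous_pairPoint (v := fun y : (Fin 3 → ℂ) × ℂ × {b : coordHyperplane k // b ≠ 0} =>
        Function.update y.1 k 1) (fun y => hupd y.1) (continuous_fst.update k continuous_const)
        (by fun_prop) (by fun_prop)).subtype_mk _⟩
  let g : C(pairChart k, (Fin 3 → ℂ) × ℂ × {b : coordHyperplane k // b ≠ 0}) :=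
    ⟨fun z => ((z.1.1.rep.1 k)⁻¹ • z.1.1.rep.1, z.1.1.rep.2 k / z.1.1.rep.1 k,
      pairCoeff k (z.1.1.rep.1 k)⁻¹ z.1.1.rep z.1.2 (inv_ne_zero z.2) z.2), by
      refine .prodMk ?_ (.prodMk ?_ ((Continuous.subtype_mk ?_ _).subtype_mk _))
      · refine continuous_comp_rep_pairChart (F := fun w => (w.1 k)⁻¹ • w.1) ?_ ?_
        · intro a w ha
          ext i
          simp
          field_simp
        · intro w hw
          fun_prop (disch := exact hw)
      · refine continuous_comp_rep_pairChart (F := fun w => w.2 k / w.1 k) ?_ ?_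
        · intro a w ha
          simp
          field_simp
        · intro w hw
          fun_prop (disch := exact hw)
      · refine continuous_comp_rep_pairChart
          (F := fun w => (w.1 k)⁻¹ • (w.2 - (w.2 k / w.1 k) • w.1)) ?_ ?_
        · intro a w ha
          ext i
          simp
          field_simp
        · intro w hw
          fun_prop (disch := exact hw)⟩
  refine SimplyConnectedSpace.of_retract f g fun z => Subtype.ext ?_
  refine Eq.trans ?_ (pairPoint_pairCoeff (inv_ne_zero z.2) z.2)
  have : Function.update ((z.1.1.rep.1 k)⁻¹ • z.1.1.rep.1) k 1 =
      (z.1.1.rep.1 k)⁻¹ • z.1.1.rep.1 := by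
    rw [Function.update_eq_self_iff]
    exact (inv_mul_cancel₀ z.2).symm
  simp only [f, g, ContinuousMap.coe_mk, this]

theorem isPathConnected_pairChart_inter (j k : Fin 3) :
    IsPathConnected (pairChart j ∩ pairChart k) := by
  let e (u : Fin 3 → ℂ) (i : Fin 3) : ℂ := if i = j ∨ i = k then Complex.exp (u i) else u i
  have hej (u) : e u j ≠ 0 := by simp [e]
  have hek (u) : e u k ≠ 0 := by simp [e]
  have hec : Continuous e := by
    refine continuous_pi fun i => ?_
    by_cases h : i = j ∨ i = k
    · simp only [e, if_pos h]
      fun_prop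
    · simp only [e, if_neg h]
      fun_prop
  have hrange : pairChart j ∩ pairChart k =
      Set.range fun y : (Fin 3 → ℂ) × ℂ × {b : coordHyperplane k // b ≠ 0} =>
        pairPoint (e y.1) (hek y.1) y.2.1 y.2.2 := by
    refine Set.Subset.antisymm (fun z hz => ?_) (Set.range_subset_iff.2 fun y =>
      ⟨pairPoint_mem_pairChart _ (hej _) _ _, pairPoint_mem_pairChart _ (hek _) _ _⟩)
    refine ⟨(fun i => if i = j ∨ i = k then Complex.log (z.1.rep.1 i) else z.1.rep.1 i,
      z.1.rep.2 k / z.1.rep.1 k, pairCoeff k 1 z.1.rep z.2 one_ne_zero hz.2), ?_⟩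
    refine Eq.trans ?_ (pairPoint_pairCoeff one_ne_zero hz.2)
    beta_reduce
    congr 1
    refine funext fun i => ?_
    by_cases h : i = j ∨ i = k
    · have : z.1.rep.1 i ≠ 0 := by
        rcases h with rfl | rfl
        exacts [hz.1, hz.2]
      simp [e, h, Complex.exp_log this]
    · simp [e, h]
  rw [hrange]
  exact isPathConnected_range (continuous_pairPoint _ (by fun_prop) (by fun_prop) (by fun_prop))

instance simplyConnectedSpace_pairSpace : SimplyConnectedSpace pairSpace := by
  have hli : LinearIndependent ℂ ![(1 : Fin 3 → ℂ), Pi.single 0 1] := by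
    rw [LinearIndependent.pair_iff]
    intro s t h
    have h0 := congrFun h 0
    have h1 := congrFun h 1
    simp at h0 h1
    simpa [h1] using h0
  refine SimplyConnectedSpace.of_openCover (x₀ := ⟨_, toProj_mem_pairSpace hli⟩)
    isOpen_pairChart ?_ isSimplyConnected_pairChart isPathConnected_pairChart_inter ?_
  · intro z
    by_contra! h
    exact z.2.ne_zero 0 (funext fun k => not_not.1 (h k))
  · intro k
    have hne : ((1 : Fin 3 → ℂ), (Pi.single 0 1 : Fin 3 → ℂ)) ≠ 0 := fun h0 =>
      hli.ne_zero 0 (congrArg Prod.fst h0)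
    obtain ⟨a, ha, hrep⟩ := exists_rep_toProj_eq_smul hne
    simp [pairChart, hrep, ha]

end PairSpace

section Collinear

open scoped ComplexConjugate ComplexOrder Matrix

/-- For linearly independent `u` and `v`, this is a nonzero multiple of the coefficient of `u` in
the orthogonal projection of `w` to the span of `u` and `v`. -/
def gramCoeff (u v w : Fin 3 → ℂ) : ℂ :=
  (star v ⬝ᵥ v) * (star u ⬝ᵥ w) - (star u ⬝ᵥ v) * (star v ⬝ᵥ w)

theorem gramCoeff_smul_add_smul (u v : Fin 3 → ℂ) (a b : ℂ) :
    gramCoeff u v (a • u + b • v) = a * gramCoeff u v u := by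
  simp only [gramCoeff, dotProduct_add, dotProduct_smul, smul_eq_mul]
  ring

theorem gramCoeff_smul_add_smul_right (u v : Fin 3 → ℂ) (a b : ℂ) :
    gramCoeff v u (a • u + b • v) = b * gramCoeff u v u := by
  simp only [gramCoeff, dotProduct_add, dotProduct_smul, smul_eq_mul]
  ring

theorem gramCoeff_smul_smul_smul (a b c : ℂ) (u v w : Fin 3 → ℂ) :
    gramCoeff (a • u) (b • v) (c • w) = conj a * conj b * b * c * gramCoeff u v w := by
  simp only [gramCoeff, star_smul, dotProduct_smul, smul_dotProduct, smul_eq_mul,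
    starRingEnd_apply]
  ring

theorem gramCoeff_self_ne_zero {u v : Fin 3 → ℂ} (h : LinearIndependent ℂ ![u, v]) :
    gramCoeff u v u ≠ 0 := by
  intro h0
  set n : Fin 3 → ℂ := (star v ⬝ᵥ v) • u + (-(star v ⬝ᵥ u)) • v with hn
  have hu : star u ⬝ᵥ n = 0 := by
    rw [← h0, hn, gramCoeff]
    simp only [dotProduct_add, dotProduct_smul, smul_eq_mul]
    ring
  have hv : star v ⬝ᵥ n = 0 := by
    rw [hn]
    simp only [dotProduct_add, dotProduct_smul, smul_eq_mul]
    ring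
  have hnn : star n ⬝ᵥ n = 0 := by
    conv_lhs => rw [hn, star_add, star_smul, star_smul, ← hn]
    rw [add_dotProduct, smul_dotProduct, smul_dotProduct, hu, hv, smul_zero, smul_zero, add_zero]
  have hv0 := (LinearIndependent.pair_iff.1 h _ _ (dotProduct_star_self_eq_zero.1 hnn)).1
  exact h.ne_zero 1 (dotProduct_star_self_eq_zero.1 hv0)

theorem continuous_gramCoeff {Y : Type*} [TopologicalSpace Y] {u v w : Y → Fin 3 → ℂ}
    (hu : Continuous u) (hv : Continuous v) (hw : Continuous w) :
    Continuous fun y => gramCoeff (u y) (v y) (w y) := by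
  unfold gramCoeff
  fun_prop

/-- Four vectors, pairwise independent, in the plane spanned by the first two. -/
structure IsPlanarQuadruple (w : Fin 4 → Fin 3 → ℂ) (a b c d : ℂ) : Prop where
  linearIndependent : LinearIndependent ℂ ![w 0, w 1]
  left_ne_zero : a ≠ 0
  right_ne_zero : b ≠ 0
  left_ne_zero' : c ≠ 0
  right_ne_zero' : d ≠ 0
  det_ne_zero : a * d - b * c ≠ 0
  third_eq : w 2 = a • w 0 + b • w 1
  fourth_eq : w 3 = c • w 0 + d • w 1

theorem exists_isPlanarQuadruple_of_mem_Fconf {x : Fin 4 → CP 2} (hx : x ∈ Fconf 4 1 2) :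
    ∃ a b c d, IsPlanarQuadruple (fun i => (x i).rep) a b c d := by
  obtain ⟨hinj, hrank⟩ := hx
  have hli (i j : Fin 4) (hij : i ≠ j) : LinearIndependent ℂ ![(x i).rep, (x j).rep] :=
    (Projectivization.linearIndependent_pair_iff_ne).2 (hinj.ne hij)
  have h01 := hli 0 1 (by decide)
  have hspan : span ℂ (Set.range ![(x 0).rep, (x 1).rep]) =
      span ℂ (Set.range fun j => (x j).rep) := by
    refine eq_of_le_of_finrank_eq (span_mono ?_) ?_
    · rintro _ ⟨i, rfl⟩
      fin_cases i
      exacts [⟨0, rfl⟩, ⟨1, rfl⟩]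
    · rw [hrank, finrank_span_eq_card h01, Fintype.card_fin]
  have hmem (i : Fin 4) : ∃ a b : ℂ, a • (x 0).rep + b • (x 1).rep = (x i).rep := by
    rw [← mem_span_pair, ← Matrix.range_cons_cons_empty (x 0).rep (x 1).rep ![], hspan]
    exact subset_span ⟨i, rfl⟩
  obtain ⟨a, b, h2⟩ := hmem 2
  obtain ⟨c, d, h3⟩ := hmem 3
  have hcoeff (i j : Fin 4) (hij : i ≠ j) (s t : ℂ)
      (h : s • (x i).rep + t • (x j).rep = 0) : s = 0 ∧ t = 0 :=
    LinearIndependent.pair_iff.1 (hli i j hij) s t h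
  have ha : a ≠ 0 := by
    rintro rfl
    exact neg_ne_zero.2 one_ne_zero (hcoeff 1 2 (by decide) b (-1) (by rw [← h2]; module)).2
  have hb : b ≠ 0 := by
    rintro rfl
    exact neg_ne_zero.2 one_ne_zero (hcoeff 0 2 (by decide) a (-1) (by rw [← h2]; module)).2
  have hc : c ≠ 0 := by
    rintro rfl
    exact neg_ne_zero.2 one_ne_zero (hcoeff 1 3 (by decide) d (-1) (by rw [← h3]; module)).2
  have hd : d ≠ 0 := by
    rintro rfl
    exact neg_ne_zero.2 one_ne_zero (hcoeff 0 3 (by decide) c (-1) (by rw [← h3]; module)).2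
  refine ⟨a, b, c, d, h01, ha, hb, hc, hd, fun hdet => hd (hcoeff 2 3 (by decide) d (-b) ?_).1,
    h2.symm, h3.symm⟩
  calc d • (x 2).rep + (-b) • (x 3).rep = (a * d - b * c) • (x 0).rep := by
        rw [← h2, ← h3]
        module
    _ = 0 := by rw [hdet, zero_smul]

theorem toProj_mem_Fconf {k i n : ℕ} {w : Fin k → Fin (n + 1) → ℂ}
    (hw : ∀ j, w j ≠ 0) (hli : Pairwise fun j l => LinearIndependent ℂ ![w j, w l])
    (hrank : finrank ℂ (span ℂ (Set.range w)) = i + 1) :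
    (fun j => toProj (w j)) ∈ Fconf k i n := by
  refine ⟨fun j l h => ?_, ?_⟩
  · by_contra hjl
    exact (toProj_ne_toProj_iff (hw j) (hw l)).2 (hli hjl) h
  · rw [← hrank, span_range_eq_iSup, span_range_eq_iSup]
    have (j : Fin k) : span ℂ {(toProj (w j)).rep} = span ℂ {w j} := by
      rw [← Projectivization.submodule_eq, toProj_of_ne_zero (hw j), Projectivization.submodule_mk]
    exact congrArg (fun p : Submodule ℂ (Fin (n + 1) → ℂ) => finrank ℂ p) (iSup_congr this)

/-- The vectors `v`, `w`, `v + w` and `v + l • w`. -/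
def planarVectors (v w : Fin 3 → ℂ) (l : ℂ) : Fin 4 → Fin 3 → ℂ :=
  ![v, w, v + w, v + l • w]

theorem isPlanarQuadruple_planarVectors {v w : Fin 3 → ℂ} (h : LinearIndependent ℂ ![v, w])
    {l : ℂ} (hl : l ∈ puncturedPlane) : IsPlanarQuadruple (planarVectors v w l) 1 1 1 l where
  linearIndependent := h
  left_ne_zero := one_ne_zero
  right_ne_zero := one_ne_zero
  left_ne_zero' := one_ne_zero
  right_ne_zero' := hl.1
  det_ne_zero := by simpa [sub_eq_zero] using hl.2
  third_eq := by simp [planarVectors]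
  fourth_eq := by simp [planarVectors]

theorem pairwise_linearIndependent_planarVectors {v w : Fin 3 → ℂ}
    (h : LinearIndependent ℂ ![v, w]) {l : ℂ} (hl : l ∈ puncturedPlane) :
    Pairwise fun i j => LinearIndependent ℂ ![planarVectors v w l i, planarVectors v w l j] := by
  have hp : ∀ i, planarVectors v w l i =
      (![1, 0, 1, 1] : Fin 4 → ℂ) i • v + (![0, 1, 1, l] : Fin 4 → ℂ) i • w := by
    intro i
    fin_cases i <;> simp [planarVectors]
  intro i j hij
  rw [hp i, hp j]
  refine (LinearIndependent.pair_add_smul_add_smul_iff _ _ _ _).2 ⟨h, ?_⟩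
  have h0 := hl.1
  have h0' := hl.1.symm
  have h1 := hl.2
  have h1' := hl.2.symm
  fin_cases i <;> fin_cases j <;> simp_all

theorem planarVectors_ne_zero {v w : Fin 3 → ℂ} (h : LinearIndependent ℂ ![v, w]) {l : ℂ}
    (hl : l ∈ puncturedPlane) (i : Fin 4) : planarVectors v w l i ≠ 0 := by
  obtain ⟨j, hj⟩ := exists_ne i
  exact (pairwise_linearIndependent_planarVectors h hl hj.symm).ne_zero 0

theorem toProj_planarVectors_mem_Fconf {v w : Fin 3 → ℂ} (h : LinearIndependent ℂ ![v, w]) {l : ℂ}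
    (hl : l ∈ puncturedPlane) : (fun i => toProj (planarVectors v w l i)) ∈ Fconf 4 1 2 := by
  have hli := pairwise_linearIndependent_planarVectors h hl
  refine toProj_mem_Fconf (planarVectors_ne_zero h hl) hli ?_
  have : span ℂ (Set.range (planarVectors v w l)) = span ℂ (Set.range ![v, w]) := by
    refine le_antisymm (span_le.2 ?_) (span_mono ?_)
    · rw [Matrix.range_cons_cons_empty]
      rintro _ ⟨i, rfl⟩
      refine mem_span_pair.2 ⟨(![1, 0, 1, 1] : Fin 4 → ℂ) i, (![0, 1, 1, l] : Fin 4 → ℂ) i, ?_⟩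
      fin_cases i <;> simp [planarVectors]
    · rintro _ ⟨i, rfl⟩
      fin_cases i
      exacts [⟨0, rfl⟩, ⟨1, rfl⟩]
  rw [this, finrank_span_eq_card h, Fintype.card_fin]

/-- The pair of multiples of the first two vectors whose sum is a multiple of the third one. -/
def normalizedPair (w : Fin 4 → Fin 3 → ℂ) : (Fin 3 → ℂ) × (Fin 3 → ℂ) :=
  (gramCoeff (w 0) (w 1) (w 2) • w 0, gramCoeff (w 1) (w 0) (w 2) • w 1)

/-- The cross-ratio of four coplanar vectors. -/
def crossRatio (w : Fin 4 → Fin 3 → ℂ) : ℂ :=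
  gramCoeff (w 0) (w 1) (w 2) * gramCoeff (w 1) (w 0) (w 3) /
    (gramCoeff (w 1) (w 0) (w 2) * gramCoeff (w 0) (w 1) (w 3))

theorem toProj_normalizedPair_smul (s : Fin 4 → ℂ) (w : Fin 4 → Fin 3 → ℂ) (hs : ∀ i, s i ≠ 0) :
    toProj (normalizedPair fun i => s i • w i) = toProj (normalizedPair w) := by
  have hne : conj (s 0) * conj (s 1) * s 0 * s 1 * s 2 ≠ 0 := by
    simp [hs]
  rw [← toProj_smul hne (normalizedPair w)]
  congr 1
  simp only [normalizedPair, gramCoeff_smul_smul_smul, Prod.smul_mk]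
  congr 1 <;> module

theorem crossRatio_smul (s : Fin 4 → ℂ) (w : Fin 4 → Fin 3 → ℂ) (hs : ∀ i, s i ≠ 0) :
    crossRatio (fun i => s i • w i) = crossRatio w := by
  have hne : (conj (s 0) * conj (s 1) * s 0 * s 2) * (conj (s 0) * conj (s 1) * s 1 * s 3) ≠ 0 := by
    simp [hs]
  simp only [crossRatio, gramCoeff_smul_smul_smul]
  rw [← mul_div_mul_left _ (gramCoeff (w 1) (w 0) (w 2) * gramCoeff (w 0) (w 1) (w 3)) hne]
  congr 1 <;> ring

namespace IsPlanarQuadruple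

variable {w : Fin 4 → Fin 3 → ℂ} {a b c d : ℂ}

theorem gram_ne_zero (h : IsPlanarQuadruple w a b c d) : gramCoeff (w 0) (w 1) (w 0) ≠ 0 :=
  gramCoeff_self_ne_zero h.linearIndependent

theorem normalizedPair_eq (h : IsPlanarQuadruple w a b c d) :
    normalizedPair w = gramCoeff (w 0) (w 1) (w 0) • (a • w 0, b • w 1) := by
  rw [normalizedPair, h.third_eq, gramCoeff_smul_add_smul, gramCoeff_smul_add_smul_right]
  simp only [Prod.smul_mk, smul_smul, mul_comm]

theorem crossRatio_eq (h : IsPlanarQuadruple w a b c d) :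
    crossRatio w = a * d / (b * c) := by
  have := h.gram_ne_zero
  rw [crossRatio, h.third_eq, h.fourth_eq, gramCoeff_smul_add_smul, gramCoeff_smul_add_smul_right,
    gramCoeff_smul_add_smul, gramCoeff_smul_add_smul_right]
  rw [← mul_div_mul_left (a * d) (b * c) (mul_ne_zero this this)]
  congr 1 <;> ring

theorem crossRatio_denom_ne_zero (h : IsPlanarQuadruple w a b c d) :
    gramCoeff (w 1) (w 0) (w 2) * gramCoeff (w 0) (w 1) (w 3) ≠ 0 := by
  rw [h.third_eq, h.fourth_eq, gramCoeff_smul_add_smul, gramCoeff_smul_add_smul_right]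
  exact mul_ne_zero (mul_ne_zero h.right_ne_zero h.gram_ne_zero)
    (mul_ne_zero h.left_ne_zero' h.gram_ne_zero)

theorem crossRatio_mem (h : IsPlanarQuadruple w a b c d) : crossRatio w ∈ puncturedPlane := by
  have hbc := mul_ne_zero h.right_ne_zero h.left_ne_zero'
  rw [h.crossRatio_eq]
  refine ⟨div_ne_zero (mul_ne_zero h.left_ne_zero h.right_ne_zero') hbc, fun h1 => ?_⟩
  rw [div_eq_one_iff_eq hbc] at h1
  exact h.det_ne_zero (sub_eq_zero.2 h1)

theorem linearIndependent_normalizedPair (h : IsPlanarQuadruple w a b c d) :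
    LinearIndependent ℂ ![(normalizedPair w).1, (normalizedPair w).2] := by
  rw [h.normalizedPair_eq]
  exact (h.linearIndependent.pair_smul_smul h.left_ne_zero h.right_ne_zero).pair_smul_smul
    h.gram_ne_zero h.gram_ne_zero

theorem toProj_planarVectors_normalizedPair (h : IsPlanarQuadruple w a b c d) (i : Fin 4) :
    toProj (planarVectors (normalizedPair w).1 (normalizedPair w).2 (crossRatio w) i) =
      toProj (w i) := by
  have hg := h.gram_ne_zero
  have ha := h.left_ne_zero
  have hb := h.right_ne_zero
  have hc := h.left_ne_zero'
  rw [h.normalizedPair_eq, h.crossRatio_eq]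
  set g := gramCoeff (w 0) (w 1) (w 0)
  fin_cases i
  · simp [planarVectors, toProj_smul, hg, ha]
  · simp [planarVectors, toProj_smul, hg, hb]
  · simp only [planarVectors, Prod.smul_mk, Fin.reduceFinMk, Matrix.cons_val]
    rw [h.third_eq, ← smul_add, toProj_smul hg]
  · simp only [planarVectors, Prod.smul_mk, Fin.reduceFinMk, Matrix.cons_val]
    rw [h.fourth_eq, ← toProj_smul (div_ne_zero (mul_ne_zero hg ha) hc) (c • w 0 + d • w 1)]
    congr 1
    match_scalars <;> field_simp

end IsPlanarQuadruple

end Collinear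

section FourCollinear

theorem toProj_planarVectors_smul {a : ℂ} (ha : a ≠ 0) (v w : Fin 3 → ℂ) (l : ℂ) (i : Fin 4) :
    toProj (planarVectors (a • v) (a • w) l i) = toProj (planarVectors v w l i) := by
  have : planarVectors (a • v) (a • w) l i = a • planarVectors v w l i := by
    fin_cases i <;> simp [planarVectors, smul_comm a l]
  rw [this, toProj_smul ha]

/-- The four collinear points given by a pair of vectors and a cross-ratio. -/
def fourPoints : C(pairSpace × puncturedPlane, Fconf 4 1 2) where
  toFun p := ⟨fun i => toProj (planarVectors p.1.1.rep.1 p.1.1.rep.2 p.2 i),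
    toProj_planarVectors_mem_Fconf p.1.2 p.2.2⟩
  continuous_toFun := by
    refine Continuous.subtype_mk (continuous_pi fun i => continuous_iff_continuousAt.2 ?_) _
    rintro ⟨z, l⟩
    refine ContinuousAt.comp (g := fun p => toProj (planarVectors p.1.rep.1 p.1.rep.2 p.2 i))
      (f := fun p : pairSpace × puncturedPlane => (p.1.1, p.2.1))
      (x := (z, l)) (continuousAt_comp_rep (z := l.1)
        (F := fun q : ((Fin 3 → ℂ) × (Fin 3 → ℂ)) × ℂ => toProj (planarVectors q.1.1 q.1.2 q.2 i))
        (fun a v l ha => toProj_planarVectors_smul ha _ _ _ _) ?_)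
      ((continuous_subtype_val.comp continuous_fst).prodMk
        (continuous_subtype_val.comp continuous_snd)).continuousAt
    refine ContinuousAt.comp (x := (z.1.rep, l.1))
      (f := fun q : ((Fin 3 → ℂ) × (Fin 3 → ℂ)) × ℂ => planarVectors q.1.1 q.1.2 q.2 i)
      (continuousAt_toProj (planarVectors_ne_zero z.2 l.2 i)) ?_
    refine Continuous.continuousAt ?_
    fin_cases i <;> simp only [planarVectors, Fin.reduceFinMk, Matrix.cons_val] <;> fun_prop

/-- The point of `pairSpace` given by four collinear points. -/
def fourPointsPair : C(Fconf 4 1 2, pairSpace) where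
  toFun x := ⟨toProj (normalizedPair fun i => (x.1 i).rep), by
    obtain ⟨a, b, c, d, h⟩ := exists_isPlanarQuadruple_of_mem_Fconf x.2
    exact toProj_mem_pairSpace h.linearIndependent_normalizedPair⟩
  continuous_toFun := by
    refine Continuous.subtype_mk (continuous_iff_continuousAt.2 fun x => ?_) _
    refine ContinuousAt.comp (f := Subtype.val) (continuousAt_comp_rep_pi
      (F := fun w : Fin 4 → Fin 3 → ℂ => toProj (normalizedPair w))
      toProj_normalizedPair_smul ?_) continuousAt_subtype_val
    obtain ⟨a, b, c, d, h⟩ := exists_isPlanarQuadruple_of_mem_Fconf x.2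
    refine (continuousAt_toProj ?_).comp (f := normalizedPair) (Continuous.continuousAt ?_)
    · exact fun h0 => h.linearIndependent_normalizedPair.ne_zero 0 (congrArg Prod.fst h0)
    · exact ((continuous_gramCoeff (continuous_apply 0) (continuous_apply 1)
        (continuous_apply 2)).smul (continuous_apply 0)).prodMk
        ((continuous_gramCoeff (continuous_apply 1) (continuous_apply 0)
        (continuous_apply 2)).smul (continuous_apply 1))

/-- The cross-ratio of four collinear points. -/
def fourPointsCrossRatio : C(Fconf 4 1 2, puncturedPlane) where
  toFun x := ⟨crossRatio fun i => (x.1 i).rep, by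
    obtain ⟨a, b, c, d, h⟩ := exists_isPlanarQuadruple_of_mem_Fconf x.2
    exact h.crossRatio_mem⟩
  continuous_toFun := by
    refine Continuous.subtype_mk (continuous_iff_continuousAt.2 fun x => ?_) _
    refine ContinuousAt.comp (f := Subtype.val) (continuousAt_comp_rep_pi
      (F := crossRatio) crossRatio_smul ?_) continuousAt_subtype_val
    obtain ⟨a, b, c, d, h⟩ := exists_isPlanarQuadruple_of_mem_Fconf x.2
    refine ContinuousAt.div (Continuous.continuousAt ?_) (Continuous.continuousAt ?_)
      h.crossRatio_denom_ne_zero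
    · exact (continuous_gramCoeff (continuous_apply 0) (continuous_apply 1)
        (continuous_apply 2)).mul (continuous_gramCoeff (continuous_apply 1)
        (continuous_apply 0) (continuous_apply 3))
    · exact (continuous_gramCoeff (continuous_apply 1) (continuous_apply 0)
        (continuous_apply 2)).mul (continuous_gramCoeff (continuous_apply 0)
        (continuous_apply 1) (continuous_apply 3))

theorem fourPoints_fourPointsPair_fourPointsCrossRatio (x : Fconf 4 1 2) :
    fourPoints (fourPointsPair x, fourPointsCrossRatio x) = x := by
  obtain ⟨a, b, c, d, h⟩ := exists_isPlanarQuadruple_of_mem_Fconf x.2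
  refine Subtype.ext (funext fun i => ?_)
  have hne : normalizedPair (fun i => (x.1 i).rep) ≠ 0 := fun h0 =>
    h.linearIndependent_normalizedPair.ne_zero 0 (congrArg Prod.fst h0)
  obtain ⟨s, hs, hrep⟩ := exists_rep_toProj_eq_smul hne
  simp only [fourPoints, fourPointsPair, fourPointsCrossRatio, ContinuousMap.coe_mk, hrep]
  exact (toProj_planarVectors_smul hs _ _ _ _).trans
    ((h.toProj_planarVectors_normalizedPair i).trans (toProj_rep _))

theorem fourPointsCrossRatio_fourPoints (z : pairSpace) (l : puncturedPlane) :
    fourPointsCrossRatio (fourPoints (z, l)) = l := by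
  refine Subtype.ext ?_
  choose s hs hrep using fun i => exists_rep_toProj_eq_smul (planarVectors_ne_zero z.2 l.2 i)
  simp only [fourPoints, fourPointsCrossRatio, ContinuousMap.coe_mk, hrep]
  rw [crossRatio_smul s _ hs, (isPlanarQuadruple_planarVectors z.2 l.2).crossRatio_eq]
  simp

end FourCollinear

/-- The fundamental group of `F_4^{1,2}`, the space of `4` distinct collinear points
in `ℂP²`, is free on two generators. -/
theorem pi1_Fconf_four_collinear (x : Fconf 4 1 2) :
    Nonempty (FundamentalGroup (Fconf 4 1 2) x ≃* FreeGroup (Fin 2)) := by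
  obtain ⟨e⟩ := FundamentalGroup.nonempty_mulEquiv_of_prod_retract fourPointsCrossRatio
    fourPointsPair fourPoints fourPoints_fourPointsPair_fourPointsCrossRatio
    fourPointsCrossRatio_fourPoints x
  obtain ⟨e'⟩ := nonempty_fundamentalGroup_puncturedPlane_mulEquiv (fourPointsCrossRatio x)
  exact ⟨e.trans e'⟩
end
end

section
/- Let S² denote the unit sphere in ℝ³ and let f, g : S² → S² be continuous maps such that f(x) ≠ x for all x ∈ S² and g(x) ≠ x for all x ∈ S². Then there exists a point x ∈ S² with f(x) = g(x). -/
open Complex in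
/-- A continuous nowhere vanishing function `ℂ → ℂ` has a continuous logarithm. -/
theorem exists_continuous_exp_eq {h : ℂ → ℂ} (hc : Continuous h) (h0 : ∀ z, h z ≠ 0) :
    ∃ a : ℂ → ℂ, Continuous a ∧ ∀ z, exp (a z) = h z := by
  obtain ⟨⟨a, ha⟩, ⟨-, ha'⟩, -⟩ := isCoveringMapOn_exp.existsUnique_continuousMap_lifts
    ⟨h, hc⟩ (exp_log (h0 0)) (fun z ↦ h0 z)
  exact ⟨a, ha, fun z ↦ congrFun ha' z⟩

open Complex in
/-- The function `z ↦ z ^ 2` has no continuous logarithm on the unit circle. -/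
theorem not_exp_eq_sq_on_unit_circle {c : ℂ → ℂ} (hc : Continuous c)
    (h : ∀ z : ℂ, ‖z‖ = 1 → exp (c z) = z ^ 2) : False := by
  have h1 : exp (c 1) = 1 := by simpa using h 1 (by simp)
  have key : (fun t : ℝ ↦ 2 * (t * I) + c 1) = fun t : ℝ ↦ c (exp (t * I)) := by
    refine isCoveringMap_exp.eq_of_comp_eq (by fun_prop) (by fun_prop) ?_ (0 : ℝ) (by simp)
    funext t
    apply Subtype.ext
    simp only [Function.comp_apply]
    rw [exp_add, h1, h _ (norm_exp_ofReal_mul_I t), mul_one, ← exp_nat_mul]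
    norm_num
  have := congrFun key (2 * Real.pi)
  simp [exp_two_pi_mul_I] at this

/-- The inverse stereographic projection `ℂ → S²` from the pole `(0, 0, ε)`, where `ε ^ 2 = 1`. -/
noncomputable def invStereo (ε : ℝ) (hε : ε ^ 2 = 1) (z : ℂ) :
    Metric.sphere (0 : EuclideanSpace ℝ (Fin 3)) 1 :=
  ⟨!₂[2 * z.re / (1 + z.re ^ 2 + z.im ^ 2), 2 * z.im / (1 + z.re ^ 2 + z.im ^ 2),
      ε * (z.re ^ 2 + z.im ^ 2 - 1) / (1 + z.re ^ 2 + z.im ^ 2)], by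
    have : 1 + z.re ^ 2 + z.im ^ 2 ≠ 0 := by positivity
    rw [mem_sphere_zero_iff_norm, ← sq_eq_sq₀ (norm_nonneg _) zero_le_one,
      EuclideanSpace.real_norm_sq_eq]
    simp only [Fin.sum_univ_three, Matrix.cons_val]
    field_simp
    rw [hε]
    ring⟩

theorem continuous_invStereo (ε : ℝ) (hε : ε ^ 2 = 1) : Continuous (invStereo ε hε) := by
  refine Continuous.subtype_mk ((PiLp.continuous_toLp 2 _).comp (continuous_pi fun i ↦ ?_)) _
  have : ∀ z : ℂ, 1 + z.re ^ 2 + z.im ^ 2 ≠ 0 := fun z ↦ by positivity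
  fin_cases i <;> simp <;> fun_prop (disch := assumption)

/-- Up to a positive factor, the image of the vector `v` at the point `p` of the sphere under the
differential of the stereographic projection from the pole `(0, 0, ε)`. -/
def stereoVec (ε : ℝ) (p v : EuclideanSpace ℝ (Fin 3)) : ℂ :=
  ⟨v 0 * (1 - ε * p 2) + ε * p 0 * v 2, v 1 * (1 - ε * p 2) + ε * p 1 * v 2⟩

theorem Continuous.stereoVec {X : Type*} [TopologicalSpace X] (ε : ℝ)
    {p v : X → EuclideanSpace ℝ (Fin 3)} (hp : Continuous p) (hv : Continuous v) :
    Continuous fun x ↦ stereoVec ε (p x) (v x) := by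
  simp only [_root_.stereoVec, Complex.mk_eq_add_mul_I]
  fun_prop

theorem stereoVec_ne_zero {ε : ℝ} (hε : ε ^ 2 = 1) {p v : EuclideanSpace ℝ (Fin 3)}
    (hp : p 0 ^ 2 + p 1 ^ 2 + p 2 ^ 2 = 1) (hpε : 1 - ε * p 2 ≠ 0)
    (hpv : p 0 * v 0 + p 1 * v 1 + p 2 * v 2 = 0) (hv : v ≠ 0) : stereoVec ε p v ≠ 0 := by
  intro h
  have hre : v 0 * (1 - ε * p 2) + ε * p 0 * v 2 = 0 := congrArg Complex.re h
  have him : v 1 * (1 - ε * p 2) + ε * p 1 * v 2 = 0 := congrArg Complex.im h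
  have h2 : v 2 = 0 := by
    have : (1 - ε * p 2) * v 2 = 0 := by
      linear_combination ε * p 0 * hre + ε * p 1 * him - ε * (1 - ε * p 2) * hpv
        - ε ^ 2 * v 2 * hp - v 2 * hε
    exact (mul_eq_zero.mp this).resolve_left hpε
  have h0 : v 0 = 0 := by simpa [h2, hpε] using hre
  have h1 : v 1 = 0 := by simpa [h2, hpε] using him
  apply hv
  ext i
  fin_cases i <;> simpa

theorem exists_log_stereoVec {ε : ℝ} (hε : ε ^ 2 = 1)
    {T : Metric.sphere (0 : EuclideanSpace ℝ (Fin 3)) 1 → EuclideanSpace ℝ (Fin 3)}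
    (hT : Continuous T) (horth : ∀ x, inner ℝ x.1 (T x) = 0)
    (hne : ∀ x, T x ≠ 0) :
    ∃ a : ℂ → ℂ, Continuous a ∧
      ∀ z, Complex.exp (a z) = stereoVec ε (invStereo ε hε z) (T (invStereo ε hε z)) := by
  have hcont := continuous_invStereo ε hε
  refine exists_continuous_exp_eq
    ((continuous_subtype_val.comp hcont).stereoVec ε (hT.comp hcont))
    fun z ↦ stereoVec_ne_zero hε ?_ ?_ ?_ (hne _)
  · have := EuclideanSpace.real_norm_sq_eq (invStereo ε hε z : EuclideanSpace ℝ (Fin 3))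
    rw [norm_eq_of_mem_sphere, Fin.sum_univ_three] at this
    linarith
  · have hz : 0 < 1 + z.re ^ 2 + z.im ^ 2 := by positivity
    have : 1 - ε * (invStereo ε hε z : EuclideanSpace ℝ (Fin 3)) 2
        = 2 / (1 + z.re ^ 2 + z.im ^ 2) := by
      simp only [invStereo, Matrix.cons_val]
      field_simp
      rw [hε]
      ring
    rw [this]
    positivity
  · have := horth (invStereo ε hε z)
    rw [PiLp.inner_apply, Fin.sum_univ_three] at this
    simp only [RCLike.inner_apply, conj_trivial] at this
    linarith

/-- The hairy ball theorem: a continuous tangent vector field on `S²` has a zero. -/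
theorem exists_zero_of_tangent_field
    {T : Metric.sphere (0 : EuclideanSpace ℝ (Fin 3)) 1 → EuclideanSpace ℝ (Fin 3)}
    (hT : Continuous T) (horth : ∀ x, inner ℝ x.1 (T x) = 0) :
    ∃ x, T x = 0 := by
  by_contra! hne
  obtain ⟨a, ha, ha'⟩ := exists_log_stereoVec (ε := 1) (by norm_num) hT horth hne
  obtain ⟨b, hb, hb'⟩ := exists_log_stereoVec (ε := -1) (by norm_num) hT horth hne
  refine not_exp_eq_sq_on_unit_circle
    (c := fun z ↦ a z - starRingEnd ℂ (b z) + Real.pi * Complex.I) (by fun_prop) fun z hz ↦ ?_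
  have hz2 : z.re ^ 2 + z.im ^ 2 = 1 := by
    rw [← Complex.normSq_add_mul_I, Complex.re_add_im, Complex.normSq_eq_norm_sq, hz, one_pow]
  have hden : 1 + z.re ^ 2 + z.im ^ 2 = 2 := by linarith
  have hp : invStereo (-1) (by norm_num) z = invStereo 1 (by norm_num) z := by
    apply Subtype.ext
    simp [invStereo, hz2]
  have hb0 := Complex.exp_ne_zero (starRingEnd ℂ (b z))
  rw [Complex.exp_add, Complex.exp_pi_mul_I, Complex.exp_sub, mul_neg_one, ← neg_div,
    div_eq_iff hb0, Complex.exp_conj, ha', hb', hp]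
  set p := invStereo 1 (by norm_num) z with hpdef
  have hp0 : (p : EuclideanSpace ℝ (Fin 3)) 0 = z.re := by simp [hpdef, invStereo, hden]
  have hp1 : (p : EuclideanSpace ℝ (Fin 3)) 1 = z.im := by simp [hpdef, invStereo, hden]
  have hp2 : (p : EuclideanSpace ℝ (Fin 3)) 2 = 0 := by simp [hpdef, invStereo, hz2]
  have ho := horth p
  rw [PiLp.inner_apply, Fin.sum_univ_three] at ho
  simp only [RCLike.inner_apply, conj_trivial, hp0, hp1, hp2, mul_zero, add_zero] at ho
  apply Complex.ext
  · simp [stereoVec, hp0, hp1, hp2, pow_two]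
    linear_combination (T p 0 + z.re * T p 2) * hz2 - 2 * z.re * ho
  · simp [stereoVec, hp0, hp1, hp2, pow_two]
    linear_combination (T p 1 + z.im * T p 2) * hz2 - 2 * z.im * ho

/-- Inverting a point `y ≠ x` of the unit sphere in the unit sphere centred at `x` gives a point
of the affine plane `⟪x, ·⟫ = 1 / 2`. -/
theorem inner_inversion_of_mem_sphere {E : Type*} [NormedAddCommGroup E] [InnerProductSpace ℝ E]
    {x y : E} (hx : ‖x‖ = 1) (hy : ‖y‖ = 1) (hxy : y ≠ x) :
    inner ℝ x (EuclideanGeometry.inversion x 1 y) = 1 / 2 := by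
  have hd : ‖y - x‖ ≠ 0 := norm_ne_zero_iff.mpr (sub_ne_zero.mpr hxy)
  have hsq : ‖y - x‖ ^ 2 = 2 * (1 - inner ℝ x y) := by
    rw [norm_sub_sq_real, hx, hy, real_inner_comm]
    ring
  rw [EuclideanGeometry.inversion, dist_eq_norm, vsub_eq_sub, vadd_eq_add, inner_add_right,
    inner_smul_right, inner_sub_right, real_inner_self_eq_norm_sq, hx]
  field_simp
  linarith

/-- If `f, g : S² → S²` are continuous maps of the unit sphere of `ℝ³` without fixed
points, then `f(x) = g(x)` for some `x ∈ S²`. -/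
theorem exists_coincidence_of_fixedPointFree
    (f g : Metric.sphere (0 : EuclideanSpace ℝ (Fin 3)) 1 →
      Metric.sphere (0 : EuclideanSpace ℝ (Fin 3)) 1)
    (hf : Continuous f) (hg : Continuous g)
    (hf' : ∀ x, f x ≠ x) (hg' : ∀ x, g x ≠ x) :
    ∃ x, f x = g x := by
  have hfv x : (f x : EuclideanSpace ℝ (Fin 3)) ≠ x := Subtype.coe_injective.ne (hf' x)
  have hgv x : (g x : EuclideanSpace ℝ (Fin 3)) ≠ x := Subtype.coe_injective.ne (hg' x)
  obtain ⟨x, hx⟩ := exists_zero_of_tangent_field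
    (T := fun x ↦ EuclideanGeometry.inversion (x : EuclideanSpace ℝ (Fin 3)) 1 (f x)
      - EuclideanGeometry.inversion (x : EuclideanSpace ℝ (Fin 3)) 1 (g x))
    ((continuous_subtype_val.inversion continuous_const (by fun_prop) hfv).sub
      (continuous_subtype_val.inversion continuous_const (by fun_prop) hgv))
    fun x ↦ by
      rw [inner_sub_right,
        inner_inversion_of_mem_sphere (norm_eq_of_mem_sphere x) (norm_eq_of_mem_sphere _) (hfv x),
        inner_inversion_of_mem_sphere (norm_eq_of_mem_sphere x) (norm_eq_of_mem_sphere _) (hgv x),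
        sub_self]
  exact ⟨x, Subtype.ext (EuclideanGeometry.inversion_injective _ one_ne_zero (sub_eq_zero.mp hx))⟩
end
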